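/- Let n, n' ≥ 1 and 0 ≤ r ≤ n, 0 ≤ r' ≤ n' be integers, and let Λ ∈ M_n(k*) and Λ' ∈ M_{n'}(k*) be multiplicatively antisymmetric. Let (D, ι) be a division ring of fractions of S_{n,r}^Λ(k) and (D', ι') a division ring of fractions of S_{n',r'}^{Λ'}(k). If D and D' are isomorphic as k-algebras, then: (1) n = n' and r = r'; and (2) if moreover the quantum torus O_Λ((k*)^n) is a simple ring, then the quantum tori O_Λ((k*)^n) and O_{Λ'}((k*)^{n'}) are isomorphic as k-algebras. -/

import Mathlib

universe u

/-- A matrix is multiplicatively antisymmetric if `Λ i i = 1` and `Λ i j * Λ j i = 1`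
for all `i, j`. -/
def Matrix.MulAntisymmetric {k : Type u} [Field k] {n : ℕ}
    (Λ : Matrix (Fin n) (Fin n) k) : Prop :=
  (∀ i, Λ i i = 1) ∧ ∀ i j, Λ i j * Λ j i = 1

inductive QTorusRel (k : Type u) [Field k] {n : ℕ} (Λ : Matrix (Fin n) (Fin n) k) :
    FreeAlgebra k (Fin n ⊕ Fin n) → FreeAlgebra k (Fin n ⊕ Fin n) → Prop
  | comm (i j : Fin n) :
      QTorusRel k Λ (FreeAlgebra.ι k (Sum.inl i) * FreeAlgebra.ι k (Sum.inl j))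
        (algebraMap k _ (Λ i j) * (FreeAlgebra.ι k (Sum.inl j) * FreeAlgebra.ι k (Sum.inl i)))
  | mul_inv (i : Fin n) :
      QTorusRel k Λ (FreeAlgebra.ι k (Sum.inl i) * FreeAlgebra.ι k (Sum.inr i)) 1
  | inv_mul (i : Fin n) :
      QTorusRel k Λ (FreeAlgebra.ι k (Sum.inr i) * FreeAlgebra.ι k (Sum.inl i)) 1

/-- The quantum torus `O_Λ((k*)^n)`. -/
def QuantumTorus (k : Type u) [Field k] {n : ℕ} (Λ : Matrix (Fin n) (Fin n) k) :=
  RingQuot (QTorusRel k Λ)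

noncomputable instance (k : Type u) [Field k] {n : ℕ} (Λ : Matrix (Fin n) (Fin n) k) :
    Ring (QuantumTorus k Λ) := by unfold QuantumTorus; infer_instance

noncomputable instance (k : Type u) [Field k] {n : ℕ} (Λ : Matrix (Fin n) (Fin n) k) :
    Algebra k (QuantumTorus k Λ) := by unfold QuantumTorus; infer_instance

/-- The generator `y_i` of the quantum torus. -/
noncomputable def QuantumTorus.y (k : Type u) [Field k] {n : ℕ}
    (Λ : Matrix (Fin n) (Fin n) k) (i : Fin n) : QuantumTorus k Λ :=
  RingQuot.mkAlgHom k (QTorusRel k Λ) (FreeAlgebra.ι k (Sum.inl i))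

/-- The generator `y_i⁻¹` of the quantum torus. -/
noncomputable def QuantumTorus.yinv (k : Type u) [Field k] {n : ℕ}
    (Λ : Matrix (Fin n) (Fin n) k) (i : Fin n) : QuantumTorus k Λ :=
  RingQuot.mkAlgHom k (QTorusRel k Λ) (FreeAlgebra.ι k (Sum.inr i))


inductive MixedCrossedRel (k : Type u) [Field k] {n : ℕ} (Λ : Matrix (Fin n) (Fin n) k)
    (r : ℕ) (hr : r ≤ n) :
    FreeAlgebra k (Fin n ⊕ Fin r) → FreeAlgebra k (Fin n ⊕ Fin r) → Prop
  | yy (i j : Fin n) :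
      MixedCrossedRel k Λ r hr
        (FreeAlgebra.ι k (Sum.inl i) * FreeAlgebra.ι k (Sum.inl j))
        (algebraMap k _ (Λ i j) * (FreeAlgebra.ι k (Sum.inl j) * FreeAlgebra.ι k (Sum.inl i)))
  | xy_same (i : Fin r) :
      MixedCrossedRel k Λ r hr
        (FreeAlgebra.ι k (Sum.inr i) * FreeAlgebra.ι k (Sum.inl (Fin.castLE hr i)))
        (FreeAlgebra.ι k (Sum.inl (Fin.castLE hr i)) * FreeAlgebra.ι k (Sum.inr i) + 1)
  | xy_ne (i : Fin r) (j : Fin n) (hij : Fin.castLE hr i ≠ j) :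
      MixedCrossedRel k Λ r hr
        (FreeAlgebra.ι k (Sum.inr i) * FreeAlgebra.ι k (Sum.inl j))
        (algebraMap k _ (Λ (Fin.castLE hr i) j)⁻¹ *
          (FreeAlgebra.ι k (Sum.inl j) * FreeAlgebra.ι k (Sum.inr i)))
  | xx (i j : Fin r) :
      MixedCrossedRel k Λ r hr
        (FreeAlgebra.ι k (Sum.inr i) * FreeAlgebra.ι k (Sum.inr j))
        (algebraMap k _ (Λ (Fin.castLE hr i) (Fin.castLE hr j)) *
          (FreeAlgebra.ι k (Sum.inr j) * FreeAlgebra.ι k (Sum.inr i)))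

/-- The mixed crossed polynomial algebra `S_{n,r}^Λ(k)`. -/
def MixedCrossedAlgebra (k : Type u) [Field k] {n : ℕ} (Λ : Matrix (Fin n) (Fin n) k)
    (r : ℕ) (hr : r ≤ n) :=
  RingQuot (MixedCrossedRel k Λ r hr)

noncomputable instance (k : Type u) [Field k] {n : ℕ} (Λ : Matrix (Fin n) (Fin n) k)
    (r : ℕ) (hr : r ≤ n) : Ring (MixedCrossedAlgebra k Λ r hr) := by
  unfold MixedCrossedAlgebra; infer_instance

noncomputable instance (k : Type u) [Field k] {n : ℕ} (Λ : Matrix (Fin n) (Fin n) k)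
    (r : ℕ) (hr : r ≤ n) : Algebra k (MixedCrossedAlgebra k Λ r hr) := by
  unfold MixedCrossedAlgebra; infer_instance

/-- The generator `y_j` of `S_{n,r}^Λ(k)`. -/
noncomputable def MixedCrossedAlgebra.y (k : Type u) [Field k] {n : ℕ}
    (Λ : Matrix (Fin n) (Fin n) k) (r : ℕ) (hr : r ≤ n) (j : Fin n) :
    MixedCrossedAlgebra k Λ r hr :=
  RingQuot.mkAlgHom k (MixedCrossedRel k Λ r hr) (FreeAlgebra.ι k (Sum.inl j))

/-- The generator `x_i` of `S_{n,r}^Λ(k)`. -/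
noncomputable def MixedCrossedAlgebra.x (k : Type u) [Field k] {n : ℕ}
    (Λ : Matrix (Fin n) (Fin n) k) (r : ℕ) (hr : r ≤ n) (i : Fin r) :
    MixedCrossedAlgebra k Λ r hr :=
  RingQuot.mkAlgHom k (MixedCrossedRel k Λ r hr) (FreeAlgebra.ι k (Sum.inr i))


structure FractionDivisionRing (k : Type u) [Field k] (A : Type u) [Ring A] [Algebra k A] where
  carrier : Type u
  [divisionRing : DivisionRing carrier]
  [algebra : Algebra k carrier]
  emb : A →ₐ[k] carrier
  emb_injective : Function.Injective emb
  frac : ∀ d : carrier, ∃ a b : A, b ≠ 0 ∧ d = emb a * (emb b)⁻¹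

attribute [instance] FractionDivisionRing.divisionRing FractionDivisionRing.algebra

/-- The relations satisfied by the units `y_i` and the elements `w_i = y_i x_i` of the
localisation of a mixed crossed polynomial algebra. -/
structure IsQSystem {K B : Type*} [Field K] [Ring B] [Algebra K B] {n r : ℕ} (ι : Fin r → Fin n)
    (lam : Fin n → Fin n → Kˣ) (y : Fin n → Bˣ) (w : Fin r → B) : Prop where
  yy : ∀ i j, (y i : B) * y j = (lam i j : K) • ((y j : B) * y i)
  wy : ∀ i j, w i * y j = y j * (w i + if ι i = j then 1 else 0)
  ww : ∀ i j, w i * w j = w j * w i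

/-- The image of a scalar unit in the units of an algebra. -/
abbrev scalarUnit {K : Type*} (B : Type*) [Field K] [Ring B] [Algebra K B] : Kˣ →* Bˣ :=
  Units.map (algebraMap K B : K →* B)

/-- `IsMonomial U y g a` means that `g` is a product of the `y i`, their inverses and scalars in
`U`, with total exponent `a`. -/
inductive IsMonomial {K B : Type*} [Field K] [Ring B] [Algebra K B] {n : ℕ} (U : Subgroup Kˣ)
    (y : Fin n → Bˣ) : Bˣ → (Fin n → ℤ) → Prop
  | gen (i : Fin n) : IsMonomial U y (y i) (Pi.single i 1)
  | scalar (u : Kˣ) (hu : u ∈ U) : IsMonomial U y (scalarUnit B u) 0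
  | mul {g h : Bˣ} {a b : Fin n → ℤ} : IsMonomial U y g a → IsMonomial U y h b →
      IsMonomial U y (g * h) (a + b)
  | inv {g : Bˣ} {a : Fin n → ℤ} : IsMonomial U y g a → IsMonomial U y g⁻¹ (-a)

/-- The bicharacter `(a, b) ↦ ∏ λ_{ij} ^ (a_i b_j)`. -/
def bichar {G : Type*} [CommGroup G] {n : ℕ} (lam : Fin n → Fin n → G) (a b : Fin n → ℤ) : G :=
  ∏ i, ∏ j, lam i j ^ (a i * b j)

namespace bichar

variable {G : Type*} [CommGroup G] {n : ℕ} (lam : Fin n → Fin n → G)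

theorem add_left (a a' b : Fin n → ℤ) :
    bichar lam (a + a') b = bichar lam a b * bichar lam a' b := by
  simp [bichar, add_mul, zpow_add, Finset.prod_mul_distrib]

theorem add_right (a b b' : Fin n → ℤ) :
    bichar lam a (b + b') = bichar lam a b * bichar lam a b' := by
  simp [bichar, mul_add, zpow_add, Finset.prod_mul_distrib]

theorem zero_left (b : Fin n → ℤ) : bichar lam 0 b = 1 := by simp [bichar]

theorem zero_right (a : Fin n → ℤ) : bichar lam a 0 = 1 := by simp [bichar]

theorem neg_left (a b : Fin n → ℤ) : bichar lam (-a) b = (bichar lam a b)⁻¹ := by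
  simp [bichar]

theorem neg_right (a b : Fin n → ℤ) : bichar lam a (-b) = (bichar lam a b)⁻¹ := by
  simp [bichar]

theorem single_single (i j : Fin n) :
    bichar lam (Pi.single i 1) (Pi.single j 1) = lam i j := by
  classical
  simp only [bichar]
  rw [Finset.prod_eq_single i, Finset.prod_eq_single j]
  · simp
  · intro b _ hb; simp [hb]
  · simp
  · intro b _ hb; simp [hb]
  · simp

end bichar

namespace IsMonomial

variable {K B : Type*} [Field K] [Ring B] [Algebra K B] {n : ℕ} {U : Subgroup Kˣ} {y : Fin n → Bˣ}

theorem one : IsMonomial U y 1 0 := by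
  simpa using IsMonomial.scalar (U := U) (y := y) 1 U.one_mem

theorem pow {g : Bˣ} {a : Fin n → ℤ} (h : IsMonomial U y g a) (m : ℕ) :
    IsMonomial U y (g ^ m) (m • a) := by
  induction m with
  | zero => simpa using one
  | succ m ih => rw [pow_succ, succ_nsmul]; exact ih.mul h

theorem zpow {g : Bˣ} {a : Fin n → ℤ} (h : IsMonomial U y g a) (m : ℤ) :
    IsMonomial U y (g ^ m) (m • a) := by
  cases m with
  | ofNat m => simpa using h.pow m
  | negSucc m => rw [zpow_negSucc, negSucc_zsmul]; exact (h.pow (m + 1)).inv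

theorem congr_exp {g : Bˣ} {a b : Fin n → ℤ} (h : IsMonomial U y g a) (e : a = b) :
    IsMonomial U y g b := e ▸ h

theorem smul {g : Bˣ} {a : Fin n → ℤ} (h : IsMonomial U y g a) {u : Kˣ} (hu : u ∈ U) :
    IsMonomial U y (scalarUnit B u * g) a := by
  simpa using (IsMonomial.scalar u hu).mul h

theorem exists_of_exp (U : Subgroup Kˣ) (y : Fin n → Bˣ) (a : Fin n → ℤ) :
    ∃ g, IsMonomial U y g a := by
  classical
  have h : a = ∑ i, Pi.single i (a i) := (Finset.univ_sum_single a).symm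
  rw [h]
  refine Finset.sum_induction _ (fun a => ∃ g, IsMonomial U y g a) ?_ ⟨1, one⟩ ?_
  · rintro a b ⟨g, hg⟩ ⟨h, hh⟩; exact ⟨_, hg.mul hh⟩
  · intro i _
    refine ⟨_, ((IsMonomial.gen i).zpow (a i)).congr_exp ?_⟩
    rw [← Pi.single_smul]; simp

theorem mem {g : Bˣ} {a : Fin n → ℤ} (h : IsMonomial U y g a) (H : Subgroup Bˣ)
    (hy : ∀ i, y i ∈ H) (hU : ∀ u ∈ U, scalarUnit B u ∈ H) : g ∈ H := by
  induction h with
  | gen i => exact hy i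
  | scalar u hu => exact hU u hu
  | mul _ _ h1 h2 => exact H.mul_mem h1 h2
  | inv _ h => exact H.inv_mem h

theorem scalarUnit_mul_comm (u : Kˣ) (g : Bˣ) : scalarUnit B u * g = g * scalarUnit B u := by
  ext; simpa using Algebra.commutes (u : K) (g : B)

theorem mul_comm' {lam : Fin n → Fin n → Kˣ}
    (hyy : ∀ i j, (y i : B) * y j = (lam i j : K) • ((y j : B) * y i))
    {g h : Bˣ} {a b : Fin n → ℤ} (hg : IsMonomial U y g a) (hh : IsMonomial U y h b) :
    g * h = scalarUnit B (bichar lam a b) * (h * g) := by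
  have key : ∀ {h : Bˣ} {b : Fin n → ℤ} (i : Fin n), IsMonomial U y h b →
      y i * h = scalarUnit B (bichar lam (Pi.single i 1) b) * (h * y i) := by
    intro h b i hh
    induction hh with
    | gen j =>
      ext; rw [bichar.single_single, Units.val_mul, hyy, Algebra.smul_def]; rfl
    | scalar u hu =>
      rw [bichar.zero_right, map_one, one_mul, scalarUnit_mul_comm]
    | @mul g h a b _ _ h1 h2 =>
      rw [bichar.add_right, map_mul, ← mul_assoc, h1, mul_assoc, mul_assoc, h2, ← mul_assoc g,
        ← scalarUnit_mul_comm _ g]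
      simp only [mul_assoc]
    | @inv g a _ h1 =>
      rw [bichar.neg_right, map_inv, eq_inv_mul_iff_mul_eq, eq_inv_mul_iff_mul_eq, ← mul_assoc,
        ← scalarUnit_mul_comm, ← mul_assoc, mul_inv_eq_iff_eq_mul, h1, mul_assoc]
  induction hg with
  | gen i => exact key i hh
  | scalar u hu => rw [bichar.zero_left, map_one, one_mul, scalarUnit_mul_comm]
  | @mul g g' a a' _ _ h1 h2 =>
    rw [bichar.add_left, map_mul, mul_assoc, h2, ← mul_assoc g, ← scalarUnit_mul_comm, mul_assoc,
      ← mul_assoc g, h1]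
    simp only [mul_assoc]
    rw [← mul_assoc, ← mul_assoc (scalarUnit B _), ← scalarUnit_mul_comm _ (scalarUnit B _)]
  | @inv g a _ h1 =>
    rw [bichar.neg_left, map_inv, eq_inv_mul_iff_mul_eq, ← mul_assoc, scalarUnit_mul_comm,
      mul_assoc, inv_mul_eq_iff_eq_mul, ← mul_assoc, eq_mul_inv_iff_mul_eq, mul_assoc, ← h1]

theorem unique {lam : Fin n → Fin n → Kˣ}
    (hyy : ∀ i j, (y i : B) * y j = (lam i j : K) • ((y j : B) * y i))
    (hU : ∀ i j, lam i j ∈ U)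
    {g h : Bˣ} {a : Fin n → ℤ} (hg : IsMonomial U y g a) (hh : IsMonomial U y h a) :
    ∃ u ∈ U, g = scalarUnit B u * h := by
  classical
  let H : Subgroup Bˣ := U.map (scalarUnit B)
  have hH : H.Normal := by
    refine ⟨?_⟩
    rintro _ ⟨u, hu, rfl⟩ g
    exact ⟨u, hu, by rw [← scalarUnit_mul_comm]; simp⟩
  have hc : Pairwise fun i j => ∀ x z : Multiplicative ℤ,
      Commute (zpowersHom _ (QuotientGroup.mk (s := H) (y i)) x)
        (zpowersHom _ (QuotientGroup.mk (s := H) (y j)) z) := by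
    intro i j _ x z
    simp only [zpowersHom_apply]
    refine (Commute.zpow_zpow ?_ _ _)
    change (QuotientGroup.mk (y i * y j) : Bˣ ⧸ H) = QuotientGroup.mk (y j * y i)
    have : y i * y j = scalarUnit B (lam i j) * (y j * y i) := by
      ext; simp [hyy i j, Algebra.smul_def]
    rw [this, scalarUnit_mul_comm, eq_comm, QuotientGroup.eq]
    exact ⟨lam i j, hU i j, by group⟩
  let Φ : ((i : Fin n) → Multiplicative ℤ) →* Bˣ ⧸ H :=
    MonoidHom.noncommPiCoprod (fun i => zpowersHom _ (QuotientGroup.mk (s := H) (y i))) hc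
  have key : ∀ {g : Bˣ} {a : Fin n → ℤ}, IsMonomial U y g a →
      (QuotientGroup.mk g : Bˣ ⧸ H) = Φ (fun i => Multiplicative.ofAdd (a i)) := by
    intro g a hg
    induction hg with
    | gen i =>
      have : (fun j => Multiplicative.ofAdd ((Pi.single i 1 : Fin n → ℤ) j)) =
          Pi.mulSingle i (Multiplicative.ofAdd (1 : ℤ)) := by
        ext j; by_cases h : j = i
        · subst h; simp
        · simp [h]
      rw [this, MonoidHom.noncommPiCoprod_mulSingle]
      simp
    | scalar u hu =>
      have : (fun j => Multiplicative.ofAdd ((0 : Fin n → ℤ) j)) = 1 := rfl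
      rw [this, map_one, QuotientGroup.eq_one_iff]
      exact ⟨u, hu, rfl⟩
    | @mul g g' a a' _ _ h1 h2 =>
      rw [QuotientGroup.mk_mul, h1, h2, ← map_mul]; rfl
    | @inv g a _ h1 =>
      rw [QuotientGroup.mk_inv, h1, ← map_inv]; rfl
  have h1 := (key hg).trans (key hh).symm
  rw [eq_comm, QuotientGroup.eq] at h1
  obtain ⟨u, hu, h2⟩ := h1
  refine ⟨u, hu, ?_⟩
  rw [scalarUnit_mul_comm, h2]; group

end IsMonomial

namespace IsQSystem

variable {K B : Type*} [Field K] [Ring B] [Algebra K B] {n r : ℕ} {ι : Fin r → Fin n}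
  {lam : Fin n → Fin n → Kˣ} {y : Fin n → Bˣ} {w : Fin r → B}

theorem w_mul (S : IsQSystem ι lam y w) {U : Subgroup Kˣ} {g : Bˣ} {a : Fin n → ℤ}
    (hg : IsMonomial U y g a) (i : Fin r) : w i * g = g * (w i + (a (ι i) : B)) := by
  classical
  induction hg with
  | gen j => rw [S.wy]; simp [Pi.single_apply]
  | scalar u hu => simpa using (Algebra.commutes (u : K) (w i)).symm
  | @mul g h a b _ _ h1 h2 =>
    rw [Units.val_mul, ← mul_assoc, h1, mul_assoc, add_mul, h2, Int.cast_comm, ← mul_add, mul_assoc]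
    simp [add_comm, add_left_comm]
  | @inv g a _ h1 =>
    rw [Units.mul_inv_eq_iff_eq_mul, mul_assoc, Units.eq_inv_mul_iff_mul_eq]
    rw [add_mul, h1, Pi.neg_apply, Int.cast_neg, neg_mul, Int.cast_comm, mul_add]; simp

open MvPolynomial in
/-- Evaluation of commutative polynomials at the commuting elements `w_i`. -/
theorem exists_polyHom (S : IsQSystem ι lam y w) :
    ∃ φ : MvPolynomial (Fin r) K →ₐ[K] B, ∀ i, φ (X i) = w i := by
  have hc : ∀ a ∈ Set.range w, ∀ b ∈ Set.range w, a * b = b * a := by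
    rintro _ ⟨i, rfl⟩ _ ⟨j, rfl⟩; exact S.ww i j
  have := Algebra.isMulCommutative_adjoin K hc
  let _ : CommRing (Algebra.adjoin K (Set.range w)) :=
    { (inferInstance : Ring (Algebra.adjoin K (Set.range w))) with
      mul_comm := fun a b => this.is_comm.comm a b }
  let ψ : MvPolynomial (Fin r) K →ₐ[K] Algebra.adjoin K (Set.range w) :=
    aeval fun i => ⟨w i, Algebra.subset_adjoin ⟨i, rfl⟩⟩
  refine ⟨(Algebra.adjoin K (Set.range w)).val.comp ψ, fun i => ?_⟩
  simp [ψ]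

/-- Evaluation of commutative polynomials at the commuting elements `w_i`. -/
noncomputable def poly (S : IsQSystem ι lam y w) : MvPolynomial (Fin r) K →ₐ[K] B :=
  S.exists_polyHom.choose

open MvPolynomial

@[simp] theorem poly_X (S : IsQSystem ι lam y w) (i : Fin r) : S.poly (X i) = w i :=
  S.exists_polyHom.choose_spec i

/-- The translation `X_i ↦ X_i + a_i`. -/
noncomputable def shift (K : Type*) [Field K] (ι : Fin r → Fin n) (a : Fin n → ℤ) :
    MvPolynomial (Fin r) K →ₐ[K] MvPolynomial (Fin r) K :=
  aeval fun i => X i + C (a (ι i) : K)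

theorem poly_mul (S : IsQSystem ι lam y w) {U : Subgroup Kˣ} {g : Bˣ} {a : Fin n → ℤ}
    (hg : IsMonomial U y g a) (f : MvPolynomial (Fin r) K) :
    S.poly f * g = g * S.poly (shift K ι a f) := by
  induction f using MvPolynomial.induction_on with
  | C c =>
    rw [shift, ← algebraMap_eq, AlgHom.commutes, AlgHom.commutes, AlgHom.commutes,
      Algebra.commutes]
  | add p q hp hq => simp [add_mul, mul_add, hp, hq]
  | mul_X p i hp =>
    rw [map_mul, mul_assoc, poly_X, S.w_mul hg, ← mul_assoc, hp, mul_assoc, map_mul, map_mul]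
    congr 2
    simp [shift]

end IsQSystem

theorem Matrix.MulAntisymmetric.ne_zero {k : Type u} [Field k] {n : ℕ}
    {Λ : Matrix (Fin n) (Fin n) k} (h : Λ.MulAntisymmetric) (i j : Fin n) : Λ i j ≠ 0 :=
  left_ne_zero_of_mul_eq_one (h.2 i j)

/-- The entries of a multiplicatively antisymmetric matrix, as units. -/
noncomputable def Matrix.MulAntisymmetric.units {k : Type u} [Field k] {n : ℕ}
    {Λ : Matrix (Fin n) (Fin n) k} (h : Λ.MulAntisymmetric) (i j : Fin n) : kˣ :=
  Units.mk0 (Λ i j) (h.ne_zero i j)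

@[simp] theorem Matrix.MulAntisymmetric.val_units {k : Type u} [Field k] {n : ℕ}
    {Λ : Matrix (Fin n) (Fin n) k} (h : Λ.MulAntisymmetric) (i j : Fin n) :
    (h.units i j : k) = Λ i j := rfl

theorem Matrix.MulAntisymmetric.units_mul {k : Type u} [Field k] {n : ℕ}
    {Λ : Matrix (Fin n) (Fin n) k} (h : Λ.MulAntisymmetric) (i j : Fin n) :
    h.units i j * h.units j i = 1 := Units.ext (h.2 i j)

theorem Matrix.MulAntisymmetric.units_self {k : Type u} [Field k] {n : ℕ}
    {Λ : Matrix (Fin n) (Fin n) k} (h : Λ.MulAntisymmetric) (i : Fin n) :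
    h.units i i = 1 := Units.ext (h.1 i)

section Presentations

variable {k : Type u} [Field k] {n r : ℕ} {B : Type*} [Ring B] [Algebra k B]
  {Λ : Matrix (Fin n) (Fin n) k}

theorem QuantumTorus.y_mul_y (i j : Fin n) :
    QuantumTorus.y k Λ i * QuantumTorus.y k Λ j =
      Λ i j • (QuantumTorus.y k Λ j * QuantumTorus.y k Λ i) := by
  have := RingQuot.mkAlgHom_rel k (QTorusRel.comm (Λ := Λ) i j)
  rw [map_mul, map_mul, map_mul, AlgHom.commutes, ← Algebra.smul_def] at this
  exact this

theorem QuantumTorus.y_mul_yinv (i : Fin n) :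
    QuantumTorus.y k Λ i * QuantumTorus.yinv k Λ i = 1 := by
  have := RingQuot.mkAlgHom_rel k (QTorusRel.mul_inv (Λ := Λ) i)
  rw [map_mul, map_one] at this
  exact this

theorem QuantumTorus.yinv_mul_y (i : Fin n) :
    QuantumTorus.yinv k Λ i * QuantumTorus.y k Λ i = 1 := by
  have := RingQuot.mkAlgHom_rel k (QTorusRel.inv_mul (Λ := Λ) i)
  rw [map_mul, map_one] at this
  exact this

/-- The generators of the quantum torus as units. -/
noncomputable def QuantumTorus.unit (Λ : Matrix (Fin n) (Fin n) k) (i : Fin n) :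
    (QuantumTorus k Λ)ˣ :=
  ⟨y k Λ i, yinv k Λ i, y_mul_yinv i, yinv_mul_y i⟩

/-- The universal property of the quantum torus. -/
theorem QuantumTorus.exists_hom (y : Fin n → Bˣ)
    (hy : ∀ i j, (y i : B) * y j = Λ i j • ((y j : B) * y i)) :
    ∃ f : QuantumTorus k Λ →ₐ[k] B, ∀ i, f (QuantumTorus.y k Λ i) = y i := by
  let g : FreeAlgebra k (Fin n ⊕ Fin n) →ₐ[k] B :=
    FreeAlgebra.lift k (Sum.elim (fun i => (y i : B)) fun i => ((y i)⁻¹ : Bˣ))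
  have hg : ∀ ⦃a b⦄, QTorusRel k Λ a b → g a = g b := by
    intro a b h
    induction h with
    | comm i j => simp [g, hy i j, Algebra.smul_def]
    | mul_inv i => simp [g]
    | inv_mul i => simp [g]
  refine ⟨RingQuot.liftAlgHom k ⟨g, hg⟩, fun i => ?_⟩
  refine (RingQuot.liftAlgHom_mkAlgHom_apply k g hg _).trans ?_
  simp [g]

theorem QuantumTorus.adjoin_eq_top :
    Algebra.adjoin k (Set.range (y k Λ) ∪ Set.range (yinv k Λ)) = ⊤ := by
  rw [eq_top_iff]
  rintro x -
  obtain ⟨x, rfl⟩ := RingQuot.mkAlgHom_surjective k _ x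
  change RingQuot.mkAlgHom k (QTorusRel k Λ) x ∈
    (Algebra.adjoin k (Set.range (y k Λ) ∪ Set.range (yinv k Λ)) :
      Subalgebra k (RingQuot (QTorusRel k Λ)))
  induction x using FreeAlgebra.induction with
  | grade0 r => rw [AlgHom.commutes]; exact Subalgebra.algebraMap_mem _ r
  | grade1 x =>
    cases x with
    | inl i => exact Algebra.subset_adjoin (Or.inl ⟨i, rfl⟩)
    | inr i => exact Algebra.subset_adjoin (Or.inr ⟨i, rfl⟩)
  | mul a b ha hb => rw [map_mul]; exact Subalgebra.mul_mem _ ha hb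
  | add a b ha hb => rw [map_add]; exact Subalgebra.add_mem _ ha hb

variable {hr : r ≤ n}

/-- The universal property of the mixed crossed polynomial algebra, in terms of the elements
`w_i = y_i x_i`. -/
theorem IsQSystem.exists_hom (hΛ : Λ.MulAntisymmetric) {y : Fin n → Bˣ} {w : Fin r → B}
    (S : IsQSystem (Fin.castLE hr) hΛ.units y w) :
    ∃ f : MixedCrossedAlgebra k Λ r hr →ₐ[k] B, (∀ i, f (MixedCrossedAlgebra.y k Λ r hr i) = y i) ∧
      ∀ i, f (MixedCrossedAlgebra.x k Λ r hr i) =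
        ((y (Fin.castLE hr i))⁻¹ : Bˣ) * w i := by
  let g : FreeAlgebra k (Fin n ⊕ Fin r) →ₐ[k] B :=
    FreeAlgebra.lift k (Sum.elim (fun i => (y i : B))
      fun i => ((y (Fin.castLE hr i))⁻¹ : Bˣ) * w i)
  have hinv : ∀ i j : Fin n, ((y i)⁻¹ : Bˣ) * (y j : B) =
      (Λ i j)⁻¹ • ((y j : B) * ((y i)⁻¹ : Bˣ)) := by
    intro i j
    rw [Units.inv_mul_eq_iff_eq_mul, mul_smul_comm, ← mul_assoc, S.yy, smul_mul_assoc, mul_assoc]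
    simp [smul_smul, hΛ.ne_zero]
  have hinv2 : ∀ i j : Fin n, (((y i)⁻¹ : Bˣ) : B) * ((y j)⁻¹ : Bˣ) =
      (Λ i j) • (((y j)⁻¹ : Bˣ) * ((y i)⁻¹ : Bˣ) : B) := by
    intro i j
    rw [Units.mul_inv_eq_iff_eq_mul, smul_mul_assoc, mul_assoc, hinv, mul_smul_comm, ← mul_assoc]
    simp [smul_smul, hΛ.ne_zero]
  have hw : ∀ (i : Fin r) (j : Fin n), Fin.castLE hr i ≠ j →
      w i * ((y j)⁻¹ : Bˣ) = ((y j)⁻¹ : Bˣ) * w i := by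
    intro i j h
    rw [Units.mul_inv_eq_iff_eq_mul, mul_assoc, S.wy, if_neg h]; simp
  have hg : ∀ ⦃a b⦄, MixedCrossedRel k Λ r hr a b → g a = g b := by
    intro a b h
    induction h with
    | yy i j => simp [g, S.yy i j, Algebra.smul_def]
    | xy_same i =>
      simp only [map_mul, FreeAlgebra.lift_ι_apply, Sum.elim_inr, Sum.elim_inl, map_add, map_one,
        Units.mul_inv_cancel_left, g, mul_assoc, S.wy]
      simp
    | xy_ne i j h =>
      simp only [map_mul, FreeAlgebra.lift_ι_apply, Sum.elim_inr, Sum.elim_inl, AlgHom.commutes,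
        g, mul_assoc, S.wy, if_neg h, add_zero]
      rw [← mul_assoc, hinv, ← Algebra.smul_def, smul_mul_assoc, mul_assoc]
    | xx i j =>
      by_cases h : i = j
      · subst h; simp [g, hΛ.1]
      · have h1 : Fin.castLE hr i ≠ Fin.castLE hr j := fun h' => h (Fin.castLE_injective hr h')
        simp only [map_mul, FreeAlgebra.lift_ι_apply, Sum.elim_inr, AlgHom.commutes, g]
        rw [mul_assoc, ← mul_assoc (w i), hw i _ h1, mul_assoc, ← mul_assoc, hinv2, S.ww,
          ← Algebra.smul_def, smul_mul_assoc, mul_assoc, mul_assoc, ← mul_assoc (w j),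
          hw j _ h1.symm, mul_assoc]
  refine ⟨RingQuot.liftAlgHom k ⟨g, hg⟩, fun i => ?_, fun i => ?_⟩
  · refine (RingQuot.liftAlgHom_mkAlgHom_apply k g hg _).trans ?_
    simp [g]
  · refine (RingQuot.liftAlgHom_mkAlgHom_apply k g hg _).trans ?_
    simp [g]

namespace MixedCrossedAlgebra

theorem y_mul_y (i j : Fin n) : y k Λ r hr i * y k Λ r hr j =
    Λ i j • (y k Λ r hr j * y k Λ r hr i) := by
  have := RingQuot.mkAlgHom_rel k (MixedCrossedRel.yy (r := r) (hr := hr) (Λ := Λ) i j)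
  rw [map_mul, map_mul, map_mul, AlgHom.commutes, ← Algebra.smul_def] at this
  exact this

theorem x_mul_y_same (i : Fin r) : x k Λ r hr i * y k Λ r hr (Fin.castLE hr i) =
    y k Λ r hr (Fin.castLE hr i) * x k Λ r hr i + 1 := by
  have := RingQuot.mkAlgHom_rel k (MixedCrossedRel.xy_same (hr := hr) (Λ := Λ) i)
  rw [map_add, map_mul, map_mul, map_one] at this
  exact this

theorem x_mul_y_ne (i : Fin r) (j : Fin n) (h : Fin.castLE hr i ≠ j) :
    x k Λ r hr i * y k Λ r hr j =
      (Λ (Fin.castLE hr i) j)⁻¹ • (y k Λ r hr j * x k Λ r hr i) := by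
  have := RingQuot.mkAlgHom_rel k (MixedCrossedRel.xy_ne (Λ := Λ) i j h)
  rw [map_mul, map_mul, map_mul, AlgHom.commutes, ← Algebra.smul_def] at this
  exact this

theorem x_mul_x (i j : Fin r) : x k Λ r hr i * x k Λ r hr j =
    Λ (Fin.castLE hr i) (Fin.castLE hr j) • (x k Λ r hr j * x k Λ r hr i) := by
  have := RingQuot.mkAlgHom_rel k (MixedCrossedRel.xx (Λ := Λ) (hr := hr) i j)
  rw [map_mul, map_mul, map_mul, AlgHom.commutes, ← Algebra.smul_def] at this
  exact this

theorem induction_on {p : MixedCrossedAlgebra k Λ r hr → Prop}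
    (hc : ∀ c : k, p (algebraMap k _ c)) (hy : ∀ i, p (y k Λ r hr i)) (hx : ∀ i, p (x k Λ r hr i))
    (hmul : ∀ a b, p a → p b → p (a * b)) (hadd : ∀ a b, p a → p b → p (a + b)) (a) : p a := by
  obtain ⟨x, rfl⟩ := RingQuot.mkAlgHom_surjective k _ a
  induction x using FreeAlgebra.induction with
  | grade0 r => rw [AlgHom.commutes]; exact hc r
  | grade1 x =>
    cases x with
    | inl i => exact hy i
    | inr i => exact hx i
  | mul a b ha hb => rw [map_mul]; exact hmul _ _ ha hb
  | add a b ha hb => rw [map_add]; exact hadd _ _ ha hb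

/-- The elements `y_i` and `w_i = y_i x_i`. -/
theorem isQSystem (hΛ : Λ.MulAntisymmetric) (f : MixedCrossedAlgebra k Λ r hr →ₐ[k] B)
    (u : Fin n → Bˣ) (hu : ∀ i, f (y k Λ r hr i) = u i) :
    IsQSystem (Fin.castLE hr) hΛ.units u
      (fun i => f (y k Λ r hr (Fin.castLE hr i) * x k Λ r hr i)) where
  yy i j := by
    rw [← hu, ← hu, ← map_mul, ← map_mul, y_mul_y, map_smul]; rfl
  wy i j := by
    rw [← hu]
    split_ifs with h
    · subst h
      rw [← map_one f, ← map_mul, ← map_add, ← map_mul, mul_assoc, x_mul_y_same]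
    · rw [add_zero, ← map_mul, ← map_mul, mul_assoc, x_mul_y_ne _ _ h, mul_smul_comm, ← mul_assoc,
        y_mul_y, smul_mul_assoc, smul_smul, inv_mul_cancel₀ (hΛ.ne_zero _ _), one_smul, mul_assoc]
  ww i j := by
    by_cases h : i = j
    · subst h; rfl
    · have h1 : Fin.castLE hr i ≠ Fin.castLE hr j := fun h' => h (Fin.castLE_injective hr h')
      rw [← map_mul, ← map_mul, mul_assoc, ← mul_assoc (x k Λ r hr i), x_mul_y_ne _ _ h1,
        smul_mul_assoc, mul_assoc, x_mul_x, mul_smul_comm, mul_smul_comm, mul_smul_comm,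
        smul_smul, inv_mul_cancel₀ (hΛ.ne_zero _ _), one_smul, ← mul_assoc, y_mul_y,
        mul_assoc, ← mul_assoc (x k Λ r hr j), x_mul_y_ne _ _ h1.symm, smul_mul_assoc,
        smul_mul_assoc, mul_smul_comm,
        mul_assoc, mul_assoc, eq_inv_of_mul_eq_one_left (hΛ.2 _ _)]

end MixedCrossedAlgebra

end Presentations

/-- Linear operators on functions on `ℤ^n`. -/
abbrev Op (k : Type u) [Field k] (n : ℕ) := Module.End k ((Fin n → ℤ) → k)

namespace ShiftRep

variable {k : Type u} [Field k] {n r : ℕ}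

/-- The strictly triangular part of `lam`. -/
def tri (lam : Fin n → Fin n → kˣ) (j i : Fin n) : kˣ := if j < i then lam j i else 1

/-- The weighted shift by `a` on functions on `ℤ^n`. -/
def op (lam : Fin n → Fin n → kˣ) (a : Fin n → ℤ) : Op k n where
  toFun ψ m := ((bichar (tri lam) m a : kˣ) : k) * ψ (m + a)
  map_add' ψ ψ' := by ext m; simp [mul_add]
  map_smul' c ψ := by ext m; simp [mul_left_comm]

theorem op_mul (lam : Fin n → Fin n → kˣ) (a b : Fin n → ℤ) :
    op lam a * op lam b = ((bichar (tri lam) a b : kˣ) : k) • op lam (a + b) := by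
  ext ψ m
  simp [op, bichar.add_left, bichar.add_right, add_assoc]
  ring

/-- The weighted shift by the `i`-th unit vector. -/
def unit (lam : Fin n → Fin n → kˣ) (i : Fin n) : (Op k n)ˣ where
  val := op lam (Pi.single i 1)
  inv := ((bichar (tri lam) (Pi.single i 1) (Pi.single i 1) : kˣ) : k) • op lam (-Pi.single i 1)
  val_inv := by
    rw [mul_smul_comm, op_mul, smul_smul, add_neg_cancel, bichar.neg_right, Units.mul_inv,
      one_smul]
    ext ψ m
    simp [op, bichar.zero_right]
  inv_val := by
    rw [smul_mul_assoc, op_mul, smul_smul, neg_add_cancel, bichar.neg_left, Units.mul_inv,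
      one_smul]
    ext ψ m
    simp [op, bichar.zero_right]

/-- Multiplication by the function `m ↦ -m_i`. -/
def diag (k : Type u) [Field k] (ι : Fin r → Fin n) (i : Fin r) :
    Op k n where
  toFun ψ m := (-(m (ι i) : k)) * ψ m
  map_add' ψ ψ' := by ext m; simp [mul_add]
  map_smul' c ψ := by ext m; simp [mul_left_comm]

theorem unit_mul {lam : Fin n → Fin n → kˣ} (h1 : ∀ i, lam i i = 1)
    (h2 : ∀ i j, lam i j * lam j i = 1) (i j : Fin n) :
    (unit lam i : Op k n) * unit lam j = (lam i j : k) • ((unit lam j : Op k n) *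
      unit lam i) := by
  change op lam _ * op lam _ = _ • (op lam _ * op lam _)
  rw [op_mul, op_mul, smul_smul, add_comm, bichar.single_single, bichar.single_single,
    ← Units.val_mul]
  congr 2
  simp only [tri]
  rcases lt_trichotomy i j with h | h | h
  · simp [h, h.not_gt]
  · subst h; simp [h1]
  · simp [h, h.not_gt, h2]

theorem isQSystem (ι : Fin r → Fin n) {lam : Fin n → Fin n → kˣ} (h1 : ∀ i, lam i i = 1)
    (h2 : ∀ i j, lam i j * lam j i = 1) :
    IsQSystem ι lam (unit lam) (diag k ι) where
  yy := unit_mul h1 h2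
  wy i j := by
    change diag k ι i * op lam _ = op lam _ * _
    ext ψ m
    split_ifs with h
    · simp [op, diag, h]; ring
    · simp [op, diag, h]; ring
  ww i j := by
    ext ψ m
    simp [diag]; ring

theorem apply_of_isMonomial {lam : Fin n → Fin n → kˣ} {U : Subgroup kˣ}
    {g : (Op k n)ˣ} {a : Fin n → ℤ} (h : IsMonomial U (unit lam) g a) :
    ∃ u : (Fin n → ℤ) → kˣ, ∀ ψ m, (g : Op k n) ψ m = u m * ψ (m + a) := by
  induction h with
  | gen i => exact ⟨fun m => bichar (tri lam) m _, fun ψ m => rfl⟩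
  | scalar u hu => exact ⟨fun _ => u, fun ψ m => by simp [Module.algebraMap_end_apply]⟩
  | @mul g h a b _ _ h1 h2 =>
    obtain ⟨u, hu⟩ := h1
    obtain ⟨v, hv⟩ := h2
    refine ⟨fun m => u m * v (m + a), fun ψ m => ?_⟩
    rw [Units.val_mul, Module.End.mul_apply, hu, hv]
    simp [mul_assoc, add_assoc]
  | @inv g a _ h1 =>
    obtain ⟨u, hu⟩ := h1
    refine ⟨fun m => (u (m - a))⁻¹, fun ψ m => ?_⟩
    have h := hu ((g⁻¹ : (Op k n)ˣ).1 ψ) (m - a)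
    rw [← Module.End.mul_apply, Units.mul_inv, sub_add_cancel] at h
    rw [← sub_eq_add_neg]
    have h' : (ψ (m - a)) = (u (m - a) : k) * ((g⁻¹ : (Op k n)ˣ).1 ψ) m := h
    rw [h']; simp

open MvPolynomial in
theorem poly_apply {ι : Fin r → Fin n} {lam : Fin n → Fin n → kˣ}
    (S : IsQSystem ι lam (unit lam) (diag k ι)) (f : MvPolynomial (Fin r) k)
    (ψ : (Fin n → ℤ) → k) (m : Fin n → ℤ) :
    S.poly f ψ m = eval (fun i => -(m (ι i) : k)) f * ψ m := by
  induction f using MvPolynomial.induction_on generalizing ψ with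
  | C c =>
    rw [← algebraMap_eq, AlgHom.commutes, algebraMap_eq, eval_C]; rfl
  | add p q hp hq => rw [map_add, LinearMap.add_apply, Pi.add_apply, hp, hq, map_add, add_mul]
  | mul_X p i hp =>
    rw [map_mul, Module.End.mul_apply, hp, map_mul, mul_assoc, IsQSystem.poly_X, eval_X]; rfl

end ShiftRep

theorem IsMonomial.mono {K B : Type*} [Field K] [Ring B] [Algebra K B] {n : ℕ} {U V : Subgroup Kˣ}
    {y : Fin n → Bˣ} {g : Bˣ} {a : Fin n → ℤ} (h : IsMonomial U y g a) (hUV : U ≤ V) :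
    IsMonomial V y g a := by
  induction h with
  | gen i => exact .gen i
  | scalar u hu => exact .scalar u (hUV hu)
  | mul _ _ h1 h2 => exact h1.mul h2
  | inv _ h => exact h.inv

/-- The monomials `Y^a w^b` attached to a choice of monomials `Y^a`. -/
noncomputable def IsQSystem.basisFun {K B : Type*} [Field K] [Ring B] [Algebra K B] {n r : ℕ}
    {ι : Fin r → Fin n} {lam : Fin n → Fin n → Kˣ} {y : Fin n → Bˣ} {w : Fin r → B}
    (S : IsQSystem ι lam y w) (Y : (Fin n → ℤ) → Bˣ) (p : (Fin n → ℤ) × (Fin r →₀ ℕ)) : B :=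
  (Y p.1 : B) * S.poly (MvPolynomial.monomial p.2 1)

open MvPolynomial in
/-- The monomials `Y^a w^b` are linearly independent in any division ring containing the
mixed crossed polynomial algebra. -/
theorem MixedCrossedAlgebra.linearIndependent {k : Type u} [Field k] [CharZero k] {n r : ℕ}
    {hr : r ≤ n} {Λ : Matrix (Fin n) (Fin n) k} (hΛ : Λ.MulAntisymmetric) {D : Type*}
    [Ring D] [Algebra k D] (f : MixedCrossedAlgebra k Λ r hr →ₐ[k] D)
    (hf : Function.Injective f) (y : Fin n → Dˣ)
    (hy : ∀ i, f (MixedCrossedAlgebra.y k Λ r hr i) = y i)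
    (Y : (Fin n → ℤ) → Dˣ) (hY : ∀ a, IsMonomial (⊤ : Subgroup kˣ) y (Y a) a) :
    LinearIndependent k ((MixedCrossedAlgebra.isQSystem hΛ f y hy).basisFun Y) := by
  set S := MixedCrossedAlgebra.isQSystem hΛ f y hy with hS
  have SE := ShiftRep.isQSystem (Fin.castLE hr) hΛ.units_self hΛ.units_mul
  obtain ⟨ρ, hρy, hρx⟩ := SE.exists_hom hΛ
  -- elements of the algebra mapping to monomials on both sides
  have hmon : ∀ c : Fin n → ℕ, ∃ s : MixedCrossedAlgebra k Λ r hr, ∃ g h,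
      f s = (g : Dˣ) ∧ IsMonomial (⊤ : Subgroup kˣ) y g (fun i => (c i : ℤ)) ∧
      ρ s = ((h : (Op k n)ˣ) : Op k n) ∧
      IsMonomial (⊤ : Subgroup kˣ) (ShiftRep.unit hΛ.units) h (fun i => (c i : ℤ)) := by
    intro c
    have hc : (fun i => (c i : ℤ)) = ∑ i, c i • Pi.single i (1 : ℤ) := by
      rw [← Finset.univ_sum_single (fun i => (c i : ℤ))]
      refine Finset.sum_congr rfl fun i _ => ?_
      rw [← Pi.single_smul]; simp
    rw [hc]
    refine Finset.sum_induction _ (fun a => ∃ s : MixedCrossedAlgebra k Λ r hr, ∃ g h,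
      f s = (g : Dˣ) ∧ IsMonomial (⊤ : Subgroup kˣ) y g a ∧
      ρ s = ((h : (Op k n)ˣ) : Op k n) ∧
      IsMonomial (⊤ : Subgroup kˣ) (ShiftRep.unit hΛ.units) h a) ?_ ?_ ?_
    · rintro a b ⟨s, g, h, h1, h2, h3, h4⟩ ⟨s', g', h', h1', h2', h3', h4'⟩
      exact ⟨s * s', g * g', h * h', by simp [h1, h1'], h2.mul h2', by simp [h3, h3'], h4.mul h4'⟩
    · exact ⟨1, 1, 1, by simp, .one, by simp, .one⟩
    · intro i _
      exact ⟨MixedCrossedAlgebra.y k Λ r hr i ^ c i, _, _,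
        by rw [map_pow, hy, Units.val_pow_eq_pow_val],
        (IsMonomial.gen i).pow _, by rw [map_pow, hρy, Units.val_pow_eq_pow_val],
        (IsMonomial.gen i).pow _⟩
  have hpoly : ∀ p : MvPolynomial (Fin r) k, ∃ s : MixedCrossedAlgebra k Λ r hr,
      f s = S.poly p ∧ ρ s = SE.poly p := by
    intro p
    induction p using MvPolynomial.induction_on with
    | C c =>
      exact ⟨algebraMap k _ c, by rw [← algebraMap_eq]; simp, by rw [← algebraMap_eq]; simp⟩
    | add p q hp hq =>
      obtain ⟨s, h1, h2⟩ := hp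
      obtain ⟨t, h3, h4⟩ := hq
      exact ⟨s + t, by simp [h1, h3], by simp [h2, h4]⟩
    | mul_X p i hp =>
      obtain ⟨s, h1, h2⟩ := hp
      refine ⟨s * (MixedCrossedAlgebra.y k Λ r hr (Fin.castLE hr i) *
        MixedCrossedAlgebra.x k Λ r hr i),
        by rw [map_mul, h1, map_mul S.poly, IsQSystem.poly_X], ?_⟩
      rw [map_mul, h2, map_mul, map_mul, IsQSystem.poly_X, hρy, hρx, Units.mul_inv_cancel_left]
  rw [linearIndependent_iff]
  intro l hl
  classical
  obtain ⟨N, hN⟩ : ∃ N : Fin n → ℕ, ∀ p ∈ l.support, ∀ i, 0 ≤ p.1 i + N i := by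
    refine ⟨fun i => ∑ p ∈ l.support, (p.1 i).natAbs, fun p hp i => ?_⟩
    have := Finset.single_le_sum (f := fun p : (Fin n → ℤ) × (Fin r →₀ ℕ) => (p.1 i).natAbs)
      (fun _ _ => Nat.zero_le _) hp
    beta_reduce
    omega
  set Nz : Fin n → ℤ := fun i => (N i : ℤ) with hNz
  have hterm : ∀ a : Fin n → ℤ, ∃ s : MixedCrossedAlgebra k Λ r hr, (∀ i, 0 ≤ a i + N i) →
      f s = (Y Nz : D) * Y a ∧ ∃ u : (Fin n → ℤ) → kˣ, ∀ ψ m, ρ s ψ m = u m * ψ (m + (a + Nz)) := by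
    intro a
    by_cases ha : ∀ i, 0 ≤ a i + N i
    swap
    · exact ⟨0, fun h => absurd h ha⟩
    obtain ⟨s, g, h, h1, h2, h3, h4⟩ := hmon fun i => (a i + N i).toNat
    have he : (fun i => (((a i + N i).toNat : ℕ) : ℤ)) = Nz + a := by
      ext i; simp [hNz, ha i, add_comm]
    rw [he] at h2 h4
    obtain ⟨c, -, hc⟩ := ((hY Nz).mul (hY a)).unique S.yy (fun _ _ => Subgroup.mem_top _) h2
    obtain ⟨u, hu⟩ := ShiftRep.apply_of_isMonomial h4
    refine ⟨(c : k) • s, fun _ => ⟨?_, fun m => c * u m, fun ψ m => ?_⟩⟩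
    · rw [map_smul, h1, ← Units.val_mul, hc]; simp [Algebra.smul_def]
    · rw [map_smul, h3, LinearMap.smul_apply, Pi.smul_apply, hu, add_comm a]; simp [mul_assoc]
  choose sY hsY using hterm
  choose sP hsP hsP' using hpoly
  have hsum : ∑ p ∈ l.support, l p • (sY p.1 * sP (monomial p.2 1)) = 0 := by
    apply hf
    rw [map_sum, map_zero]
    rw [Finsupp.linearCombination_apply, Finsupp.sum] at hl
    have := congrArg ((Y Nz : D) * ·) hl
    simp only [mul_zero, Finset.mul_sum] at this
    rw [← this]
    refine Finset.sum_congr rfl fun p hp => ?_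
    rw [map_smul, map_mul, (hsY p.1 (hN p hp)).1, hsP, mul_smul_comm, IsQSystem.basisFun, mul_assoc]
  ext ⟨a₀, b₀⟩
  rw [Finsupp.zero_apply]
  by_contra h0
  obtain ⟨u, hu⟩ := (hsY a₀ (hN (a₀, b₀) (Finsupp.mem_support_iff.mpr h0))).2
  let P : MvPolynomial (Fin r) k := ∑ p ∈ l.support with p.1 = a₀, monomial p.2 (l p)
  have hP0 : P = 0 := by
    refine MvPolynomial.funext_set (fun _ => Set.range fun z : ℤ => (z : k))
      (fun _ => Set.infinite_range_of_injective Int.cast_injective) ?_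
    intro x hx
    simp only [Set.mem_pi, Set.mem_univ, Set.mem_range, forall_const] at hx
    choose z hz using hx
    let m : Fin n → ℤ := fun i => if h : (i : ℕ) < r then - z ⟨i, h⟩ else 0
    have hm : (fun i => -(m (Fin.castLE hr i) : k)) = x := by
      ext i; simp [m, hz]
    have h := congrArg (fun s => ρ s (Pi.single m 1) (m - (a₀ + Nz))) hsum
    simp only [map_sum, map_smul, map_mul, map_zero, LinearMap.sum_apply, Finset.sum_apply,
      LinearMap.zero_apply, Pi.zero_apply, LinearMap.smul_apply, Pi.smul_apply,
      Module.End.mul_apply] at h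
    have hterm' : ∀ p ∈ l.support, l p • ρ (sY p.1) (ρ (sP (monomial p.2 1)) (Pi.single m 1))
        (m - (a₀ + Nz)) = if p.1 = a₀ then
          (u (m - (a₀ + Nz)) : k) * eval x (monomial p.2 (l p)) else 0 := by
      rintro ⟨a, b⟩ hp
      split_ifs with hpa
      · subst hpa
        rw [hu, hsP', ShiftRep.poly_apply, sub_add_cancel, hm]
        simp [eval_monomial]; ring
      · obtain ⟨v, hv⟩ := (hsY a (hN (a, b) hp)).2
        have : m - (a₀ + Nz) + (a + Nz) ≠ m := by
          intro h; apply hpa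
          have : a - a₀ = 0 := by rw [← sub_eq_zero.mpr h]; abel
          exact sub_eq_zero.mp this
        rw [hv, hsP', ShiftRep.poly_apply, Pi.single_eq_of_ne this]
        simp
    rw [Finset.sum_congr rfl hterm', ← Finset.sum_filter, ← Finset.mul_sum, ← map_sum] at h
    rw [map_zero]
    exact (mul_eq_zero.mp h).resolve_left (Units.ne_zero _)
  apply h0
  have h := congrArg (coeff b₀) hP0
  rw [coeff_zero, coeff_sum] at h
  simp only [coeff_monomial] at h
  rw [← h, Finset.sum_eq_single (a₀, b₀)]
  · simp
  · rintro ⟨a, b⟩ hp hne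
    simp only [Finset.mem_filter] at hp
    rw [if_neg]
    rintro rfl
    exact hne (by rw [← hp.2])
  · intro hmem
    simpa using hmem

/-- `α` is the leading index of `f`: the largest index among those where the coefficient has
maximal valuation. -/
structure IsLead {k I M Γ : Type*} [Field k] [LinearOrderedCommGroupWithZero Γ] [LT M]
    (v : Valuation k Γ) (key : I → M) (f : I →₀ k) (α : I) : Prop where
  ne : f α ≠ 0
  le : ∀ γ, v (f γ) ≤ v (f α)
  lt : ∀ γ, key α < key γ → v (f γ) < v (f α)

namespace IsLead

variable {k I M Γ : Type*} [Field k] [LinearOrderedCommGroupWithZero Γ] {v : Valuation k Γ}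
  {key : I → M}

theorem exists_isLead [LinearOrder M] {f : I →₀ k} (hf : f ≠ 0) : ∃ α, IsLead v key f α := by
  classical
  obtain ⟨α₀, h₀, hmax⟩ := f.support.exists_max_image (fun a => v (f a))
    (Finsupp.support_nonempty_iff.mpr hf)
  obtain ⟨α, h, hmax'⟩ := (f.support.filter fun a => v (f a) = v (f α₀)).exists_max_image key
    ⟨α₀, by simpa using h₀⟩
  simp only [Finset.mem_filter, Finsupp.mem_support_iff] at h hmax hmax'
  have hle : ∀ γ, v (f γ) ≤ v (f α) := by
    intro γ
    rw [h.2]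
    by_cases hγ : f γ = 0
    · simp [hγ]
    · exact hmax γ hγ
  refine ⟨α, h.1, hle, fun γ hγ => lt_of_le_of_ne (hle γ) fun he => ?_⟩
  refine (hmax' γ ⟨?_, he.trans h.2⟩).not_gt hγ
  intro h0
  rw [h0, map_zero, eq_comm, map_eq_zero] at he
  exact h.1 he

theorem eq [LinearOrder M] (hkey : Function.Injective key) {f : I →₀ k} {α β : I}
    (h : IsLead v key f α) (h' : IsLead v key f β) : α = β := by
  apply hkey
  rcases lt_trichotomy (key α) (key β) with hlt | heq | hlt
  · exact absurd (h.lt _ hlt) (h'.le _).not_gt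
  · exact heq
  · exact absurd (h'.lt _ hlt) (h.le _).not_gt

end IsLead

/-- A family whose products are triangular with respect to the ordering of the indices, with
leading coefficients `c`. -/
def IsTriangular {k I M Γ B : Type*} [Field k] [LinearOrderedCommGroupWithZero Γ] [LE M] [Add I]
    [Ring B] [Algebra k B] (v : Valuation k Γ) (key : I → M) (e : I → B) (c : I → I → k) :
    Prop :=
  ∀ α β, ∃ s : I →₀ k, e α * e β = Finsupp.linearCombination k e s ∧ s (α + β) = c α β ∧
    v (c α β) = 1 ∧ ∀ γ, v (s γ) ≤ 1 ∧ (s γ ≠ 0 → key γ ≤ key (α + β))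

namespace IsTriangular

variable {k I M Γ B : Type*} [Field k] [LinearOrderedCommGroupWithZero Γ] [AddCommMonoid M]
  [LinearOrder M] [IsOrderedCancelAddMonoid M] [Add I] [Ring B] [Algebra k B] {v : Valuation k Γ}
  {key : I → M} {e : I → B}
  {c : I → I → k}

theorem mul_lead (T : IsTriangular v key e c) (hinj : Function.Injective key)
    (hadd : ∀ a b, key (a + b) = key a + key b) {f g : I →₀ k} {α β : I}
    (hf : IsLead v key f α) (hg : IsLead v key g β) :
    ∃ h : I →₀ k, Finsupp.linearCombination k e f * Finsupp.linearCombination k e g =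
      Finsupp.linearCombination k e h ∧ IsLead v key h (α + β) ∧
      v (h (α + β) - f α * g β * c α β) < v (f α * g β) ∧
      v (h (α + β)) = v (f α) * v (g β) := by
  classical
  choose s hs hsc hc hs2 using T
  let h : I →₀ k := ∑ p ∈ f.support ×ˢ g.support, (f p.1 * g p.2) • s p.1 p.2
  have hh : Finsupp.linearCombination k e f * Finsupp.linearCombination k e g =
      Finsupp.linearCombination k e h := by
    simp only [h, map_sum, map_smul, ← hs]
    rw [Finsupp.linearCombination_apply, Finsupp.linearCombination_apply, Finsupp.sum, Finsupp.sum,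
      Finset.sum_mul_sum, Finset.sum_product]
    simp [smul_smul, mul_comm]
  have hα : v (f α) ≠ 0 := by simpa using hf.ne
  have hβ : v (g β) ≠ 0 := by simpa using hg.ne
  have hαβ : v (f α) * v (g β) ≠ 0 := mul_ne_zero hα hβ
  have hle : ∀ a b γ, v (f a * g b * s a b γ) ≤ v (f α) * v (g β) := by
    intro a b γ
    rw [map_mul, map_mul]
    calc v (f a) * v (g b) * v (s a b γ) ≤ v (f a) * v (g b) * 1 := by
          gcongr; exact (hs2 a b γ).1
      _ ≤ v (f α) * v (g β) := by
          rw [mul_one]; exact mul_le_mul' (hf.le a) (hg.le b)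
  have hlt : ∀ a b γ, key (α + β) ≤ key γ → (key (α + β) < key γ ∨ (a, b) ≠ (α, β)) →
      v (f a * g b * s a b γ) < v (f α) * v (g β) := by
    intro a b γ hγ hor
    by_cases h0 : s a b γ = 0
    · rw [h0, mul_zero, map_zero]; exact zero_lt_iff.mpr hαβ
    have h1 := (hs2 a b γ).2 h0
    have h2 : v (f a) * v (g b) < v (f α) * v (g β) := by
      rcases lt_or_ge (key α) (key a) with ha | ha
      · exact (mul_le_mul_right (hg.le b) _).trans_lt
          (mul_lt_mul_of_pos_right (hf.lt a ha) (zero_lt_iff.mpr hβ))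
      rcases lt_or_ge (key β) (key b) with hb | hb
      · exact (mul_le_mul_left (hf.le a) _).trans_lt
          (mul_lt_mul_of_pos_left (hg.lt b hb) (zero_lt_iff.mpr hα))
      exfalso
      have h3 : key (a + b) ≤ key (α + β) := by
        rw [hadd, hadd]; exact add_le_add ha hb
      rcases hor with hor | hor
      · exact absurd (h1.trans h3) hor.not_ge
      · have h4 : key a + key b = key α + key β := by
          rw [← hadd, ← hadd]; exact le_antisymm h3 (hγ.trans h1)
        have h5 : key a = key α := by
          refine le_antisymm ha ?_
          by_contra hc
          exact absurd h4 (add_lt_add_of_lt_of_le (not_le.mp hc) hb).ne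
        rw [h5] at h4
        exact hor (by rw [hinj h5, hinj (add_left_cancel h4)])
    rw [map_mul, map_mul]
    calc v (f a) * v (g b) * v (s a b γ) ≤ v (f a) * v (g b) * 1 := by
          gcongr; exact (hs2 a b γ).1
      _ < _ := by rwa [mul_one]
  have happ : ∀ γ, h γ = ∑ p ∈ f.support ×ˢ g.support, f p.1 * g p.2 * s p.1 p.2 γ := by
    intro γ; simp [h, Finsupp.finsetSum_apply]
  have hdiff : v (h (α + β) - f α * g β * c α β) < v (f α * g β) := by
    have hmem : (α, β) ∈ f.support ×ˢ g.support := by simp [hf.ne, hg.ne]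
    rw [happ, ← Finset.add_sum_erase _ _ hmem, hsc, add_sub_cancel_left, map_mul]
    refine Valuation.map_sum_lt _ hαβ fun p hp => hlt _ _ _ le_rfl (Or.inr ?_)
    exact Finset.ne_of_mem_erase hp
  have htop : v (h (α + β)) = v (f α) * v (g β) := by
    have h1 : v (f α * g β * c α β) = v (f α * g β) := by
      rw [map_mul, hc, mul_one]
    rw [← map_mul, ← h1]
    exact Valuation.map_eq_of_sub_lt _ (by rwa [h1])
  refine ⟨h, hh, ⟨?_, ?_, ?_⟩, hdiff, htop⟩
  · intro h0; rw [h0, map_zero] at htop; exact hαβ htop.symm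
  · intro γ
    rw [htop, happ]
    exact Valuation.map_sum_le _ fun p _ => hle _ _ _
  · intro γ hγ
    rw [htop, happ]
    exact Valuation.map_sum_lt _ hαβ fun p _ => hlt _ _ _ hγ.le (Or.inl hγ)

end IsTriangular

namespace IsQSystem

open MvPolynomial

variable {K B : Type*} [Field K] [Ring B] [Algebra K B] {n r : ℕ} {ι : Fin r → Fin n}
  {lam : Fin n → Fin n → Kˣ} {y : Fin n → Bˣ} {w : Fin r → B}

/-- The total order on exponents: lexicographic, first in the `y_i`, then in the `w_i`. -/
noncomputable def key (n r : ℕ) (p : (Fin n → ℤ) × (Fin r →₀ ℕ)) :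
    Lex (Fin n → ℤ) ×ₗ (MonomialOrder.lex (σ := Fin r)).syn :=
  toLex (toLex p.1, MonomialOrder.lex.toSyn p.2)

theorem key_injective : Function.Injective (key n r) := by
  rintro ⟨a, b⟩ ⟨a', b'⟩ h
  simp only [key, EmbeddingLike.apply_eq_iff_eq, Prod.mk.injEq] at h
  exact Prod.ext h.1 h.2

theorem key_add (p q : (Fin n → ℤ) × (Fin r →₀ ℕ)) : key n r (p + q) = key n r p + key n r q := by
  simp only [key, Prod.fst_add, Prod.snd_add, map_add]; rfl

theorem isTriangular (S : IsQSystem ι lam y w) {Γ : Type*} [LinearOrderedCommGroupWithZero Γ]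
    (v : Valuation K Γ) {U : Subgroup Kˣ} (hU : ∀ u ∈ U, v (u : K) = 1) (hlam : ∀ i j, lam i j ∈ U)
    {Y : (Fin n → ℤ) → Bˣ} (hY : ∀ a, IsMonomial U y (Y a) a) :
    ∃ c : (Fin n → ℤ) → (Fin n → ℤ) → Kˣ,
      (∀ a b, (Y a : B) * Y b = (c a b : K) • (Y (a + b) : B)) ∧
      IsTriangular v (key n r) (S.basisFun Y) (fun p q => c p.1 q.1) := by
  have hc : ∀ a b, ∃ u ∈ U, Y a * Y b = scalarUnit B u * Y (a + b) := fun a b =>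
    ((hY a).mul (hY b)).unique S.yy hlam (hY (a + b))
  choose c hcU hc using hc
  have hc' : ∀ a b, (Y a : B) * Y b = (c a b : K) • (Y (a + b) : B) := fun a b => by
    rw [← Units.val_mul, hc]; simp [Algebra.smul_def]
  refine ⟨c, hc', ?_⟩
  rintro ⟨a, b⟩ ⟨a', b'⟩
  let m := MonomialOrder.lex (σ := Fin r)
  let Q : MvPolynomial (Fin r) ℤ := ∏ i, (X i + C (a' (ι i))) ^ b i
  let P : MvPolynomial (Fin r) ℤ := Q * monomial b' 1
  have hQm : m.Monic Q := MonomialOrder.Monic.prod fun i _ => (m.monic_X_add_C i _).pow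
  have hQd : m.degree Q = b := by
    rw [MonomialOrder.degree_prod]
    · simp only [MonomialOrder.degree_pow, MonomialOrder.degree_X_add_C]
      conv_rhs => rw [← Finsupp.univ_sum_single b]
      simp
    · intro i _; exact ((m.monic_X_add_C i _).pow).ne_zero
  have hPm : m.Monic P := hQm.mul MonomialOrder.monic_monomial_one
  have hPd : m.degree P = b + b' := by
    rw [MonomialOrder.degree_mul hQm.ne_zero (m.monic_monomial_one.ne_zero), hQd,
      MonomialOrder.degree_monomial]
    simp
  have hshift : shift K ι a' (monomial b 1) * monomial b' 1 = map (Int.castRingHom K) P := by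
    have hb : (monomial b (1 : K)) = ∏ i, X i ^ b i := by
      rw [monomial_eq]; simp [Finsupp.prod_fintype]
    rw [hb]
    simp [P, Q, shift]
  let s : ((Fin n → ℤ) × (Fin r →₀ ℕ)) →₀ K :=
    ∑ d ∈ P.support, Finsupp.single (a + a', d) ((c a a' : K) * ((coeff d P : ℤ) : K))
  have happ : ∀ γ, s γ = if γ.1 = a + a' then (c a a' : K) * ((coeff γ.2 P : ℤ) : K) else 0 := by
    rintro ⟨γ, δ⟩
    simp only [s, Finsupp.finsetSum_apply, Finsupp.single_apply, Prod.mk.injEq]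
    split_ifs with h
    · subst h
      simp only [true_and]
      rw [Finset.sum_ite_eq']
      split_ifs with h
      · rfl
      · rw [notMem_support_iff.mp h]; simp
    · refine Finset.sum_eq_zero fun d _ => if_neg ?_
      rintro ⟨h', _⟩; exact h h'.symm
  refine ⟨s, ?_, ?_, hU _ (hcU _ _), ?_⟩
  · have h1 : S.basisFun Y (a, b) * S.basisFun Y (a', b') =
        (c a a' : K) • ((Y (a + a') : B) * S.poly (map (Int.castRingHom K) P)) := by
      rw [← hshift, map_mul, ← smul_mul_assoc, ← hc']
      simp only [basisFun]
      rw [mul_assoc, ← mul_assoc (S.poly _), S.poly_mul (hY a')]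
      simp only [mul_assoc]
    rw [h1]
    conv_lhs => rw [P.as_sum]
    simp only [map_sum, s, Finsupp.linearCombination_single, Finset.mul_sum, Finset.smul_sum]
    refine Finset.sum_congr rfl fun d _ => ?_
    have h2 : map (Int.castRingHom K) (monomial d (coeff d P)) =
        ((coeff d P : ℤ) : K) • monomial d (1 : K) := by
      rw [map_monomial, smul_monomial]; simp
    rw [h2, map_smul, basisFun, mul_smul_comm, smul_smul]
  · rw [happ]
    have : coeff (b + b') P = 1 := by rw [← hPd]; exact hPm
    simp [this]
  · rintro ⟨γ, δ⟩
    have hint : ∀ z : ℤ, v (z : K) ≤ 1 := fun z => (intCast_mem v.integer z)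
    rw [happ]
    split_ifs with h
    · refine ⟨?_, fun h0 => ?_⟩
      · rw [map_mul, hU _ (hcU _ _), one_mul]; exact hint _
      · simp only at h
        subst h
        have hδ : δ ∈ P.support := by
          rw [mem_support_iff]; intro h1; simp [h1] at h0
        have := m.le_degree hδ
        rw [hPd] at this
        exact Prod.Lex.toLex_le_toLex.mpr (Or.inr ⟨rfl, this⟩)
    · simp
end IsQSystem

/-- Every element of `D` is a right fraction of elements of `A`. -/
def IsFracSubring {D : Type*} [DivisionRing D] (A : Subring D) : Prop :=
  ∀ d : D, ∃ a ∈ A, ∃ b ∈ A, b ≠ 0 ∧ d = a * b⁻¹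

/-- A multiplicative map on an Ore subring extends to the division ring of fractions. -/
theorem IsFracSubring.exists_extension {D G : Type*} [DivisionRing D] [GroupWithZero G]
    {A : Subring D} (hA : IsFracSubring A) (ν : D → G) (h0 : ν 0 = 0) (h1 : ν 1 = 1)
    (hmul : ∀ a ∈ A, ∀ b ∈ A, ν (a * b) = ν a * ν b) (hν : ∀ a ∈ A, ν a = 0 → a = 0) :
    ∃ μ : D →*₀ G, ∀ a ∈ A, μ a = ν a := by
  choose nu hnu de hde hde0 hd using hA
  have key : ∀ a ∈ A, ∀ b ∈ A, ∀ c ∈ A, ∀ d ∈ A, b ≠ 0 → d ≠ 0 → a * b⁻¹ = c * d⁻¹ →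
      ν a * (ν b)⁻¹ = ν c * (ν d)⁻¹ := by
    intro a ha b hb c hc d hd' hb0 hd0 h
    obtain ⟨e, he, f, hf, hf0, hef⟩ : ∃ e ∈ A, ∃ f ∈ A, f ≠ 0 ∧ b⁻¹ * d = e * f⁻¹ :=
      ⟨_, hnu _, _, hde _, hde0 _, hd _⟩
    have h2 : d * f = b * e := by
      have : b * (b⁻¹ * d) * f = b * (e * f⁻¹) * f := by rw [hef]
      simpa [hb0, hf0, mul_assoc] using this
    have h3 : a * e = c * f := by
      have : a * b⁻¹ * (b * e) = c * d⁻¹ * (d * f) := by rw [h, h2]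
      simpa [hb0, hd0, mul_assoc] using this
    have hνb : ν b ≠ 0 := fun h => hb0 (hν b hb h)
    have hνd : ν d ≠ 0 := fun h => hd0 (hν d hd' h)
    have hνf : ν f ≠ 0 := fun h => hf0 (hν f hf h)
    have h4 := congrArg ν h2
    have h5 := congrArg ν h3
    rw [hmul _ hd' _ hf, hmul _ hb _ he] at h4
    rw [hmul _ ha _ he, hmul _ hc _ hf] at h5
    have h6 : ν e = (ν b)⁻¹ * (ν d * ν f) := by rw [h4]; simp [hνb]
    rw [h6, ← mul_assoc, ← mul_assoc] at h5
    rw [eq_mul_inv_iff_mul_eq₀ hνd]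
    exact mul_right_cancel₀ hνf h5
  refine ⟨⟨⟨fun d => ν (nu d) * (ν (de d))⁻¹, ?_⟩, ?_, ?_⟩, fun a ha => ?_⟩
  · have := key _ (hnu 0) _ (hde 0) 0 A.zero_mem 1 A.one_mem (hde0 _) one_ne_zero
      (by rw [← hd]; simp)
    rw [this, h0, zero_mul]
  · have := key _ (hnu 1) _ (hde 1) 1 A.one_mem 1 A.one_mem (hde0 _) one_ne_zero
      (by rw [← hd]; simp)
    change ν (nu 1) * (ν (de 1))⁻¹ = 1
    rw [this, h1]; simp
  · intro x y
    change ν (nu (x * y)) * (ν (de (x * y)))⁻¹ =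
      ν (nu x) * (ν (de x))⁻¹ * (ν (nu y) * (ν (de y))⁻¹)
    have hc := hd ((de x)⁻¹ * nu y)
    set e := nu ((de x)⁻¹ * nu y) with he
    set f := de ((de x)⁻¹ * nu y) with hf
    have hb0 := hde0 x
    have hf0 : f ≠ 0 := hde0 _
    have hd0 := hde0 y
    have h2 : nu y * f = de x * e := by
      have : de x * ((de x)⁻¹ * nu y) * f = de x * (e * f⁻¹) * f := by rw [hc]
      simpa [hb0, hf0, mul_assoc] using this
    have hxy : nu (x * y) * (de (x * y))⁻¹ = (nu x * e) * (de y * f)⁻¹ := by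
      rw [← hd, mul_inv_rev]
      conv_lhs => rw [hd x, hd y]
      have : (de x)⁻¹ * (nu y * (de y)⁻¹) = e * (f⁻¹ * (de y)⁻¹) := by
        rw [← mul_assoc, hc, mul_assoc]
      rw [mul_assoc, this, mul_assoc]
    have := key _ (hnu _) _ (hde _) _ (A.mul_mem (hnu x) (hnu _)) _ (A.mul_mem (hde y) (hde _))
      (hde0 _) (mul_ne_zero hd0 hf0) hxy
    rw [this, hmul _ (hnu x) _ (hnu _), hmul _ (hde y) _ (hde _), mul_inv_rev]
    have h4 := congrArg ν h2
    rw [hmul _ (hnu y) _ (hde _), hmul _ (hde x) _ (hnu _)] at h4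
    have hνb : ν (de x) ≠ 0 := fun h => hb0 (hν _ (hde x) h)
    have hνf : ν f ≠ 0 := fun h => hf0 (hν f (hde _) h)
    have h6 : ν e = (ν (de x))⁻¹ * (ν (nu y) * ν f) := by
      rw [h4, inv_mul_cancel_left₀ hνb]
    simp only [← he, ← hf]
    rw [h6]
    simp [mul_assoc, hνf]
  · have := key _ (hnu a) _ (hde a) a ha 1 A.one_mem (hde0 _) one_ne_zero
      (by rw [← hd]; simp)
    change ν (nu a) * (ν (de a))⁻¹ = _
    rw [this, h1]; simp

namespace IsTriangular

variable {k I M Γ D : Type*} [Field k] [LinearOrderedCommGroupWithZero Γ] [AddCommMonoid M]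
  [LinearOrder M] [IsOrderedCancelAddMonoid M] [Add I] [DivisionRing D] [Algebra k D]
  {v : Valuation k Γ} {key : I → M} {e : I → D} {c : I → I → k}

/-- Multiplicative maps defined through leading terms. -/
theorem exists_leading_hom {G : Type*} [GroupWithZero G] (T : IsTriangular v key e c)
    (hinj : Function.Injective key) (hadd : ∀ a b, key (a + b) = key a + key b)
    (hli : LinearIndependent k e) {A : Subring D} (hA : IsFracSubring A)
    (hspan : ∀ a ∈ A, ∃ f, a = Finsupp.linearCombination k e f) (F : I → k → G)
    (hF0 : ∀ α x, x ≠ 0 → F α x ≠ 0)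
    (hF : ∀ α β x y z, x ≠ 0 → y ≠ 0 → v (z - x * y * c α β) < v (x * y) → v z = v x * v y →
      F (α + β) z = F α x * F β y) :
    ∃ μ : D →*₀ G, ∀ f α, IsLead v key f α → Finsupp.linearCombination k e f ∈ A →
      μ (Finsupp.linearCombination k e f) = F α (f α) := by
  classical
  let L := Finsupp.linearCombination k e
  have hL : Function.Injective L := hli
  have hlead : ∀ f : I →₀ k, f ≠ 0 → ∃ α, IsLead v key f α := fun f hf => IsLead.exists_isLead hf
  let ν : D → G := fun d => if h : ∃ p : (I →₀ k) × I, IsLead v key p.1 p.2 ∧ L p.1 = d then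
    F h.choose.2 (h.choose.1 h.choose.2) else 0
  have hν : ∀ f α, IsLead v key f α → ν (L f) = F α (f α) := by
    intro f α hf
    have h : ∃ p : (I →₀ k) × I, IsLead v key p.1 p.2 ∧ L p.1 = L f := ⟨(f, α), hf, rfl⟩
    have h2 := h.choose_spec
    have h3 : h.choose.1 = f := hL h2.2
    have h4 : h.choose.2 = α := (h3 ▸ h2.1).eq hinj hf
    simp only [ν]
    rw [dif_pos h, h3, h4]
  have hν0 : ν 0 = 0 := by
    simp only [ν]
    rw [dif_neg]
    rintro ⟨⟨f, α⟩, hf, h⟩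
    have : f = 0 := hL (by rw [h, map_zero])
    exact hf.ne (by simp [this])
  have hmul : ∀ a ∈ A, ∀ b ∈ A, ν (a * b) = ν a * ν b := by
    intro a ha b hb
    obtain ⟨f, rfl⟩ := hspan a ha
    obtain ⟨g, rfl⟩ := hspan b hb
    by_cases hf : f = 0
    · simp [hf, hν0]
    by_cases hg : g = 0
    · simp [hg, hν0]
    obtain ⟨α, hα⟩ := hlead f hf
    obtain ⟨β, hβ⟩ := hlead g hg
    obtain ⟨h, h1, h2, h3, h4⟩ := T.mul_lead hinj hadd hα hβ
    rw [h1, hν h _ h2, hν f _ hα, hν g _ hβ]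
    exact hF _ _ _ _ _ hα.ne hβ.ne h3 h4
  have hne : ∀ a ∈ A, ν a = 0 → a = 0 := by
    intro a ha h
    obtain ⟨f, rfl⟩ := hspan a ha
    by_contra hf
    have hf : f ≠ 0 := by rintro rfl; simp at hf
    obtain ⟨α, hα⟩ := hlead f hf
    rw [hν f _ hα] at h
    exact hF0 _ _ hα.ne h
  have h1 : ν 1 = 1 := by
    have h2 : ν 1 ≠ 0 := fun h => one_ne_zero (hne 1 A.one_mem h)
    have h3 := hmul 1 A.one_mem 1 A.one_mem
    rw [mul_one] at h3
    exact (mul_eq_left₀ h2).mp h3.symm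
  obtain ⟨μ, hμ⟩ := hA.exists_extension ν hν0 h1 hmul hne
  exact ⟨μ, fun f α hf hfA => by rw [hμ _ hfA]; exact hν f α hf⟩

/-- The Gauss extension of a valuation. -/
theorem exists_valuation (T : IsTriangular v key e c)
    (hinj : Function.Injective key) (hadd : ∀ a b, key (a + b) = key a + key b)
    (hli : LinearIndependent k e) {A : Subring D} (hA : IsFracSubring A)
    (hspan : ∀ a, a ∈ A ↔ ∃ f, a = Finsupp.linearCombination k e f) :
    ∃ V : Valuation D Γ, ∀ f α, IsLead v key f α →
      V (Finsupp.linearCombination k e f) = v (f α) := by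
  obtain ⟨μ, hμ⟩ := T.exists_leading_hom hinj hadd hli hA (fun a => (hspan a).mp) (fun _ x => v x)
    (fun _ x hx => by simpa using hx) (fun _ _ x y z _ _ _ h => h)
  have hadd' : ∀ a ∈ A, ∀ b ∈ A, μ (a + b) ≤ max (μ a) (μ b) := by
    intro a ha b hb
    obtain ⟨f, rfl⟩ := (hspan a).mp ha
    obtain ⟨g, rfl⟩ := (hspan b).mp hb
    by_cases hf : f = 0
    · simp [hf]
    by_cases hg : g = 0
    · simp [hg]
    by_cases hfg : f + g = 0
    · rw [← map_add, hfg]; simp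
    obtain ⟨α, hα⟩ := IsLead.exists_isLead (v := v) (key := key) hf
    obtain ⟨β, hβ⟩ := IsLead.exists_isLead (v := v) (key := key) hg
    obtain ⟨γ, hγ⟩ := IsLead.exists_isLead (v := v) (key := key) hfg
    have hsum := A.add_mem ha hb
    rw [← map_add] at hsum ⊢
    rw [hμ _ _ hα ha, hμ _ _ hβ hb, hμ _ _ hγ hsum, Finsupp.add_apply]
    exact (v.map_add _ _).trans (max_le_max (hα.le _) (hβ.le _))
  have hone : ∀ x, μ (1 + x) ≤ max 1 (μ x) := by
    intro x
    obtain ⟨a, ha, b, hb, hb0, rfl⟩ := hA x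
    have h1 : 1 + a * b⁻¹ = (b + a) * b⁻¹ := by rw [add_mul, mul_inv_cancel₀ hb0]
    have h2 : (0 : Γ) < μ b := zero_lt_iff.mpr ((map_ne_zero μ).mpr hb0)
    rw [h1, map_mul, map_mul, map_inv₀, ← div_eq_mul_inv, ← div_eq_mul_inv, div_le_iff₀ h2]
    refine (hadd' b hb a ha).trans (max_le ?_ ?_)
    · exact le_mul_of_one_le_left' (le_max_left _ _)
    · rw [← div_le_iff₀ h2]; exact le_max_right _ _
  refine ⟨{ μ with map_add_le_max' := fun x y => ?_ },
    fun f α hf => hμ f α hf ((hspan _).mpr ⟨f, rfl⟩)⟩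
  change μ (x + y) ≤ max (μ x) (μ y)
  by_cases hx : x = 0
  · simp [hx]
  have h1 : x + y = x * (1 + x⁻¹ * y) := by rw [mul_add, mul_one, mul_inv_cancel_left₀ hx]
  have h2 : (0 : Γ) < μ x := zero_lt_iff.mpr ((map_ne_zero μ).mpr hx)
  calc μ (x + y) = μ x * μ (1 + x⁻¹ * y) := by rw [h1, map_mul]
    _ ≤ μ x * max 1 (μ (x⁻¹ * y)) := by gcongr; exact hone _
    _ = max (μ x) (μ y) := by
      rw [map_mul, map_inv₀]
      rcases le_total (1 : Γ) ((μ x)⁻¹ * μ y) with h | h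
      · rw [max_eq_right h, mul_inv_cancel_left₀ h2.ne', max_eq_right]
        have := mul_le_mul_right h (μ x)
        rwa [mul_one, mul_inv_cancel_left₀ h2.ne'] at this
      · rw [max_eq_left h, mul_one, max_eq_left]
        have := mul_le_mul_right h (μ x)
        rwa [mul_one, mul_inv_cancel_left₀ h2.ne'] at this

end IsTriangular

/-- The elements generating the localised algebra of a system. -/
def qGenerators {D : Type*} [Ring D] {n r : ℕ} (y : Fin n → Dˣ) (w : Fin r → D) : Set D :=
  Set.range (fun i => (y i : D)) ∪ Set.range (fun i => (((y i)⁻¹ : Dˣ) : D)) ∪ Set.range w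

/-- A system in a division ring whose ordered monomials are linearly independent and which
generates the division ring. -/
structure IsQFrame {K D : Type*} [Field K] [DivisionRing D] [Algebra K D] {n r : ℕ}
    (ι : Fin r → Fin n) (lam : Fin n → Fin n → Kˣ) (y : Fin n → Dˣ) (w : Fin r → D) : Prop
    extends IsQSystem ι lam y w where
  li : ∀ Y : (Fin n → ℤ) → Dˣ, (∀ a, IsMonomial (⊤ : Subgroup Kˣ) y (Y a) a) →
    LinearIndependent K (toIsQSystem.basisFun Y)
  frac : IsFracSubring (Algebra.adjoin K (qGenerators y w)).toSubring

theorem IsFracSubring.mono {D : Type*} [DivisionRing D] {A B : Subring D} (h : IsFracSubring A)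
    (hAB : A ≤ B) : IsFracSubring B := fun d => by
  obtain ⟨a, ha, b, hb, h0, hd⟩ := h d
  exact ⟨a, hAB ha, b, hAB hb, h0, hd⟩

theorem MixedCrossedAlgebra.exists_isQFrame {k : Type u} [Field k] [CharZero k] {n r : ℕ}
    {hr : r ≤ n} {Λ : Matrix (Fin n) (Fin n) k} (hΛ : Λ.MulAntisymmetric) {D : Type*}
    [DivisionRing D] [Algebra k D] (f : MixedCrossedAlgebra k Λ r hr →ₐ[k] D)
    (hf : Function.Injective f)
    (hfrac : ∀ d : D, ∃ a b : MixedCrossedAlgebra k Λ r hr, b ≠ 0 ∧ d = f a * (f b)⁻¹) :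
    ∃ (y : Fin n → Dˣ) (w : Fin r → D), IsQFrame (Fin.castLE hr) hΛ.units y w := by
  obtain ⟨φ, hφ, -⟩ := (ShiftRep.isQSystem (Fin.castLE hr) hΛ.units_self hΛ.units_mul).exists_hom hΛ
  have hne : ∀ i, f (MixedCrossedAlgebra.y k Λ r hr i) ≠ 0 := by
    intro i h
    rw [map_eq_zero_iff f hf] at h
    have := hφ i
    rw [h, map_zero] at this
    exact (ShiftRep.unit hΛ.units i).ne_zero this.symm
  let y : Fin n → Dˣ := fun i => Units.mk0 _ (hne i)
  have S := isQSystem hΛ f y fun i => rfl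
  refine ⟨y, _, ⟨S, fun Y hY => linearIndependent hΛ f hf y (fun i => rfl) Y hY, ?_⟩⟩
  set A := Algebra.adjoin k (qGenerators y fun i =>
    f (MixedCrossedAlgebra.y k Λ r hr (Fin.castLE hr i) * x k Λ r hr i)) with hA
  have hyA : ∀ i, (y i : D) ∈ A := fun i =>
    Algebra.subset_adjoin (Or.inl (Or.inl ⟨i, rfl⟩))
  have hyA' : ∀ i, (((y i)⁻¹ : Dˣ) : D) ∈ A := fun i =>
    Algebra.subset_adjoin (Or.inl (Or.inr ⟨i, rfl⟩))
  have hwA : ∀ i, f (MixedCrossedAlgebra.y k Λ r hr (Fin.castLE hr i) * x k Λ r hr i) ∈ A :=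
    fun i => Algebra.subset_adjoin (Or.inr ⟨i, rfl⟩)
  have hall : ∀ s, f s ∈ A := by
    intro s
    induction s using MixedCrossedAlgebra.induction_on with
    | hc c => rw [AlgHom.commutes]; exact A.algebraMap_mem c
    | hy i => exact hyA i
    | hx i =>
      have := A.mul_mem (hyA' (Fin.castLE hr i)) (hwA i)
      rw [map_mul] at this
      change ((y (Fin.castLE hr i))⁻¹ : Dˣ) * ((y (Fin.castLE hr i) : D) * _) ∈ A at this
      rwa [Units.inv_mul_cancel_left] at this
    | hmul a b ha hb => rw [map_mul]; exact A.mul_mem ha hb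
    | hadd a b ha hb => rw [map_add]; exact A.add_mem ha hb
  intro d
  obtain ⟨a, b, hb, hd⟩ := hfrac d
  exact ⟨f a, hall a, f b, hall b, by rwa [Ne, map_eq_zero_iff f hf], hd⟩

namespace IsQSystem

variable {K B : Type*} [Field K] [Ring B] [Algebra K B] {n r : ℕ} {ι : Fin r → Fin n}
  {lam : Fin n → Fin n → Kˣ} {y : Fin n → Bˣ} {w : Fin r → B}

theorem monomial_mul_poly_mem_span (S : IsQSystem ι lam y w) {Y : (Fin n → ℤ) → Bˣ}
    (hY : ∀ a, IsMonomial (⊤ : Subgroup Kˣ) y (Y a) a) {g : Bˣ} {a : Fin n → ℤ}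
    (hg : IsMonomial (⊤ : Subgroup Kˣ) y g a) (f : MvPolynomial (Fin r) K) :
    (g : B) * S.poly f ∈ Submodule.span K (Set.range (S.basisFun Y)) := by
  obtain ⟨u, -, rfl⟩ := hg.unique S.yy (fun _ _ => Subgroup.mem_top _) (hY a)
  have h : ((scalarUnit B u * Y a : Bˣ) : B) = (u : K) • (Y a : B) := by
    simp [Algebra.smul_def]
  rw [h, smul_mul_assoc]
  refine Submodule.smul_mem _ _ ?_
  rw [f.as_sum, map_sum, Finset.mul_sum]
  refine Submodule.sum_mem _ fun s _ => ?_
  have : MvPolynomial.monomial s (f.coeff s) = f.coeff s • MvPolynomial.monomial s (1 : K) := by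
    rw [MvPolynomial.smul_monomial]; simp
  rw [this, map_smul, mul_smul_comm]
  exact Submodule.smul_mem _ _ (Submodule.subset_span ⟨(a, s), rfl⟩)

/-- The ordered monomials span a subalgebra, which contains the generators. -/
theorem exists_subalgebra (S : IsQSystem ι lam y w) {Y : (Fin n → ℤ) → Bˣ}
    (hY : ∀ a, IsMonomial (⊤ : Subgroup Kˣ) y (Y a) a) :
    ∃ A : Subalgebra K B, qGenerators y w ⊆ A ∧
      ∀ a, a ∈ A ↔ ∃ f, a = Finsupp.linearCombination K (S.basisFun Y) f := by
  have hspan : ∀ a, a ∈ Submodule.span K (Set.range (S.basisFun Y)) ↔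
      ∃ f, a = Finsupp.linearCombination K (S.basisFun Y) f := fun a => by
    rw [Finsupp.mem_span_range_iff_exists_finsupp]
    exact exists_congr fun f => eq_comm
  have hone : (1 : B) ∈ Submodule.span K (Set.range (S.basisFun Y)) := by
    simpa using S.monomial_mul_poly_mem_span hY IsMonomial.one 1
  have hmul : ∀ a b, a ∈ Submodule.span K (Set.range (S.basisFun Y)) →
      b ∈ Submodule.span K (Set.range (S.basisFun Y)) →
      a * b ∈ Submodule.span K (Set.range (S.basisFun Y)) := by
    intro a b ha hb
    induction ha, hb using Submodule.span_induction₂ with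
    | mem_mem a b ha hb =>
      obtain ⟨p, rfl⟩ := ha
      obtain ⟨q, rfl⟩ := hb
      have : S.basisFun Y p * S.basisFun Y q = ((Y p.1 * Y q.1 : Bˣ) : B) *
          S.poly (shift K ι q.1 (MvPolynomial.monomial p.2 1) * MvPolynomial.monomial q.2 1) := by
        rw [basisFun, basisFun, mul_assoc, ← mul_assoc (S.poly _), S.poly_mul (hY q.1), map_mul,
          Units.val_mul]
        simp only [mul_assoc]
      rw [this]
      exact S.monomial_mul_poly_mem_span hY ((hY _).mul (hY _)) _
    | zero_left b hb => simp
    | zero_right a ha => simp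
    | add_left a a' b _ _ _ h h' => rw [add_mul]; exact Submodule.add_mem _ h h'
    | add_right a b b' _ _ _ h h' => rw [mul_add]; exact Submodule.add_mem _ h h'
    | smul_left c a b _ _ h => rw [smul_mul_assoc]; exact Submodule.smul_mem _ _ h
    | smul_right c a b _ _ h => rw [mul_smul_comm]; exact Submodule.smul_mem _ _ h
  refine ⟨Submodule.toSubalgebra _ hone hmul, ?_, hspan⟩
  rintro _ ((⟨i, rfl⟩ | ⟨i, rfl⟩) | ⟨i, rfl⟩)
  · simpa using S.monomial_mul_poly_mem_span hY (.gen i) 1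
  · simpa using S.monomial_mul_poly_mem_span hY (IsMonomial.gen i).inv 1
  · simpa using S.monomial_mul_poly_mem_span hY .one (MvPolynomial.X i)

end IsQSystem

/-- In a division ring with a frame, the ordered monomials span an Ore subring. -/
theorem IsQFrame.exists_subring {K D : Type*} [Field K] [DivisionRing D] [Algebra K D] {n r : ℕ}
    {ι : Fin r → Fin n} {lam : Fin n → Fin n → Kˣ} {y : Fin n → Dˣ} {w : Fin r → D}
    (S : IsQFrame ι lam y w) {Y : (Fin n → ℤ) → Dˣ}
    (hY : ∀ a, IsMonomial (⊤ : Subgroup Kˣ) y (Y a) a) :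
    ∃ A : Subring D, IsFracSubring A ∧
      ∀ a, a ∈ A ↔ ∃ f, a = Finsupp.linearCombination K (S.basisFun Y) f := by
  obtain ⟨A, hA, hspan⟩ := S.exists_subalgebra hY
  exact ⟨A.toSubring, S.frac.mono (Algebra.adjoin_le hA), hspan⟩

instance : IsJacobsonRing ℤ := by
  rw [isJacobsonRing_iff_prime_eq]
  intro P hP
  by_cases h : P = ⊥
  · subst h
    rw [eq_bot_iff]
    intro x hx
    have h1 := Ideal.mem_jacobson_bot.mp hx x
    have h2 : x * x + 1 = 1 := by
      rcases Int.isUnit_iff.mp h1 with h | h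
      · exact h
      · nlinarith [mul_self_nonneg x]
    simpa using h2
  · have := hP.isMaximal h
    exact Ideal.jacobson_eq_self_of_isMaximal

/-- A field of finite type over `ℤ` is finite. -/
theorem finite_of_finiteType_int (κ : Type*) [Field κ] (h : (Int.castRingHom κ).FiniteType) :
    Finite κ := by
  have : Algebra.FiniteType ℤ κ := RingHom.finiteType_algebraMap.mp h
  have : Module.Finite ℤ κ := finite_of_finite_type_of_isJacobsonRing ℤ κ
  have hint : Algebra.IsIntegral ℤ κ := inferInstance
  obtain ⟨p, hp⟩ := CharP.exists κ
  have hp0 : p ≠ 0 := by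
    rintro rfl
    have : CharZero κ := CharP.charP_to_charZero κ
    exact Int.not_isField (isField_of_isIntegral_of_isField (S := κ)
      (algebraMap ℤ κ).injective_int (Field.toIsField κ))
  have : NeZero p := ⟨hp0⟩
  let := ZMod.algebra κ p
  have : Module.Finite (ZMod p) κ := Module.Finite.of_restrictScalars_finite ℤ (ZMod p) κ
  exact Module.finite_of_finite (ZMod p)

/-- Finitely many nonzero elements of a field are units of some valuation ring such that their
residues lie in a finite field. -/
theorem ValuationSubring.exists_finite_residues {k : Type u} [Field k] (T : Finset k) :
    ∃ (O : ValuationSubring k) (κ : Type u) (_ : Field κ) (_ : Finite κ)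
      (φ : κ →+* IsLocalRing.ResidueField O), ∀ t ∈ T, t ≠ 0 → O.valuation t = 1 ∧
        ∃ (h : t ∈ O) (c : κ), φ c = IsLocalRing.residue O ⟨t, h⟩ := by
  classical
  let R : Subalgebra ℤ k := Algebra.adjoin ℤ (T ∪ T.image (fun t => t⁻¹) : Finset k)
  have hR : Algebra.FiniteType ℤ R := (Subalgebra.fg_iff_finiteType R).mp ⟨_, rfl⟩
  obtain ⟨I, hI⟩ := Ideal.exists_maximal R.toSubring
  obtain ⟨O, hRO, hIsub⟩ :=
    Ideal.image_subset_nonunits_valuationSubring (A := R.toSubring) I hI.ne_top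
  let : Field (R.toSubring ⧸ I) := Ideal.Quotient.field I
  have h2 : (Int.castRingHom (R.toSubring ⧸ I)).FiniteType := by
    rw [Subsingleton.elim (Int.castRingHom (R.toSubring ⧸ I))
      ((Ideal.Quotient.mk I).comp (algebraMap ℤ R))]
    exact RingHom.FiniteType.comp (RingHom.FiniteType.of_surjective _ Ideal.Quotient.mk_surjective)
      (RingHom.finiteType_algebraMap.mpr hR)
  let j : R.toSubring →+* O := Subring.inclusion hRO
  let φ : R.toSubring ⧸ I →+* IsLocalRing.ResidueField O :=
    Ideal.Quotient.lift I ((IsLocalRing.residue O).comp j) fun a ha => by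
      have h1 : ((j a : O) : k) ∈ O.nonunits := hIsub ⟨a, ha, rfl⟩
      rw [RingHom.comp_apply, IsLocalRing.residue_eq_zero_iff]
      exact (O.valuation_lt_one_iff _).mpr h1
  refine ⟨O, R.toSubring ⧸ I, inferInstance, finite_of_finiteType_int _ h2, φ, fun t ht ht0 => ?_⟩
  have h3 : t ∈ R.toSubring := Algebra.subset_adjoin (by simp [ht])
  have h4 : t⁻¹ ∈ R.toSubring := Algebra.subset_adjoin (by simp [ht])
  have h5 := (O.valuation_le_one_iff _).mpr (hRO h3)
  have h6 := (O.valuation_le_one_iff _).mpr (hRO h4)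
  refine ⟨le_antisymm h5 ?_, hRO h3, Ideal.Quotient.mk I ⟨t, h3⟩, rfl⟩
  rw [map_inv₀] at h6
  exact (inv_le_one₀ (zero_lt_iff.mpr ((map_ne_zero _).mpr ht0))).mp h6

/-- The residue division ring of a valuation on a division ring. -/
theorem Valuation.exists_residue_divisionRing {D : Type u} {Γ : Type*} [DivisionRing D]
    [LinearOrderedCommGroupWithZero Γ] (V : Valuation D Γ) :
    ∃ (E : Type u) (_ : DivisionRing E) (π : V.integer →+* E), Function.Surjective π ∧
      ∀ a, π a = 0 ↔ V a < 1 := by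
  let I : Ideal V.integer :=
    { carrier := {a | V a < 1}
      add_mem' := fun {a b} ha hb => (V.map_add _ _).trans_lt (max_lt ha hb)
      zero_mem' := by simp
      smul_mem' := fun c a ha => by
        change V ((c : D) * a) < 1
        rw [map_mul]
        exact (mul_le_of_le_one_left' c.2).trans_lt ha }
  have hI : I.IsTwoSided := ⟨fun {a} b ha => by
    change V ((a : D) * b) < 1
    rw [map_mul, mul_comm]
    exact (mul_le_of_le_one_left' b.2).trans_lt ha⟩
  have hmem : ∀ a : V.integer, Ideal.Quotient.mk I a = 0 ↔ V a < 1 := fun a =>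
    Ideal.Quotient.eq_zero_iff_mem
  have hnt : Nontrivial (V.integer ⧸ I) := by
    refine ⟨1, 0, fun h => ?_⟩
    rw [← map_one (Ideal.Quotient.mk I), hmem] at h
    simp at h
  have hunit : ∀ x : V.integer ⧸ I, IsUnit x ∨ x = 0 := by
    intro x
    obtain ⟨a, rfl⟩ := Ideal.Quotient.mk_surjective x
    rcases lt_or_eq_of_le a.2 with h | h
    · exact Or.inr ((hmem a).mpr h)
    · left
      have h0 : (a : D) ≠ 0 := by
        intro h'; rw [h', map_zero] at h; exact zero_ne_one h
      let b : V.integer := ⟨(a : D)⁻¹, by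
        change V _ ≤ 1
        rw [map_inv₀, h, inv_one]⟩
      have h1 : a * b = 1 := Subtype.ext (mul_inv_cancel₀ h0)
      have h2 : b * a = 1 := Subtype.ext (inv_mul_cancel₀ h0)
      exact ⟨⟨_, Ideal.Quotient.mk I b, by rw [← map_mul, h1, map_one],
        by rw [← map_mul, h2, map_one]⟩, rfl⟩
  exact ⟨V.integer ⧸ I, DivisionRing.ofIsUnitOrEqZero hunit, Ideal.Quotient.mk I,
    Ideal.Quotient.mk_surjective, hmem⟩

/-- A set generates a division ring over a field if every subalgebra closed under inverses which
contains it is everything. -/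
def IsDivGenerated (K : Type*) {D : Type*} [Field K] [DivisionRing D] [Algebra K D] (s : Set D) :
    Prop :=
  ∀ B : Subalgebra K D, s ⊆ B → (∀ x ∈ B, x⁻¹ ∈ B) → B = ⊤

/-- Linear combinations of ordered monomials with coefficients in a valuation ring. -/
theorem IsQSystem.linearCombination_mem {k B : Type*} [Field k] [Ring B] [Algebra k B] {n r : ℕ}
    {ι : Fin r → Fin n} {lam : Fin n → Fin n → kˣ} {y : Fin n → Bˣ} {w : Fin r → B}
    (S : IsQSystem ι lam y w) {Y : (Fin n → ℤ) → Bˣ} (O : ValuationSubring k) (Q : Subring B)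
    (hO : ∀ c ∈ O, algebraMap k B c ∈ Q) (hY : ∀ a, (Y a : B) ∈ Q) (hw : ∀ i, w i ∈ Q)
    (f : ((Fin n → ℤ) × (Fin r →₀ ℕ)) →₀ k) (hf : ∀ p, f p ∈ O) :
    Finsupp.linearCombination k (S.basisFun Y) f ∈ Q := by
  rw [Finsupp.linearCombination_apply]
  refine Subring.sum_mem _ fun p _ => ?_
  change f p • S.basisFun Y p ∈ Q
  rw [Algebra.smul_def]
  refine Q.mul_mem (hO _ (hf p)) (Q.mul_mem (hY _) ?_)
  change _ ∈ Q.comap (S.poly : MvPolynomial (Fin r) k →+* B)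
  rw [MvPolynomial.monomial_eq, map_one, one_mul]
  refine Subring.prod_mem _ fun i _ => Subring.pow_mem _ ?_ _
  change S.poly (MvPolynomial.X i) ∈ Q
  rw [S.poly_X]
  exact hw i

section Coefficients

variable {k D : Type u} [Field k] [DivisionRing D] [Algebra k D] {n r : ℕ} {ι : Fin r → Fin n}
  {lam : Fin n → Fin n → kˣ} {y : Fin n → Dˣ} {w : Fin r → D}

/-- `V` extends the valuation of `O` as the Gauss extension for a system. -/
def IsQSystem.IsGauss (S : IsQSystem ι lam y w) (Y : (Fin n → ℤ) → Dˣ) (O : ValuationSubring k)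
    (V : Valuation D O.ValueGroup) : Prop :=
  ∀ f α, IsLead O.valuation (IsQSystem.key n r) f α →
    V (Finsupp.linearCombination k (S.basisFun Y) f) = O.valuation (f α)

theorem IsQFrame.exists_coeffs (S : IsQFrame ι lam y w) {Y : (Fin n → ℤ) → Dˣ}
    (hY : ∀ a, IsMonomial (⊤ : Subgroup kˣ) y (Y a) a) (d : D) :
    ∃ f g, Finsupp.linearCombination k (S.basisFun Y) g ≠ 0 ∧
      d = Finsupp.linearCombination k (S.basisFun Y) f *
        (Finsupp.linearCombination k (S.basisFun Y) g)⁻¹ := by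
  obtain ⟨A, hA, hspan⟩ := S.exists_subring hY
  obtain ⟨a, ha, b, hb, hb0, hd⟩ := hA d
  obtain ⟨f, rfl⟩ := (hspan a).mp ha
  obtain ⟨g, rfl⟩ := (hspan b).mp hb
  exact ⟨f, g, hb0, hd⟩

theorem IsQFrame.exists_finset_eq_one (S : IsQFrame ι lam y w) {Y : (Fin n → ℤ) → Dˣ}
    (hY : ∀ a, IsMonomial (⊤ : Subgroup kˣ) y (Y a) a) (d : D) :
    ∃ T : Finset k, ∀ (O : ValuationSubring k) (V : Valuation D O.ValueGroup),
      S.IsGauss Y O V → (∀ t ∈ T, t ≠ 0 → O.valuation t = 1) → d ≠ 0 → V d = 1 := by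
  classical
  obtain ⟨f, g, hg, rfl⟩ := S.exists_coeffs hY d
  refine ⟨f.support.image f ∪ g.support.image g, fun O V hV hT hd => ?_⟩
  have key : ∀ h, Finsupp.linearCombination k (S.basisFun Y) h ≠ 0 →
      h.support.image h ⊆ f.support.image f ∪ g.support.image g →
      V (Finsupp.linearCombination k (S.basisFun Y) h) = 1 := by
    intro h h0 hs
    have h0 : h ≠ 0 := by rintro rfl; simp at h0
    obtain ⟨α, hα⟩ := IsLead.exists_isLead (v := O.valuation) (key := IsQSystem.key n r) h0
    rw [hV h α hα]
    exact hT _ (hs (Finset.mem_image_of_mem _ (Finsupp.mem_support_iff.mpr hα.ne))) hα.ne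
  rw [map_mul, map_inv₀, key f (left_ne_zero_of_mul hd) Finset.subset_union_left,
    key g hg Finset.subset_union_right]
  simp

theorem IsQFrame.exists_finset_mem (S : IsQFrame ι lam y w) {Y : (Fin n → ℤ) → Dˣ}
    (hY : ∀ a, IsMonomial (⊤ : Subgroup kˣ) y (Y a) a)
    {n' r' : ℕ} {ι' : Fin r' → Fin n'}
    {lam' : Fin n' → Fin n' → kˣ} {y' : Fin n' → Dˣ} {w' : Fin r' → D}
    (S' : IsQFrame ι' lam' y' w') {Y' : (Fin n' → ℤ) → Dˣ}
    (hY' : ∀ a, IsMonomial (⊤ : Subgroup kˣ) y' (Y' a) a) (d : D) :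
    ∃ T : Finset k, ∀ (O : ValuationSubring k) (V : Valuation D O.ValueGroup) (Q : Subring D),
      S.IsGauss Y O V → (∀ t ∈ T, t ≠ 0 → O.valuation t = 1) →
      (∀ c ∈ O, algebraMap k D c ∈ Q) → (∀ a, (Y' a : D) ∈ Q) → (∀ i, w' i ∈ Q) →
      (∀ x ∈ Q, V x = 1 → x⁻¹ ∈ Q) → d ∈ Q := by
  classical
  obtain ⟨f, g, hg, rfl⟩ := S'.exists_coeffs hY' d
  obtain ⟨T, hT⟩ := S.exists_finset_eq_one hY (Finsupp.linearCombination k (S'.basisFun Y') g)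
  refine ⟨T ∪ (f.support.image f ∪ g.support.image g), fun O V Q hV hTO hO hYQ hwQ hQ => ?_⟩
  have key : ∀ h : ((Fin n' → ℤ) × (Fin r' →₀ ℕ)) →₀ k,
      h.support.image h ⊆ f.support.image f ∪ g.support.image g →
      Finsupp.linearCombination k (S'.basisFun Y') h ∈ Q := by
    refine fun h hs => S'.linearCombination_mem O Q hO hYQ hwQ h fun p => ?_
    by_cases hp : h p = 0
    · rw [hp]; exact O.zero_mem
    · rw [← O.valuation_le_one_iff]
      exact (hTO _ (Finset.mem_union_right _ (hs (Finset.mem_image_of_mem _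
        (Finsupp.mem_support_iff.mpr hp)))) hp).le
  refine Q.mul_mem (key f Finset.subset_union_left) (hQ _ (key g Finset.subset_union_right) ?_)
  exact hT O V hV (fun t ht => hTO t (Finset.mem_union_left _ ht)) hg

end Coefficients

section Reduction

/-- The element `x` of the valuation ring has residue `e`. -/
def Valuation.Reduces {D E Γ : Type*} [DivisionRing D] [LinearOrderedCommGroupWithZero Γ]
    {V : Valuation D Γ} [DivisionRing E] (π : V.integer →+* E) (x : D) (e : E) : Prop :=
  ∃ h : V x ≤ 1, π ⟨x, h⟩ = e

namespace Valuation.Reduces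

variable {D E Γ : Type*} [DivisionRing D] [LinearOrderedCommGroupWithZero Γ]
  {V : Valuation D Γ} [DivisionRing E] {π : V.integer →+* E} {x x' : D} {e e' : E}

theorem add (h : Reduces π x e) (h' : Reduces π x' e') : Reduces π (x + x') (e + e') := by
  obtain ⟨h, rfl⟩ := h
  obtain ⟨h', rfl⟩ := h'
  exact ⟨V.integer.add_mem h h', by rw [← map_add]; rfl⟩

theorem mul (h : Reduces π x e) (h' : Reduces π x' e') : Reduces π (x * x') (e * e') := by
  obtain ⟨h, rfl⟩ := h
  obtain ⟨h', rfl⟩ := h'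
  exact ⟨V.integer.mul_mem h h', by rw [← map_mul]; rfl⟩

variable (π) in
theorem one : Reduces π 1 1 := ⟨V.integer.one_mem, map_one π⟩

variable (π) in
theorem zero : Reduces π 0 0 := ⟨V.integer.zero_mem, map_zero π⟩

theorem pow (h : Reduces π x e) (n : ℕ) : Reduces π (x ^ n) (e ^ n) := by
  induction n with
  | zero => simpa using one π
  | succ n ih => rw [pow_succ, pow_succ]; exact ih.mul h

theorem sum {I : Type*} (s : Finset I) {x : I → D} {e : I → E}
    (h : ∀ i ∈ s, Reduces π (x i) (e i)) :
    Reduces π (∑ i ∈ s, x i) (∑ i ∈ s, e i) := by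
  classical
  induction s using Finset.induction_on with
  | empty => simpa using zero π
  | insert a s ha ih =>
    rw [Finset.sum_insert ha, Finset.sum_insert ha]
    exact (h a (Finset.mem_insert_self _ _)).add
      (ih fun i hi => h i (Finset.mem_insert_of_mem hi))

theorem unique (h : Reduces π x e) (h' : Reduces π x e') : e = e' := h.2.symm.trans h'.2

end Valuation.Reduces

open Valuation

variable {k D : Type u} [Field k] [DivisionRing D] [Algebra k D]

/-- A reduction map from a valuation ring of `D` extending `O` to a division ring over the residue
field of `O`. -/
structure IsReduction {O : ValuationSubring k} {V : Valuation D O.ValueGroup} {E : Type u}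
    [DivisionRing E] [Algebra (IsLocalRing.ResidueField O) E] (π : V.integer →+* E) : Prop where
  surj : Function.Surjective π
  ker : ∀ a, π a = 0 ↔ V a < 1
  alg : ∀ c : O, Reduces π (algebraMap k D c) (algebraMap _ E (IsLocalRing.residue O c))

theorem Valuation.exists_isReduction {O : ValuationSubring k} {V : Valuation D O.ValueGroup}
    (hV : ∀ c : k, V (algebraMap k D c) = O.valuation c) :
    ∃ (E : Type u) (_ : DivisionRing E) (_ : Algebra (IsLocalRing.ResidueField O) E)
      (π : V.integer →+* E), IsReduction π := by
  obtain ⟨E, _, π, hs, hk⟩ := V.exists_residue_divisionRing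
  let j : O →+* V.integer := ((algebraMap k D).comp O.subtype).codRestrict V.integer fun c => by
    change V (algebraMap k D c) ≤ 1
    rw [hV]
    exact O.valuation_le_one c
  let i : IsLocalRing.ResidueField O →+* E := Ideal.Quotient.lift _ (π.comp j) fun c hc => by
    rw [RingHom.comp_apply, hk]
    change V (algebraMap k D c) < 1
    rw [hV]
    exact (O.valuation_lt_one_iff _).mp hc
  have hcomm : ∀ c x, i c * x = x * i c := by
    intro c x
    obtain ⟨c, rfl⟩ := IsLocalRing.residue_surjective c
    obtain ⟨x, rfl⟩ := hs x
    change π (j c) * π x = π x * π (j c)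
    rw [← map_mul, ← map_mul]
    congr 1
    exact Subtype.ext (Algebra.commutes (c : k) (x : D))
  let _ : Algebra (IsLocalRing.ResidueField O) E := i.toAlgebra' hcomm
  exact ⟨E, _, inferInstance, π, hs, hk, fun c => ⟨(j c).2, rfl⟩⟩

namespace IsReduction

variable {O : ValuationSubring k} {V : Valuation D O.ValueGroup} {E : Type u}
    [DivisionRing E] [Algebra (IsLocalRing.ResidueField O) E] {π : V.integer →+* E}

theorem exists_unit (h : IsReduction π) {g : Dˣ} (hg : V g = 1) :
    ∃ e : Eˣ, Reduces π g e := by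
  have hne : π ⟨g, hg.le⟩ ≠ 0 := by
    rw [Ne, h.ker, hg]; simp
  exact ⟨Units.mk0 _ hne, hg.le, rfl⟩

theorem reduces_inv (h : IsReduction π) {g : Dˣ} {e : Eˣ} (hg : Reduces π (g : D) (e : E)) :
    Reduces π ((g⁻¹ : Dˣ) : D) ((e⁻¹ : Eˣ) : E) := by
  have h1 : V g = 1 := by
    refine le_antisymm hg.1 (not_lt.mp fun hlt => ?_)
    have := (h.ker ⟨g, hg.1⟩).mpr hlt
    rw [hg.2] at this
    exact e.ne_zero this
  have h2 : V ((g⁻¹ : Dˣ) : D) = 1 := by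
    rw [Units.val_inv_eq_inv_val, map_inv₀, h1, inv_one]
  refine ⟨h2.le, ?_⟩
  rw [← one_mul ((e⁻¹ : Eˣ) : E), Units.eq_mul_inv_iff_mul_eq, ← hg.2, ← map_mul, ← map_one π]
  congr 1
  exact Subtype.ext (Units.inv_mul g)

variable {n r : ℕ} {ι : Fin r → Fin n} {lam : Fin n → Fin n → kˣ} {y : Fin n → Dˣ} {w : Fin r → D}
  {ybar : Fin n → Eˣ} {wbar : Fin r → E}

/-- The residue of a unit of a valuation ring. -/
noncomputable abbrev resUnit {u : kˣ} (hu : u ∈ O.unitGroup) : (IsLocalRing.ResidueField O)ˣ :=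
  O.unitGroupToResidueFieldUnits ⟨u, hu⟩

theorem reduces_algebraMap (h : IsReduction π) {u : kˣ} (hu : u ∈ O.unitGroup) :
    Reduces π (algebraMap k D u) (algebraMap _ E (resUnit hu : IsLocalRing.ResidueField O)) :=
  h.alg (O.unitGroupMulEquiv ⟨u, hu⟩ : O)

theorem isQSystem (h : IsReduction π) (S : IsQSystem ι lam y w)
    (hlam : ∀ i j, lam i j ∈ O.unitGroup) (hy : ∀ i, Reduces π (y i : D) (ybar i : E))
    (hw : ∀ i, Reduces π (w i) (wbar i)) :
    IsQSystem ι (fun i j => resUnit (hlam i j)) ybar wbar where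
  yy i j := by
    have h1 := (hy i).mul (hy j)
    rw [S.yy, Algebra.smul_def] at h1
    rw [Algebra.smul_def]
    exact h1.unique ((h.reduces_algebraMap (hlam i j)).mul ((hy j).mul (hy i)))
  wy i j := by
    have h1 := (hw i).mul (hy j)
    rw [S.wy] at h1
    refine h1.unique ((hy j).mul ((hw i).add ?_))
    split_ifs
    · exact .one π
    · exact .zero π
  ww i j := by
    have h1 := (hw i).mul (hw j)
    rw [S.ww] at h1
    exact h1.unique ((hw j).mul (hw i))

theorem isMonomial (h : IsReduction π) (hy : ∀ i, Reduces π (y i : D) (ybar i : E)) {g : Dˣ}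
    {a : Fin n → ℤ} (hg : IsMonomial O.unitGroup y g a) :
    ∃ e : Eˣ, Reduces π (g : D) (e : E) ∧
      IsMonomial (⊤ : Subgroup (IsLocalRing.ResidueField O)ˣ) ybar e a := by
  induction hg with
  | gen i => exact ⟨_, hy i, .gen i⟩
  | scalar u hu =>
    exact ⟨scalarUnit E (resUnit hu), h.reduces_algebraMap hu, .scalar _ trivial⟩
  | mul _ _ ih ih' =>
    obtain ⟨e, h1, h2⟩ := ih
    obtain ⟨e', h1', h2'⟩ := ih'
    exact ⟨_, h1.mul h1', h2.mul h2'⟩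
  | inv _ h1 =>
    obtain ⟨e, h1, h2⟩ := h1
    exact ⟨_, h.reduces_inv h1, h2.inv⟩

theorem isDivGenerated (h : IsReduction π)
    (hy : ∀ i, Reduces π (y i : D) (ybar i : E)) (hw : ∀ i, Reduces π (w i) (wbar i))
    (hgen : ∀ Q : Subring D, (∀ c ∈ O, algebraMap k D c ∈ Q) → (∀ i, (y i : D) ∈ Q) →
      (∀ i, w i ∈ Q) → (∀ x ∈ Q, V x = 1 → x⁻¹ ∈ Q) → ∀ d, V d ≤ 1 → d ∈ Q) :
    IsDivGenerated (IsLocalRing.ResidueField O) (qGenerators ybar wbar) := by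
  intro B hB hinv
  let Q : Subring D := (B.toSubring.comap π).map V.integer.subtype
  have hQ : ∀ x, x ∈ Q ↔ ∃ e ∈ B, Reduces π x e := by
    intro x
    constructor
    · rintro ⟨x, hx, rfl⟩
      exact ⟨_, hx, x.2, rfl⟩
    · rintro ⟨e, he, hx, rfl⟩
      exact ⟨⟨x, hx⟩, he, rfl⟩
  rw [eq_top_iff]
  rintro e -
  obtain ⟨⟨d, hd⟩, rfl⟩ := h.surj e
  have hdQ := hgen Q ?_ ?_ ?_ ?_ d hd
  · obtain ⟨e, he, hr⟩ := (hQ d).mp hdQ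
    rwa [hr.2]
  · intro c hc
    exact (hQ _).mpr ⟨_, B.algebraMap_mem _, h.alg ⟨c, hc⟩⟩
  · exact fun i => (hQ _).mpr ⟨_, hB (Or.inl (Or.inl ⟨i, rfl⟩)), hy i⟩
  · exact fun i => (hQ _).mpr ⟨_, hB (Or.inr ⟨i, rfl⟩), hw i⟩
  · intro x hx h1
    obtain ⟨e, he, hr⟩ := (hQ _).mp hx
    have hx0 : x ≠ 0 := by rintro rfl; simp at h1
    have h2 : V (Units.mk0 x hx0 : D) = 1 := h1
    obtain ⟨e', he'⟩ := h.exists_unit h2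
    obtain rfl := hr.unique he'
    exact (hQ _).mpr ⟨_, hinv _ he, by simpa using h.reduces_inv he'⟩

theorem reduces_basisFun (S : IsQSystem ι lam y w)
    {lam' : Fin n → Fin n → (IsLocalRing.ResidueField O)ˣ} (S' : IsQSystem ι lam' ybar wbar)
    (hw : ∀ i, Reduces π (w i) (wbar i)) {Y : (Fin n → ℤ) → Dˣ} {Ybar : (Fin n → ℤ) → Eˣ}
    (hY : ∀ a, Reduces π (Y a : D) (Ybar a : E)) (p : (Fin n → ℤ) × (Fin r →₀ ℕ)) :
    Reduces π (S.basisFun Y p) (S'.basisFun Ybar p) := by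
  refine (hY _).mul ?_
  induction p.2 using Finsupp.induction_linear with
  | zero =>
    have : ∀ (K : Type u) [Field K], MvPolynomial.monomial (0 : Fin r →₀ ℕ) (1 : K) = 1 :=
      fun _ _ => rfl
    rw [this, this, map_one, map_one]
    exact .one π
  | add f g h1 h2 =>
    have : ∀ (K : Type u) [Field K], MvPolynomial.monomial (f + g) (1 : K) =
      MvPolynomial.monomial f 1 * MvPolynomial.monomial g 1 := fun _ _ => by simp
    rw [this, this, map_mul, map_mul]
    exact h1.mul h2
  | single i m =>
    have : ∀ (K : Type u) [Field K], MvPolynomial.monomial (Finsupp.single i m) (1 : K) =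
      MvPolynomial.X i ^ m := fun K _ => by rw [MvPolynomial.X_pow_eq_monomial]
    rw [this, this, map_pow, map_pow, S.poly_X, S'.poly_X]
    exact (hw i).pow m

theorem linearIndependent (h : IsReduction π) (S : IsQSystem ι lam y w)
    {lam' : Fin n → Fin n → (IsLocalRing.ResidueField O)ˣ} (S' : IsQSystem ι lam' ybar wbar)
    (hw : ∀ i, Reduces π (w i) (wbar i)) {Y : (Fin n → ℤ) → Dˣ} {Ybar : (Fin n → ℤ) → Eˣ}
    (hY : ∀ a, Reduces π (Y a : D) (Ybar a : E)) (hG : S.IsGauss Y O V) :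
    LinearIndependent (IsLocalRing.ResidueField O) (S'.basisFun Ybar) := by
  classical
  rw [linearIndependent_iff]
  intro f hf
  obtain ⟨s, hs⟩ : ∃ s : IsLocalRing.ResidueField O → O, ∀ c,
      IsLocalRing.residue O (s c) = c := ⟨_, Function.surjInv_eq IsLocalRing.residue_surjective⟩
  let t : IsLocalRing.ResidueField O → k := fun c => if c = 0 then 0 else s c
  have ht0 : t 0 = 0 := by simp [t]
  let f' : ((Fin n → ℤ) × (Fin r →₀ ℕ)) →₀ k := f.mapRange t ht0
  have ht : ∀ c, Reduces π (algebraMap k D (t c)) (algebraMap _ E c) := by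
    intro c
    by_cases hc : c = 0
    · simpa [hc, ht0] using Reduces.zero π
    · have := h.alg (s c)
      rw [hs] at this
      simpa [t, hc] using this
  have hred : Reduces π (Finsupp.linearCombination k (S.basisFun Y) f')
      (Finsupp.linearCombination _ (S'.basisFun Ybar) f) := by
    rw [Finsupp.linearCombination_apply, Finsupp.linearCombination_apply, Finsupp.sum, Finsupp.sum,
      Finset.sum_subset (s₁ := f'.support) (s₂ := f.support) Finsupp.support_mapRange]
    · refine Reduces.sum _ fun p _ => ?_
      rw [Algebra.smul_def, Algebra.smul_def]
      exact (ht _).mul (reduces_basisFun S S' hw hY p)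
    · intro p _ hp
      rw [Finsupp.notMem_support_iff.mp hp, zero_smul]
  have hlt : V (Finsupp.linearCombination k (S.basisFun Y) f') < 1 :=
    (h.ker ⟨_, hred.1⟩).mp (hred.2.trans hf)
  by_contra hne
  obtain ⟨p, hp⟩ := Finsupp.ne_iff.mp hne
  have hf'p : f' p = s (f p) := by
    have : f' p = t (f p) := rfl
    rw [this]; exact if_neg hp
  have hval : O.valuation (s (f p) : k) = 1 := by
    refine le_antisymm (O.valuation_le_one _) (not_lt.mp fun hlt => hp ?_)
    rw [← hs (f p)]
    exact (IsLocalRing.residue_eq_zero_iff _).mpr ((O.valuation_lt_one_iff _).mpr hlt)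
  have hf'0 : f' ≠ 0 := fun h0 => by
    rw [h0, Finsupp.zero_apply] at hf'p
    rw [← hf'p, map_zero] at hval
    exact zero_ne_one hval
  obtain ⟨α, hα⟩ := IsLead.exists_isLead (v := O.valuation) (key := IsQSystem.key n r) hf'0
  rw [hG _ _ hα] at hlt
  have := (hα.le p).trans_lt hlt
  rw [hf'p, hval] at this
  exact this.false

end IsReduction

variable {n r : ℕ} {ι : Fin r → Fin n} {lam : Fin n → Fin n → kˣ} {y : Fin n → Dˣ} {w : Fin r → D}

theorem IsMonomial.mono_top {B : Type*} [Ring B] [Algebra k B] {y : Fin n → Bˣ}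
    {U : Subgroup kˣ} {g : Bˣ} {a : Fin n → ℤ} (h : IsMonomial U y g a) :
    IsMonomial (⊤ : Subgroup kˣ) y g a :=
  h.mono le_top

theorem IsQFrame.exists_isGauss (S : IsQFrame ι lam y w) (O : ValuationSubring k)
    (hlam : ∀ i j, lam i j ∈ O.unitGroup) {Y : (Fin n → ℤ) → Dˣ}
    (hY : ∀ a, IsMonomial O.unitGroup y (Y a) a) :
    ∃ V : Valuation D O.ValueGroup, S.IsGauss Y O V := by
  have hYt := fun a => (hY a).mono_top
  obtain ⟨c, -, hc⟩ := S.isTriangular O.valuation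
    (fun u hu => O.mem_unitGroup_iff u |>.mp hu) hlam hY
  obtain ⟨A, hA, hspan⟩ := S.exists_subring hYt
  exact hc.exists_valuation IsQSystem.key_injective IsQSystem.key_add (S.li Y hYt) hA hspan

theorem IsMonomial.mem_subring {O : ValuationSubring k} {g : Dˣ} {a : Fin n → ℤ}
    (hg : IsMonomial O.unitGroup y g a) (Q : Subring D) (hO : ∀ c ∈ O, algebraMap k D c ∈ Q)
    (hy : ∀ i, (y i : D) ∈ Q) (hy' : ∀ i, (((y i)⁻¹ : Dˣ) : D) ∈ Q) : (g : D) ∈ Q := by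
  let H : Subgroup Dˣ :=
    { carrier := {g | (g : D) ∈ Q ∧ ((g⁻¹ : Dˣ) : D) ∈ Q}
      mul_mem' := fun {g h} hg hh => by
        refine ⟨Q.mul_mem hg.1 hh.1, ?_⟩
        rw [mul_inv_rev]
        exact Q.mul_mem hh.2 hg.2
      one_mem' := by simp
      inv_mem' := fun {g} hg => ⟨hg.2, by simpa using hg.1⟩ }
  refine (hg.mem H (fun i => ⟨hy i, hy' i⟩) fun u hu => ⟨hO _ ?_, ?_⟩).1
  · exact (O.valuation_le_one_iff _).mp ((O.mem_unitGroup_iff u).mp hu).le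
  · rw [← _root_.map_inv]
    exact hO _ ((O.valuation_le_one_iff _).mp ((O.mem_unitGroup_iff _).mp
      (O.unitGroup.inv_mem hu)).le)

/-- Elements of the valuation ring are fractions with integral coefficients and denominator of
valuation one. -/
theorem IsQFrame.mem_of_isGauss (S : IsQFrame ι lam y w) {O : ValuationSubring k}
    {Y : (Fin n → ℤ) → Dˣ} (hY : ∀ a, IsMonomial O.unitGroup y (Y a) a)
    {V : Valuation D O.ValueGroup} (hG : S.IsGauss Y O V) (hy : ∀ i, V (y i) = 1) (Q : Subring D)
    (hO : ∀ c ∈ O, algebraMap k D c ∈ Q) (hyQ : ∀ i, (y i : D) ∈ Q) (hwQ : ∀ i, w i ∈ Q)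
    (hQ : ∀ x ∈ Q, V x = 1 → x⁻¹ ∈ Q) (d : D) (hd : V d ≤ 1) : d ∈ Q := by
  have hYQ : ∀ a, (Y a : D) ∈ Q := fun a =>
    (hY a).mem_subring Q hO hyQ fun i => by simpa using hQ _ (hyQ i) (hy i)
  obtain ⟨f, g, hg, rfl⟩ := S.exists_coeffs (fun a => (hY a).mono_top) d
  have hg0 : g ≠ 0 := by rintro rfl; simp at hg
  obtain ⟨α, hα⟩ := IsLead.exists_isLead (v := O.valuation) (key := IsQSystem.key n r) hg0
  set L := Finsupp.linearCombination k (S.basisFun Y)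
  have hV : ∀ f : ((Fin n → ℤ) × (Fin r →₀ ℕ)) →₀ k, V (L f) ≤ 1 → L f ∈ Q := by
    intro f hf
    refine S.linearCombination_mem O Q hO hYQ hwQ f fun p => ?_
    by_cases hf0 : f = 0
    · simp [hf0, O.zero_mem]
    obtain ⟨β, hβ⟩ := IsLead.exists_isLead (v := O.valuation) (key := IsQSystem.key n r) hf0
    rw [← O.valuation_le_one_iff]
    exact (hβ.le p).trans ((hG f β hβ).symm.trans_le hf)
  have hc : V (L ((g α)⁻¹ • g)) = 1 := by
    have hl : IsLead O.valuation (IsQSystem.key n r) ((g α)⁻¹ • g) α := by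
      refine ⟨by simp [hα.ne], fun γ => ?_, fun γ hγ => ?_⟩
      · simp only [Finsupp.smul_apply, smul_eq_mul, map_mul]
        exact mul_le_mul_right (hα.le γ) _
      · simp only [Finsupp.smul_apply, smul_eq_mul, map_mul]
        exact mul_lt_mul_of_pos_left (hα.lt γ hγ)
          (zero_lt_iff.mpr ((map_ne_zero _).mpr (inv_ne_zero hα.ne)))
    rw [hG _ _ hl]
    simp [hα.ne]
  have e : L f * (L g)⁻¹ = L ((g α)⁻¹ • f) * (L ((g α)⁻¹ • g))⁻¹ := by
    rw [map_smul, map_smul, Algebra.smul_def, Algebra.smul_def, mul_inv_rev,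
      Algebra.commutes, mul_assoc, ← mul_assoc _ _ (algebraMap k D _)⁻¹, Algebra.commutes,
      mul_assoc, mul_inv_cancel₀, mul_one]
    simpa using hα.ne
  have hd' := hd
  rw [e, map_mul, map_inv₀, hc, inv_one, mul_one] at hd'
  rw [e]
  exact Q.mul_mem (hV _ hd') (hQ _ (hV _ hc.le) hc)

end Reduction

section SpecializationOfFrames

open Valuation

/-- A system generating a division ring whose parameters lie in a finite field. -/
structure IsFiniteSystem {κ K D : Type*} [Field κ] [Field K] [DivisionRing D] [Algebra K D]
    {n r : ℕ} (φ : κ →+* K) (ι : Fin r → Fin n) (lam : Fin n → Fin n → Kˣ) (y : Fin n → Dˣ)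
    (w : Fin r → D) : Prop extends IsQSystem ι lam y w where
  lam_mem : ∀ i j, ∃ c, φ c = lam i j
  gen : IsDivGenerated K (qGenerators y w)

section Specialization

variable {k D : Type u} [Field k] [DivisionRing D] [Algebra k D]
  {n r : ℕ} {ι : Fin r → Fin n} {lam : Fin n → Fin n → kˣ} {y : Fin n → Dˣ} {w : Fin r → D}
  {n' r' : ℕ} {ι' : Fin r' → Fin n'} {lam' : Fin n' → Fin n' → kˣ} {y' : Fin n' → Dˣ}
  {w' : Fin r' → D}

theorem IsQFrame.val_of_isGauss (S : IsQFrame ι lam y w) {O : ValuationSubring k}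
    {Y : (Fin n → ℤ) → Dˣ} (hY : ∀ a, IsMonomial O.unitGroup y (Y a) a)
    (hlam : ∀ i j, lam i j ∈ O.unitGroup)
    {V : Valuation D O.ValueGroup} (hG : S.IsGauss Y O V) :
    (∀ c, V (algebraMap k D c) = O.valuation c) ∧ (∀ i, V (y i) = 1) ∧ ∀ i, V (w i) = 1 := by
  classical
  have hlead : ∀ (p : (Fin n → ℤ) × (Fin r →₀ ℕ)) (c : k), c ≠ 0 →
      IsLead O.valuation (IsQSystem.key n r) (Finsupp.single p c) p := fun p c hc =>
    ⟨by simpa, fun γ => by by_cases h : p = γ <;> simp [h],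
      fun γ hγ => by
        have : p ≠ γ := by rintro rfl; exact lt_irrefl _ hγ
        simpa [Finsupp.single_apply, this, zero_lt_iff] using hc⟩
  have h1 : ∀ p (c : k), c ≠ 0 → V (c • S.basisFun Y p) = O.valuation c := fun p c hc => by
    simpa using hG _ _ (hlead p c hc)
  have hunit : ∀ u ∈ O.unitGroup, O.valuation (u : k) = 1 := fun u hu =>
    (O.mem_unitGroup_iff u).mp hu
  have hY0 : ∃ u ∈ O.unitGroup, Y 0 = scalarUnit D u * 1 :=
    (hY 0).unique S.yy hlam IsMonomial.one
  obtain ⟨u, hu, hu0⟩ := hY0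
  have hb0 : S.basisFun Y (0, 0) = algebraMap k D u := by
    have : MvPolynomial.monomial (0 : Fin r →₀ ℕ) (1 : k) = 1 := rfl
    simp [IsQSystem.basisFun, hu0, this]
  have hval : ∀ c, V (algebraMap k D c) = O.valuation c := by
    intro c
    by_cases hc : c = 0
    · simp [hc]
    have := h1 (0, 0) (c * (u : k)⁻¹) (by simp [hc])
    rw [hb0, Algebra.smul_def, ← map_mul, mul_assoc, inv_mul_cancel₀ u.ne_zero, mul_one, map_mul,
      map_inv₀, hunit u hu, inv_one, mul_one] at this
    exact this
  refine ⟨hval, fun i => ?_, fun i => ?_⟩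
  · obtain ⟨v, hv, hv0⟩ := (hY _).unique S.yy hlam (IsMonomial.gen i)
    have := h1 (Pi.single i 1, 0) 1 one_ne_zero
    have h0 : MvPolynomial.monomial (0 : Fin r →₀ ℕ) (1 : k) = 1 := rfl
    simpa [IsQSystem.basisFun, h0, hv0, hval, hunit v hv] using this
  · have := h1 (0, Finsupp.single i 1) 1 one_ne_zero
    have h0 : MvPolynomial.monomial (Finsupp.single i 1) (1 : k) = MvPolynomial.X i := rfl
    simpa [IsQSystem.basisFun, h0, hu0, hval, hunit u hu] using this

/-- Two systems generating the same division ring in characteristic zero can be specialized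
simultaneously over a field of positive characteristic. -/
theorem IsQFrame.exists_specialization (S : IsQFrame ι lam y w) (S' : IsQFrame ι' lam' y' w') :
    ∃ (κ K E : Type u) (_ : Field κ) (_ : Finite κ) (_ : Field K) (_ : DivisionRing E)
      (_ : Algebra K E) (φ : κ →+* K)
      (μ : Fin n → Fin n → Kˣ) (x : Fin n → Eˣ) (z : Fin r → E)
      (μ' : Fin n' → Fin n' → Kˣ) (x' : Fin n' → Eˣ) (z' : Fin r' → E)
      (R : IsFiniteSystem φ ι μ x z) (_ : IsFiniteSystem φ ι' μ' x' z')
      (X : (Fin n → ℤ) → Eˣ), (∀ a, IsMonomial (⊤ : Subgroup Kˣ) x (X a) a) ∧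
        LinearIndependent K (R.basisFun X) := by
  classical
  choose Y hYb using IsMonomial.exists_of_exp (⊥ : Subgroup kˣ) y
  choose Y' hYb' using IsMonomial.exists_of_exp (⊥ : Subgroup kˣ) y'
  have hYt : ∀ a, IsMonomial (⊤ : Subgroup kˣ) y (Y a) a := fun a => (hYb a).mono_top
  have hYt' : ∀ a, IsMonomial (⊤ : Subgroup kˣ) y' (Y' a) a := fun a => (hYb' a).mono_top
  choose T₁ hT₁ using S.exists_finset_eq_one hYt
  choose T₂ hT₂ using S.exists_finset_mem hYt S' hYt'
  let T : Finset k := Finset.univ.image (fun i : Fin n × Fin n => (lam i.1 i.2 : k)) ∪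
    Finset.univ.image (fun i : Fin n' × Fin n' => (lam' i.1 i.2 : k)) ∪
    Finset.univ.biUnion (fun i => T₁ (y' i)) ∪ Finset.univ.biUnion (fun i => T₁ (w' i)) ∪
    Finset.univ.biUnion (fun i => T₂ (y i)) ∪ Finset.univ.biUnion (fun i => T₂ (w i))
  obtain ⟨O, κ, _, _, φ, hT⟩ := ValuationSubring.exists_finite_residues T
  have hTl : ∀ i j, (lam i j : k) ∈ T := fun i j => by
    simp only [T, Finset.mem_union, Finset.mem_image, Finset.mem_univ, true_and]
    exact Or.inl (Or.inl (Or.inl (Or.inl (Or.inl ⟨(i, j), rfl⟩))))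
  have hTl' : ∀ i j, (lam' i j : k) ∈ T := fun i j => by
    simp only [T, Finset.mem_union, Finset.mem_image, Finset.mem_univ, true_and]
    exact Or.inl (Or.inl (Or.inl (Or.inl (Or.inr ⟨(i, j), rfl⟩))))
  have hTy' : ∀ i, T₁ (y' i) ⊆ T := fun i t ht => by
    simp only [T, Finset.mem_union, Finset.mem_biUnion, Finset.mem_univ, true_and]
    exact Or.inl (Or.inl (Or.inl (Or.inr ⟨i, ht⟩)))
  have hTw' : ∀ i, T₁ (w' i) ⊆ T := fun i t ht => by
    simp only [T, Finset.mem_union, Finset.mem_biUnion, Finset.mem_univ, true_and]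
    exact Or.inl (Or.inl (Or.inr ⟨i, ht⟩))
  have hTy : ∀ i, T₂ (y i) ⊆ T := fun i t ht => by
    simp only [T, Finset.mem_union, Finset.mem_biUnion, Finset.mem_univ, true_and]
    exact Or.inl (Or.inr ⟨i, ht⟩)
  have hTw : ∀ i, T₂ (w i) ⊆ T := fun i t ht => by
    simp only [T, Finset.mem_union, Finset.mem_biUnion, Finset.mem_univ, true_and]
    exact Or.inr ⟨i, ht⟩
  have hTO : ∀ t ∈ T, t ≠ 0 → O.valuation t = 1 := fun t ht h0 => (hT t ht h0).1
  have hlam : ∀ i j, lam i j ∈ O.unitGroup := fun i j =>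
    (O.mem_unitGroup_iff _).mpr (hTO _ (hTl i j) (lam i j).ne_zero)
  have hlam' : ∀ i j, lam' i j ∈ O.unitGroup := fun i j =>
    (O.mem_unitGroup_iff _).mpr (hTO _ (hTl' i j) (lam' i j).ne_zero)
  have hY : ∀ a, IsMonomial O.unitGroup y (Y a) a := fun a => (hYb a).mono bot_le
  have hY' : ∀ a, IsMonomial O.unitGroup y' (Y' a) a := fun a => (hYb' a).mono bot_le
  obtain ⟨V, hG⟩ := S.exists_isGauss O hlam hY
  obtain ⟨hV, hVy, hVw⟩ := S.val_of_isGauss hY hlam hG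
  have hVy' : ∀ i, V (y' i) = 1 := fun i =>
    hT₁ (y' i) O V hG (fun t ht => hTO t (hTy' i ht)) (y' i).ne_zero
  have hVw' : ∀ i, V (w' i) ≤ 1 := fun i => by
    by_cases h0 : w' i = 0
    · simp [h0]
    · exact (hT₁ (w' i) O V hG (fun t ht => hTO t (hTw' i ht)) h0).le
  obtain ⟨E, _, _, π, hπ⟩ := Valuation.exists_isReduction hV
  choose x hx using fun i => hπ.exists_unit (hVy i)
  choose x' hx' using fun i => hπ.exists_unit (hVy' i)
  have hw : ∀ i, Reduces π (w i) (π ⟨w i, (hVw i).le⟩) := fun i => ⟨(hVw i).le, rfl⟩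
  have hw' : ∀ i, Reduces π (w' i) (π ⟨w' i, hVw' i⟩) := fun i => ⟨hVw' i, rfl⟩
  have hmem : ∀ (u : kˣ) (hu : u ∈ O.unitGroup), (u : k) ∈ T →
      ∃ c, φ c = IsReduction.resUnit hu := by
    intro u hu huT
    obtain ⟨-, h, c, hc⟩ := hT u huT u.ne_zero
    exact ⟨c, hc⟩
  have hgen := S.mem_of_isGauss hY hG hVy
  have hyQ' : ∀ Q : Subring D, (∀ c ∈ O, algebraMap k D c ∈ Q) → (∀ i, (y' i : D) ∈ Q) →
      (∀ x ∈ Q, V x = 1 → x⁻¹ ∈ Q) → ∀ a, (Y' a : D) ∈ Q := by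
    intro Q hO hyQ hQ a
    exact (hY' a).mem_subring Q hO hyQ fun i => by simpa using hQ _ (hyQ i) (hVy' i)
  choose X hX hXm using fun a => hπ.isMonomial hx (hY a)
  refine ⟨κ, IsLocalRing.ResidueField O, E, inferInstance, inferInstance, inferInstance,
    inferInstance, inferInstance, φ, _, x, _, _, x', _,
    ⟨hπ.isQSystem S.toIsQSystem hlam hx hw, fun i j => hmem _ _ (hTl i j),
      hπ.isDivGenerated hx hw hgen⟩,
    ⟨hπ.isQSystem S'.toIsQSystem hlam' hx' hw', fun i j => hmem _ _ (hTl' i j),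
      hπ.isDivGenerated hx' hw' fun Q hO hyQ hwQ hQ =>
        hgen Q hO (fun i => ?_) (fun i => ?_) hQ⟩,
    X, hXm, hπ.linearIndependent S.toIsQSystem _ hw hX hG⟩
  · exact hT₂ _ O V Q hG (fun t ht => hTO t (hTy i ht)) hO (hyQ' Q hO hyQ hQ) hwQ hQ
  · exact hT₂ _ O V Q hG (fun t ht => hTO t (hTw i ht)) hO (hyQ' Q hO hyQ hQ) hwQ hQ

end Specialization

end SpecializationOfFrames

theorem MvPolynomial.range_fg_of_isIntegral {K B : Type*} [Field K] [Ring B] [Algebra K B] {r : ℕ}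
    (f : MvPolynomial (Fin r) K →ₐ[K] B) (h : ∀ i, IsIntegral K (f (X i))) :
    (LinearMap.range f.toLinearMap).FG := by
  let Q := MvPolynomial (Fin r) K ⧸ RingHom.ker f
  let g : Q →ₐ[K] B := Ideal.Quotient.liftₐ (RingHom.ker f) f fun a ha => ha
  have hg : Function.Injective g := by
    rw [injective_iff_map_eq_zero]
    intro a ha
    obtain ⟨a, rfl⟩ := Ideal.Quotient.mk_surjective a
    exact Ideal.Quotient.eq_zero_iff_mem.mpr ha
  let q : MvPolynomial (Fin r) K →ₐ[K] Q := Ideal.Quotient.mkₐ K (RingHom.ker f)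
  have hfin := Algebra.finite_adjoin_of_finite_of_isIntegral (R := K)
    (s := Set.range fun i => q (X i)) (Set.finite_range _) (by
      rintro _ ⟨i, rfl⟩
      exact (isIntegral_algHom_iff g hg).mp (h i))
  have htop : Algebra.adjoin K (Set.range fun i => q (X i)) = ⊤ := by
    have h1 : (Set.range fun i => q (X i)) = q '' Set.range (X : Fin r → _) := by
      rw [← Set.range_comp]; rfl
    rw [h1, ← AlgHom.map_adjoin, MvPolynomial.adjoin_range_X, Algebra.map_top,
      AlgHom.range_eq_top]
    exact Ideal.Quotient.mkₐ_surjective K _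
  rw [htop] at hfin
  have hQ : Module.Finite K Q := Module.Finite.equiv Subalgebra.topEquiv.toLinearEquiv
  have h2 : LinearMap.range f.toLinearMap = LinearMap.range g.toLinearMap := by
    ext b
    constructor
    · rintro ⟨a, rfl⟩
      exact ⟨q a, rfl⟩
    · rintro ⟨a, rfl⟩
      obtain ⟨a, rfl⟩ := Ideal.Quotient.mk_surjective a
      exact ⟨a, rfl⟩
  rw [h2]
  exact Module.Finite.iff_fg.mp (Module.Finite.range g.toLinearMap)

namespace IsQSystem

variable {K D : Type*} [Field K] [DivisionRing D] [Algebra K D] {n r : ℕ} {ι : Fin r → Fin n}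
  {lam : Fin n → Fin n → Kˣ} {y : Fin n → Dˣ} {w : Fin r → D}

/-- If powers of the generators are scalar, then the monomials span a finite-dimensional space. -/
theorem span_monomial_fg (S : IsQSystem ι lam y w) {M : ℕ} (hM : 0 < M)
    (hy : ∀ i, ∃ u : Kˣ, y i ^ M = scalarUnit D u) {Y : (Fin n → ℤ) → Dˣ}
    (hY : ∀ a, IsMonomial (⊤ : Subgroup Kˣ) y (Y a) a) :
    (Submodule.span K (Set.range fun a => (Y a : D))).FG := by
  classical
  have hscal : ∀ c : Fin n → ℤ, ∃ u : Kˣ,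
      IsMonomial (⊤ : Subgroup Kˣ) y (scalarUnit D u) ((M : ℤ) • c) := by
    intro c
    rw [← Finset.univ_sum_single c]
    refine Finset.sum_induction _
      (fun c => ∃ u : Kˣ, IsMonomial (⊤ : Subgroup Kˣ) y (scalarUnit D u) ((M : ℤ) • c)) ?_ ?_ ?_
    · rintro a b ⟨u, hu⟩ ⟨v, hv⟩
      exact ⟨u * v, by rw [smul_add, map_mul]; exact hu.mul hv⟩
    · exact ⟨1, by rw [smul_zero, map_one]; exact .one⟩
    · intro i _
      obtain ⟨u, hu⟩ := hy i
      refine ⟨u ^ c i, ?_⟩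
      rw [map_zpow, ← hu]
      refine (((IsMonomial.gen i).pow M).zpow (c i)).congr_exp ?_
      rw [← natCast_zsmul, smul_smul, mul_comm, ← smul_smul, ← Pi.single_smul]
      simp
  let s : Set D := Set.range fun b : Fin n → Fin M => (Y fun i => ((b i : ℕ) : ℤ) : D)
  refine ⟨(Set.finite_range fun b : Fin n → Fin M =>
    (Y fun i => ((b i : ℕ) : ℤ) : D)).toFinset, ?_⟩
  rw [Set.Finite.coe_toFinset]
  refine le_antisymm (Submodule.span_mono ?_) (Submodule.span_le.mpr ?_)
  · rintro _ ⟨b, rfl⟩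
    exact ⟨_, rfl⟩
  rintro _ ⟨a, rfl⟩
  let b : Fin n → Fin M := fun i => ⟨(a i % M).toNat, by
    have := Int.emod_lt_of_pos (a i) (by exact_mod_cast hM : (0 : ℤ) < M)
    have := Int.emod_nonneg (a i) (by exact_mod_cast hM.ne' : (M : ℤ) ≠ 0)
    omega⟩
  obtain ⟨u, hu⟩ := hscal fun i => a i / M
  have ha : (fun i => ((b i : ℕ) : ℤ)) + (M : ℤ) • (fun i => a i / M) = a := by
    funext i
    have := Int.emod_nonneg (a i) (by exact_mod_cast hM.ne' : (M : ℤ) ≠ 0)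
    simp only [b, Pi.add_apply, Pi.smul_apply, smul_eq_mul, Int.toNat_of_nonneg this]
    exact Int.emod_add_mul_ediv _ _
  obtain ⟨v, -, hv⟩ := (hY a).unique S.yy (fun _ _ => Subgroup.mem_top _)
    (((hY fun i => ((b i : ℕ) : ℤ)).mul hu).congr_exp ha)
  have h2 : (Y a : D) = ((v : K) * u) • (Y fun i => ((b i : ℕ) : ℤ) : D) := by
    rw [hv, ← IsMonomial.scalarUnit_mul_comm u, ← mul_assoc, ← map_mul, Algebra.smul_def]
    simp
  change (Y a : D) ∈ _
  rw [h2]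
  exact Submodule.smul_mem _ _ (Submodule.subset_span ⟨b, rfl⟩)

theorem finiteDimensional (S : IsQSystem ι lam y w) {M : ℕ} (hM : 0 < M)
    (hy : ∀ i, ∃ u : Kˣ, y i ^ M = scalarUnit D u) (hw : ∀ i, IsIntegral K (w i))
    (hgen : IsDivGenerated K (qGenerators y w)) : FiniteDimensional K D := by
  choose Y hY using IsMonomial.exists_of_exp (⊤ : Subgroup Kˣ) y
  obtain ⟨A, hA, hspan⟩ := S.exists_subalgebra hY
  have h2 := MvPolynomial.range_fg_of_isIntegral S.poly fun i => by rw [S.poly_X]; exact hw i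
  have h3 := (S.span_monomial_fg hM hy hY).mul h2
  have hle : Subalgebra.toSubmodule A ≤
      Submodule.span K (Set.range fun a => (Y a : D)) * LinearMap.range S.poly.toLinearMap := by
    intro a ha
    obtain ⟨f, rfl⟩ := (hspan a).mp ha
    rw [Finsupp.linearCombination_apply]
    exact Submodule.sum_mem _ fun p _ => Submodule.smul_mem _ _
      (Submodule.mul_mem_mul (Submodule.subset_span ⟨_, rfl⟩) ⟨_, rfl⟩)
  have hfin : Module.Finite K A := by
    have := Module.Finite.iff_fg.mpr h3
    exact Submodule.finiteDimensional_of_le hle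
  have htop : A = ⊤ := by
    refine hgen A hA fun x hx => ?_
    by_cases h0 : x = 0
    · rw [h0, inv_zero]; exact A.zero_mem
    · obtain ⟨u, hu⟩ := FiniteDimensional.isUnit K (x := (⟨x, hx⟩ : A))
        (fun h => h0 (congrArg Subtype.val h))
      have h1 : x * ((u⁻¹ : Aˣ) : A) = 1 := by
        have := congrArg (Subtype.val : A → D) u.mul_inv
        rw [hu] at this
        exact this
      rw [inv_eq_of_mul_eq_one_right h1]
      exact ((u⁻¹ : Aˣ) : A).2
  rw [htop] at hfin
  exact Module.Finite.equiv (Subalgebra.topEquiv (R := K) (A := D)).toLinearEquiv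

end IsQSystem

theorem bichar.nsmul_left {G : Type*} [CommGroup G] {n : ℕ} {lam : Fin n → Fin n → G} {N : ℕ}
    (h : ∀ i j, lam i j ^ N = 1) (a b : Fin n → ℤ) : bichar lam (N • a) b = 1 := by
  refine Finset.prod_eq_one fun i _ => Finset.prod_eq_one fun j _ => ?_
  rw [Pi.smul_apply, nsmul_eq_mul, mul_assoc, zpow_mul, zpow_natCast, h, one_zpow]

theorem IsDivGenerated.commutes {K D : Type*} [Field K] [DivisionRing D] [Algebra K D] {s : Set D}
    (hs : IsDivGenerated K s) {d : D} (h : ∀ x ∈ s, d * x = x * d) (x : D) : d * x = x * d := by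
  have h1 : Subalgebra.centralizer K {d} = ⊤ := by
    refine hs _ (fun x hx => ?_) fun x hx => ?_
    · rw [SetLike.mem_coe, Subalgebra.mem_centralizer_iff]
      rintro _ rfl
      exact h x hx
    · rw [Subalgebra.mem_centralizer_iff] at hx ⊢
      rintro _ rfl
      exact (Commute.inv_right₀ (hx _ rfl) : _)
  have h2 : x ∈ Subalgebra.centralizer K {d} := h1 ▸ Algebra.mem_top
  exact Subalgebra.mem_centralizer_iff K |>.mp h2 d rfl

theorem IsDivGenerated.commutes_qGenerators {K D : Type*} [Field K] [DivisionRing D] [Algebra K D]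
    {n r : ℕ} {y : Fin n → Dˣ} {w : Fin r → D} (hs : IsDivGenerated K (qGenerators y w)) {d : D}
    (hy : ∀ i, d * y i = y i * d) (hw : ∀ i, d * w i = w i * d) (x : D) : d * x = x * d := by
  refine hs.commutes ?_ x
  rintro _ ((⟨i, rfl⟩ | ⟨i, rfl⟩) | ⟨i, rfl⟩)
  · exact hy i
  · exact (show Commute d (y i) from hy i).units_inv_right
  · exact hw i

namespace IsFiniteSystem

variable {κ K D : Type*} [Field κ] [Field K] [DivisionRing D] [Algebra K D]
  {n r : ℕ} {φ : κ →+* K} {ι : Fin r → Fin n} {lam : Fin n → Fin n → Kˣ} {y : Fin n → Dˣ}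
  {w : Fin r → D}

theorem w_mul_pow (R : IsFiniteSystem φ ι lam y w) (i : Fin r) (j : Fin n) (m : ℕ) :
    w i * (y j : D) ^ m = (y j : D) ^ m * (w i + if ι i = j then (m : D) else 0) := by
  have := R.w_mul ((IsMonomial.gen (U := (⊤ : Subgroup Kˣ)) (y := y) j).pow m) i
  rw [Units.val_pow_eq_pow_val] at this
  rw [this, Pi.smul_apply, Pi.single_apply]
  split_ifs <;> simp

variable {p : ℕ} [CharP D p]

theorem central_sub [Fact p.Prime] (R : IsFiniteSystem φ ι lam y w) (i : Fin r) (x : D) :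
    (w i ^ p - w i) * x = x * (w i ^ p - w i) := by
  refine R.gen.commutes_qGenerators (fun j => ?_) (fun j => ?_) x
  · have h1 : ∀ m : ℕ, w i ^ m * y j = y j * (w i + if ι i = j then 1 else 0) ^ m := by
      intro m
      induction m with
      | zero => simp
      | succ m ih => rw [pow_succ', mul_assoc, ih, ← mul_assoc, R.wy, mul_assoc, ← pow_succ']
    rw [sub_mul, h1, R.wy, ← mul_sub]
    congr 1
    split_ifs
    · rw [add_pow_char_of_commute p (Commute.one_right _), one_pow]
      abel
    · simp
  · have : Commute (w i) (w j) := R.ww i j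
    exact ((this.pow_left p).sub_left this).eq

variable [Finite κ]

theorem lam_pow (R : IsFiniteSystem φ ι lam y w) (i j : Fin n) :
    lam i j ^ (Nat.card κ - 1) = 1 := by
  have := Fintype.ofFinite κ
  obtain ⟨c, hc⟩ := R.lam_mem i j
  have h0 : c ≠ 0 := by
    rintro rfl
    rw [map_zero] at hc
    exact (lam i j).ne_zero hc.symm
  ext
  rw [Units.val_pow_eq_pow_val, ← hc, ← map_pow, Nat.card_eq_fintype_card,
    FiniteField.pow_card_sub_one_eq_one c h0, map_one, Units.val_one]

/-- The `(q - 1)`-st powers of the `y i` commute with all monomials. -/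
theorem pow_mul_comm (R : IsFiniteSystem φ ι lam y w) (i : Fin n) (m : ℕ) {g : Dˣ}
    {a : Fin n → ℤ} (hg : IsMonomial (⊤ : Subgroup Kˣ) y g a) :
    y i ^ ((Nat.card κ - 1) * m) * g = g * y i ^ ((Nat.card κ - 1) * m) := by
  have h1 := IsMonomial.mul_comm' R.yy ((IsMonomial.gen (U := ⊤) (y := y) i).pow
    ((Nat.card κ - 1) * m)) hg
  rwa [mul_smul, bichar.nsmul_left R.lam_pow, map_one, one_mul] at h1

theorem central_pow (R : IsFiniteSystem φ ι lam y w) (i : Fin n) (x : D) :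
    (y i : D) ^ ((Nat.card κ - 1) * p) * x = x * (y i : D) ^ ((Nat.card κ - 1) * p) := by
  refine R.gen.commutes_qGenerators (fun j => ?_) (fun j => ?_) x
  · exact_mod_cast R.pow_mul_comm i p (IsMonomial.gen j)
  · rw [R.w_mul_pow]
    simp

theorem central_pow_of_notMem (R : IsFiniteSystem φ ι lam y w) {i : Fin n} (hi : i ∉ Set.range ι)
    (x : D) : (y i : D) ^ (Nat.card κ - 1) * x = x * (y i : D) ^ (Nat.card κ - 1) := by
  refine R.gen.commutes_qGenerators (fun j => ?_) (fun j => ?_) x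
  · have := R.pow_mul_comm i 1 (IsMonomial.gen j)
    rw [mul_one] at this
    exact_mod_cast this
  · rw [R.w_mul_pow, if_neg fun h => hi ⟨j, h⟩, add_zero]

end IsFiniteSystem

section Transcendence

variable {κ K D : Type*} [Field κ] [Finite κ] [Field K] [DivisionRing D] [Algebra K D]
  {n r : ℕ} {φ : κ →+* K} {ι : Fin r → Fin n} {lam : Fin n → Fin n → Kˣ} {y : Fin n → Dˣ}
  {w : Fin r → D} {p : ℕ} [Fact p.Prime] {Z : Type*} [Field Z] [Algebra Z D]

/-- Central elements attached to a system in characteristic `p`. -/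
theorem IsFiniteSystem.exists_central [CharP D p] (R : IsFiniteSystem φ ι lam y w)
    (hZ : ∀ d : D, (∀ x, d * x = x * d) → ∃ z : Z, algebraMap Z D z = d) :
    ∃ z : Fin n ⊕ Fin r → Z,
      (∀ i, algebraMap Z D (z (.inl i)) = (y i : D) ^ ((Nat.card κ - 1) * p)) ∧
      ∀ i, algebraMap Z D (z (.inr i)) = w i ^ p - w i := by
  choose a ha using fun i => hZ _ (R.central_pow (p := p) i)
  choose b hb using fun i => hZ _ (R.central_sub (p := p) i)
  exact ⟨Sum.elim a b, ha, hb⟩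

variable [Algebra K Z] [IsScalarTower K Z D]

theorem IsQSystem.extendScalars {K L B : Type*} [Field K] [Field L] [Ring B] [Algebra K B]
    [Algebra K L] [Algebra L B] [IsScalarTower K L B] {ι : Fin r → Fin n}
    {lam : Fin n → Fin n → Kˣ} {y : Fin n → Bˣ} {w : Fin r → B} (S : IsQSystem ι lam y w) :
    IsQSystem ι (fun i j => Units.map (algebraMap K L : K →* L) (lam i j)) y w where
  yy i j := by
    rw [S.yy]
    exact (algebraMap_smul L (lam i j : K) _).symm
  wy := S.wy
  ww := S.ww

theorem IsDivGenerated.extendScalars {K D : Type*} (L : Type*) [Field K] [Field L]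
    [DivisionRing D] [Algebra K D] [Algebra K L] [Algebra L D] [IsScalarTower K L D] {s : Set D}
    (h : IsDivGenerated K s) : IsDivGenerated L s := fun B hs hinv => by
  have h1 := h (B.restrictScalars K) hs hinv
  rw [eq_top_iff]
  intro x _
  have : x ∈ B.restrictScalars K := h1 ▸ Algebra.mem_top
  exact this

theorem IsFiniteSystem.card_pos (_ : IsFiniteSystem φ ι lam y w) : 0 < Nat.card κ - 1 := by
  have := Finite.one_lt_card (α := κ)
  omega

/-- The division ring is finite over any central subfield containing the standard central
elements. -/
theorem IsFiniteSystem.finiteDimensional (R : IsFiniteSystem φ ι lam y w)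
    (hy : ∀ i, ∃ z : Z, algebraMap Z D z = (y i : D) ^ ((Nat.card κ - 1) * p))
    (hw : ∀ i, ∃ z : Z, algebraMap Z D z = w i ^ p - w i) :
    FiniteDimensional Z D := by
  have hp := (Fact.out : p.Prime)
  refine (R.toIsQSystem.extendScalars (L := Z)).finiteDimensional
    (Nat.mul_pos R.card_pos hp.pos) (fun i => ?_) (fun i => ?_)
    (R.gen.extendScalars Z)
  · obtain ⟨z, hz⟩ := hy i
    have h0 : z ≠ 0 := by
      rintro rfl
      rw [map_zero] at hz
      exact (pow_ne_zero _ (y i).ne_zero) hz.symm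
    refine ⟨Units.mk0 z h0, ?_⟩
    ext
    rw [Units.val_pow_eq_pow_val, ← hz]
    rfl
  · obtain ⟨z, hz⟩ := hw i
    have hdeg : (Polynomial.X + Polynomial.C z : Polynomial Z).degree < p := by
      rw [Polynomial.degree_X_add_C]
      exact_mod_cast hp.one_lt
    refine ⟨Polynomial.X ^ p - (Polynomial.X + Polynomial.C z),
      Polynomial.monic_X_pow_sub hdeg, ?_⟩
    rw [← Polynomial.aeval_def]
    simp [hz]

variable [CharP D p]

theorem IsFiniteSystem.trdeg_le (R : IsFiniteSystem φ ι lam y w) (p : ℕ) [CharP D p]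
    [Fact p.Prime]
    (hZ : ∀ d : D, (∀ x, d * x = x * d) → ∃ z : Z, algebraMap Z D z = d) :
    Algebra.trdeg K Z ≤ (n + r : ℕ) := by
  obtain ⟨z, hzy, hzw⟩ := R.exists_central (p := p) hZ
  let L := IntermediateField.adjoin K (Set.range z)
  have hmem : ∀ i, z i ∈ L := fun i => IntermediateField.subset_adjoin _ _ ⟨i, rfl⟩
  have hfin : FiniteDimensional L D := R.finiteDimensional (p := p)
    (fun i => ⟨⟨z (.inl i), hmem _⟩, hzy i⟩) (fun i => ⟨⟨z (.inr i), hmem _⟩, hzw i⟩)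
  have hinj : Function.Injective ((Algebra.linearMap Z D).restrictScalars L) :=
    (algebraMap Z D).injective
  have hfin' : FiniteDimensional L Z := FiniteDimensional.of_injective _ hinj
  have halg : Algebra.IsAlgebraic L Z := inferInstance
  have h1 : Algebra.IsAlgebraic (Algebra.adjoin K (Set.range z)) Z := by
    let _ : Algebra (Algebra.adjoin K (Set.range z)) L :=
      (Subalgebra.inclusion (IntermediateField.algebra_adjoin_le_adjoin K _)).toAlgebra
    have : IsFractionRing (Algebra.adjoin K (Set.range z)) L := by
      open IntermediateField.algebraAdjoinAdjoin in infer_instance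
    have : IsScalarTower (Algebra.adjoin K (Set.range z)) L Z := .of_algebraMap_eq' rfl
    exact (IsFractionRing.comap_isAlgebraic_iff (K := L)).mpr halg
  refine (Algebra.IsAlgebraic.trdeg_le_cardinalMk K (Set.range z)).trans ?_
  have h2 := Cardinal.mk_range_le_lift (f := z)
  simpa using h2

variable {X : (Fin n → ℤ) → Dˣ}

theorem IsQSystem.eq_zero_of_sum_mul_poly {R : IsQSystem ι lam y w}
    (hli : LinearIndependent K (R.basisFun X)) (s : Finset (Fin n → ℤ))
    (f : (Fin n → ℤ) → MvPolynomial (Fin r) K) (h : ∑ a ∈ s, (X a : D) * R.poly (f a) = 0)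
    {a : Fin n → ℤ} (ha : a ∈ s) : f a = 0 := by
  classical
  let t := s.biUnion fun a => (f a).support
  have hf : ∀ a ∈ s, R.poly (f a) =
      ∑ m ∈ t, (f a).coeff m • R.poly (MvPolynomial.monomial m 1) := by
    intro a ha
    conv_lhs => rw [(f a).as_sum, map_sum]
    rw [Finset.sum_subset (Finset.subset_biUnion_of_mem (fun a => (f a).support) ha)]
    · refine Finset.sum_congr rfl fun m _ => ?_
      rw [← map_smul, MvPolynomial.smul_monomial, smul_eq_mul, mul_one]
    · intro m _ hm
      rw [MvPolynomial.notMem_support_iff.mp hm, MvPolynomial.monomial_zero, map_zero]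
  have h1 : ∑ q ∈ s ×ˢ t, (f q.1).coeff q.2 • R.basisFun X q = 0 := by
    rw [Finset.sum_product, ← h]
    refine Finset.sum_congr rfl fun a ha => ?_
    rw [hf a ha, Finset.mul_sum]
    exact Finset.sum_congr rfl fun m _ => (mul_smul_comm _ _ _).symm
  have h2 := linearIndependent_iff'.mp hli _ _ h1
  ext m
  rw [MvPolynomial.coeff_zero]
  by_cases hm : m ∈ t
  · exact h2 (a, m) (Finset.mk_mem_product ha hm)
  · by_contra hne
    exact hm (Finset.mem_biUnion.mpr ⟨a, ha, MvPolynomial.mem_support_iff.mpr hne⟩)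

theorem IsQSystem.linearIndependent_mul_poly {R : IsQSystem ι lam y w}
    (hli : LinearIndependent K (R.basisFun X)) {β : Type*} {g : β → MvPolynomial (Fin r) K}
    (hg : LinearIndependent K g) :
    LinearIndependent K fun q : (Fin n → ℤ) × β => (X q.1 : D) * R.poly (g q.2) := by
  classical
  rw [linearIndependent_iff']
  intro s c hc
  let f : (Fin n → ℤ) → MvPolynomial (Fin r) K := fun a =>
    ∑ b ∈ s.image Prod.snd, (if (a, b) ∈ s then c (a, b) else 0) • g b
  have h1 : ∑ a ∈ s.image Prod.fst, (X a : D) * R.poly (f a) = 0 := by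
    have h2 : ∑ q ∈ s.image Prod.fst ×ˢ s.image Prod.snd, (if q ∈ s then c q else 0) •
        ((X q.1 : D) * R.poly (g q.2)) = 0 := by
      rw [← hc, ← Finset.sum_subset Finset.subset_product
        fun q _ hq => by rw [if_neg hq, zero_smul]]
      exact Finset.sum_congr rfl fun q hq => by rw [if_pos hq]
    rw [← h2, Finset.sum_product]
    refine Finset.sum_congr rfl fun a _ => ?_
    rw [map_sum, Finset.mul_sum]
    exact Finset.sum_congr rfl fun b _ => by rw [map_smul, mul_smul_comm]
  rintro ⟨a, b⟩ hab
  have h2 := R.eq_zero_of_sum_mul_poly hli _ f h1 (Finset.mem_image_of_mem _ hab)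
  have h3 := linearIndependent_iff'.mp hg _ _ h2 b (Finset.mem_image_of_mem _ hab)
  simpa [hab] using h3

theorem IsFiniteSystem.le_trdeg (R : IsFiniteSystem φ ι lam y w) (p : ℕ) [CharP D p]
    [Fact p.Prime]
    (hX : ∀ a, IsMonomial (⊤ : Subgroup Kˣ) y (X a) a) (hli : LinearIndependent K (R.basisFun X))
    (hZ : ∀ d : D, (∀ x, d * x = x * d) → ∃ z : Z, algebraMap Z D z = d) :
    ((n + r : ℕ) : Cardinal) ≤ Algebra.trdeg K Z := by
  have hp := (Fact.out : p.Prime)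
  obtain ⟨z, hzy, hzw⟩ := R.exists_central (p := p) hZ
  have hM : 0 < (Nat.card κ - 1) * p := Nat.mul_pos R.card_pos hp.pos
  set M := (Nat.card κ - 1) * p
  have hmon : ∀ m : Fin n → ℕ, ∃ g : Dˣ, IsMonomial (⊤ : Subgroup Kˣ) y g (fun i => M * m i) ∧
      (g : D) = algebraMap Z D (∏ i, z (.inl i) ^ m i) := by
    intro m
    suffices h : ∀ s : Finset (Fin n), ∃ g : Dˣ, IsMonomial (⊤ : Subgroup Kˣ) y g
        (∑ i ∈ s, Pi.single i (M * m i : ℤ)) ∧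
        (g : D) = algebraMap Z D (∏ i ∈ s, z (.inl i) ^ m i) by
      have := h Finset.univ
      rwa [Finset.univ_sum_single fun i => (M * m i : ℤ)] at this
    intro s
    induction s using Finset.cons_induction with
    | empty => exact ⟨1, .one, by simp⟩
    | cons i s hi ih =>
      obtain ⟨g, hg, hgz⟩ := ih
      refine ⟨y i ^ (M * m i) * g, ?_, ?_⟩
      · rw [Finset.sum_cons]
        refine IsMonomial.mul (((IsMonomial.gen i).pow _).congr_exp ?_) hg
        rw [← Pi.single_smul]
        simp
      · rw [Finset.prod_cons, map_mul, map_pow, hzy, ← hgz, pow_mul]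
        simp
  let x : Fin r → MvPolynomial (Fin r) K := fun i =>
    Polynomial.aeval (MvPolynomial.X i) (Polynomial.X ^ p - Polynomial.X : Polynomial K)
  have hx : AlgebraicIndependent K x := by
    refine MvPolynomial.algebraicIndependent_polynomial_aeval_X _ fun i => ?_
    refine Polynomial.transcendental (R := K) _ ?_ ?_
    · rw [FiniteField.X_pow_card_sub_X_natDegree_eq K hp.one_lt]
      exact hp.ne_zero
    · rw [mem_nonZeroDivisors_iff_ne_zero, Polynomial.leadingCoeff_ne_zero]
      exact FiniteField.X_pow_card_sub_X_ne_zero K hp.one_lt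
  have hpoly : R.poly.comp (MvPolynomial.aeval x) =
      (IsScalarTower.toAlgHom K Z D).comp (MvPolynomial.aeval fun i => z (.inr i)) := by
    refine MvPolynomial.algHom_ext fun i => ?_
    simp [x, hzw]
  have hind : LinearIndependent K fun m : Fin r →₀ ℕ =>
      MvPolynomial.aeval x (MvPolynomial.monomial m (1 : K)) := by
    have := (MvPolynomial.basisMonomials (Fin r) K).linearIndependent.map'
      (MvPolynomial.aeval x).toLinearMap
      (LinearMap.ker_eq_bot.mpr (algebraicIndependent_iff_injective_aeval.mp hx))
    simpa [Function.comp_def] using this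
  have hind' := (R.linearIndependent_mul_poly hli hind).comp
    (fun m : Fin n ⊕ Fin r →₀ ℕ => ((fun i => (M * m (.inl i) : ℤ)),
      m.comapDomain Sum.inr Sum.inr_injective.injOn)) (by
      intro m m' h
      rw [Prod.mk.injEq] at h
      ext (i | i)
      · have := congrFun h.1 i
        simpa [hM.ne'] using this
      · exact DFunLike.congr_fun h.2 i)
  choose g hg hgz using hmon
  choose u _ hu using fun m : Fin n → ℕ => (hg m).unique R.yy (fun _ _ => Subgroup.mem_top _)
    (hX fun i => M * m i)
  have hind2 := hind'.units_smul fun m : Fin n ⊕ Fin r →₀ ℕ => u fun i => m (.inl i)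
  have hz : AlgebraicIndependent K z := by
    rw [algebraicIndependent_iff]
    intro P hP
    have h1 := congrArg (algebraMap Z D) hP
    rw [MvPolynomial.aeval_def, MvPolynomial.eval₂_eq', map_zero, map_sum] at h1
    ext m
    rw [MvPolynomial.coeff_zero]
    by_cases hm : m ∈ P.support
    · refine linearIndependent_iff'.mp hind2 P.support (fun m => P.coeff m) ?_ m hm
      rw [← h1]
      refine Finset.sum_congr rfl fun m _ => ?_
      rw [Fintype.prod_sum_type, map_mul, map_mul, ← hgz fun i => m (.inl i), hu]
      have h3 := DFunLike.congr_fun hpoly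
        (MvPolynomial.monomial (m.comapDomain Sum.inr Sum.inr_injective.injOn) (1 : K))
      simp only [AlgHom.comp_apply] at h3
      have h4 : algebraMap Z D (∏ i, z (.inr i) ^ m (.inr i)) = R.poly (MvPolynomial.aeval x
          (MvPolynomial.monomial (m.comapDomain Sum.inr Sum.inr_injective.injOn) (1 : K))) := by
        refine Eq.trans ?_ h3.symm
        rw [MvPolynomial.aeval_monomial, map_one, one_mul,
          Finsupp.prod_fintype _ _ fun i => pow_zero _]
        rfl
      rw [h4, ← IsScalarTower.algebraMap_apply K Z D, ← Algebra.smul_def]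
      simp only [Function.comp_apply, Pi.smul_apply', Units.val_mul]
      congr 1
      change _ = (algebraMap K D _ * _) * _
      rw [mul_assoc, ← Algebra.smul_def, Units.smul_def]
    · exact MvPolynomial.notMem_support_iff.mp hm
  have h2 := hz.lift_cardinalMk_le_trdeg
  simpa using h2

end Transcendence

open Polynomial in
theorem Module.End.finrank_eq_sum_eigenspace {Z V α : Type*} [Field Z] [AddCommGroup V] [Module Z V]
    [FiniteDimensional Z V] [Fintype α] [Nonempty α] {v : α → Z} (hv : Function.Injective v)
    (T : Module.End Z V) (hT : aeval T (∏ c, (X - C (v c))) = 0) :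
    Module.finrank Z V = ∑ c, Module.finrank Z (T.eigenspace (v c)) := by
  classical
  have hind : iSupIndep fun c => T.eigenspace (v c) := T.eigenspaces_iSupIndep.comp hv
  have hsup : ⨆ c, T.eigenspace (v c) = ⊤ := by
    rw [eq_top_iff]
    intro x _
    have h1 := congrArg (fun f => aeval T f x)
      (Lagrange.sum_basis (s := Finset.univ) hv.injOn Finset.univ_nonempty)
    simp only [map_sum, map_one, LinearMap.sum_apply, Module.End.one_apply] at h1
    rw [← h1]
    refine Submodule.sum_mem _ fun c _ => Submodule.mem_iSup_of_mem c ?_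
    rw [Module.End.mem_eigenspace_iff, ← sub_eq_zero]
    have h2 : (X - C (v c)) * Lagrange.basis Finset.univ v c =
        C (∏ j ∈ Finset.univ.erase c, (v c - v j)⁻¹) * ∏ c, (X - C (v c)) := by
      rw [← Finset.mul_prod_erase Finset.univ _ (Finset.mem_univ c), Lagrange.basis]
      simp only [Lagrange.basisDivisor, Finset.prod_mul_distrib, map_prod]
      ring
    have h3 := congrArg (fun f => aeval T f x) h2
    simp only [map_mul, hT, mul_zero] at h3
    simpa using h3
  have hint := DirectSum.isInternal_submodule_of_iSupIndep_of_iSup_eq_top hind hsup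
  rw [← (LinearEquiv.ofBijective (DirectSum.coeLinearMap _) hint).finrank_eq,
    Module.finrank_directSum]

theorem FiniteField.map_X_pow_card_sub_X {κ Z : Type*} [Field κ] [Fintype κ] [Field Z]
    (ψ : κ →+* Z) : (Polynomial.X ^ Fintype.card κ - Polynomial.X : Polynomial Z) =
      ∏ c, (Polynomial.X - Polynomial.C (ψ c)) := by
  have h1 : (Polynomial.X ^ Fintype.card κ - Polynomial.X : Polynomial κ) =
      ∏ c, (Polynomial.X - Polynomial.C c) := by
    have h := FiniteField.roots_X_pow_card_sub_X κ
    have hm : (Polynomial.X ^ Fintype.card κ - Polynomial.X : Polynomial κ).Monic := by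
      apply Polynomial.monic_X_pow_sub
      rw [Polynomial.degree_X]
      exact_mod_cast Fintype.one_lt_card
    have := Polynomial.prod_multiset_X_sub_C_of_monic_of_roots_card_eq hm (by
      rw [h, FiniteField.X_pow_card_sub_X_natDegree_eq κ Fintype.one_lt_card]
      rfl)
    rw [← this, h]
    rfl
  have h2 := congrArg (Polynomial.map ψ) h1
  simpa [Polynomial.map_prod] using h2

open Polynomial in
/-- The dimension of a centralizer, computed from an operator whose eigenspaces are translates
of a smaller centralizer. -/
theorem Subalgebra.finrank_centralizer_eq {κ Z D : Type*} [Field κ] [Fintype κ] [Field Z]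
    [DivisionRing D] [Algebra Z D] [FiniteDimensional Z D] (ψ : κ →+* Z) (X : Set D) (b : D)
    (T : D →ₗ[Z] D) (hE : ∀ x ∈ Subalgebra.centralizer Z X, T x ∈ Subalgebra.centralizer Z X)
    (hT : ∀ x ∈ Subalgebra.centralizer Z X,
      aeval (T : Module.End Z D) (∏ c, (Polynomial.X - C (ψ c))) x = 0)
    (S : Finset κ)
    (hS : ∀ c, c ∉ S → ∀ x ∈ Subalgebra.centralizer Z X, T x = ψ c • x → x = 0) (t : κ → D)
    (ht : ∀ c ∈ S, t c ∈ Subalgebra.centralizer Z X ∧ t c ≠ 0 ∧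
      ∀ u ∈ Subalgebra.centralizer Z X, T (u * t c) = ψ c • (u * t c) ↔ b * u = u * b) :
    Module.finrank Z (Subalgebra.centralizer Z X) =
      S.card * Module.finrank Z (Subalgebra.centralizer Z (insert b X)) := by
  classical
  set E := Subalgebra.toSubmodule (Subalgebra.centralizer Z X) with hEdef
  let T' : Module.End Z E := T.restrict (p := E) (q := E) hE
  have hpow : ∀ (f : Z[X]) (x : E), ((aeval T' f x : E) : D) = aeval (T : Module.End Z D) f x := by
    intro f x
    induction f using Polynomial.induction_on' with
    | add f g hf hg => simp [hf, hg]
    | monomial m c =>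
      simp only [aeval_monomial, Module.End.mul_apply, Module.algebraMap_end_apply,
        Submodule.coe_smul]
      congr 1
      induction m generalizing x with
      | zero => rfl
      | succ m ih => rw [pow_succ, pow_succ, Module.End.mul_apply, Module.End.mul_apply, ih]; rfl
  have h1 := Module.End.finrank_eq_sum_eigenspace ψ.injective T' (by
    ext x
    rw [hpow, hT x x.2]
    rfl)
  change Module.finrank Z E = _
  rw [h1, ← Finset.sum_subset (Finset.subset_univ S), Finset.card_eq_sum_ones, Finset.sum_mul]
  · refine Finset.sum_congr rfl fun c hc => ?_
    obtain ⟨hmem, h0, hiff⟩ := ht c hc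
    have hinv : (t c)⁻¹ ∈ Subalgebra.centralizer Z X := by
      rw [Subalgebra.mem_centralizer_iff] at hmem ⊢
      exact fun g hg => (show Commute g (t c) from hmem g hg).inv_right₀
    rw [one_mul]
    have hmap : (T'.eigenspace (ψ c)).map E.subtype =
        (Subalgebra.toSubmodule (Subalgebra.centralizer Z (insert b X))).map
          (LinearMap.mulRight Z (t c)) := by
      ext x
      constructor
      · rintro ⟨x, hx, rfl⟩
        rw [SetLike.mem_coe, Module.End.mem_eigenspace_iff, Subtype.ext_iff] at hx
        have hu : (x : D) * (t c)⁻¹ ∈ Subalgebra.centralizer Z X := Subalgebra.mul_mem _ x.2 hinv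
        refine ⟨x * (t c)⁻¹, ?_, by simp [h0]⟩
        rw [SetLike.mem_coe, Subalgebra.mem_toSubmodule, Subalgebra.mem_centralizer_iff,
          Set.forall_mem_insert]
        refine ⟨(hiff _ hu).mp ?_, (Subalgebra.mem_centralizer_iff Z).mp hu⟩
        rw [inv_mul_cancel_right₀ h0]
        exact hx
      · rintro ⟨u, hu, rfl⟩
        rw [SetLike.mem_coe, Subalgebra.mem_toSubmodule, Subalgebra.mem_centralizer_iff,
          Set.forall_mem_insert, ← Subalgebra.mem_centralizer_iff Z] at hu
        refine ⟨⟨u * t c, Subalgebra.mul_mem _ hu.2 hmem⟩, ?_, rfl⟩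
        rw [SetLike.mem_coe, Module.End.mem_eigenspace_iff, Subtype.ext_iff]
        exact (hiff u hu.2).mpr hu.1
    rw [← LinearMap.finrank_range_of_inj (f := E.subtype.comp (T'.eigenspace (ψ c)).subtype),
      LinearMap.range_comp, Submodule.range_subtype, hmap,
      ← Submodule.range_subtype (Subalgebra.toSubmodule (Subalgebra.centralizer Z (insert b X))),
      ← LinearMap.range_comp, LinearMap.finrank_range_of_inj]
    · rfl
    · exact (mul_left_injective₀ h0).comp Subtype.val_injective
    · exact Subtype.val_injective.comp Subtype.val_injective
  · intro c _ hc
    rw [Submodule.finrank_eq_zero, Submodule.eq_bot_iff]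
    intro x hx
    rw [Module.End.mem_eigenspace_iff, Subtype.ext_iff] at hx
    exact Subtype.ext (hS c hc x x.2 hx)

section CentralizerDimension

variable {Z D : Type*} [Field Z] [DivisionRing D] [Algebra Z D]

theorem Module.End.charP (Z V : Type*) [Field Z] [AddCommGroup V] [Module Z V] [Nontrivial V]
    (p : ℕ) [CharP Z p] : CharP (Module.End Z V) p :=
  charP_of_injective_algebraMap (FaithfulSMul.algebraMap_injective Z (Module.End Z V)) p

/-- Conjugation by a unit. -/
noncomputable def conjLinear (Z : Type*) {D : Type*} [Field Z] [DivisionRing D] [Algebra Z D]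
    (u : Dˣ) : Module.End Z D :=
  LinearMap.mulLeft Z (u : D) * LinearMap.mulRight Z ((u⁻¹ : Dˣ) : D)

theorem conjLinear_apply (u : Dˣ) (x : D) :
    conjLinear Z u x = u * x * ((u⁻¹ : Dˣ) : D) := by
  simp [conjLinear, mul_assoc]

theorem conjLinear_pow_apply (u : Dˣ) (m : ℕ) (x : D) :
    (conjLinear Z u ^ m) x = u ^ m * x * (((u ^ m)⁻¹ : Dˣ) : D) := by
  induction m generalizing x with
  | zero => simp
  | succ m ih =>
    rw [pow_succ, Module.End.mul_apply, ih, conjLinear_apply, pow_succ u, mul_inv_rev,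
      Units.val_mul,
      pow_succ]
    simp only [mul_assoc]

theorem conjLinear_mul (u : Dˣ) (x y : D) :
    conjLinear Z u (x * y) = conjLinear Z u x * conjLinear Z u y := by
  simp [conjLinear_apply, mul_assoc]

theorem conjLinear_eq_iff (u : Dˣ) (x : D) : conjLinear Z u x = x ↔ (u : D) * x = x * u := by
  rw [conjLinear_apply, Units.mul_inv_eq_iff_eq_mul]

theorem conjLinear_pow_eq_self {u : Dˣ} {m : ℕ} {x : D} (h : (u : D) ^ m * x = x * (u : D) ^ m) :
    (conjLinear Z u ^ m) x = x := by
  rw [conjLinear_pow_apply, Units.mul_inv_eq_iff_eq_mul, Units.val_pow_eq_pow_val, h]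

variable [FiniteDimensional Z D] {X : Set D}

theorem ZMod.castHom_eq_natCast {p : ℕ} [Fact p.Prime] (Z : Type*) [Field Z] [CharP Z p]
    (c : ZMod p) : ZMod.castHom (dvd_refl p) Z c = (c.val : Z) := by
  conv_lhs => rw [← ZMod.natCast_zmod_val c]
  exact map_natCast _ _

theorem Subalgebra.finrank_centralizer_of_commutator (p : ℕ) [Fact p.Prime] [CharP Z p] {b : D}
    {t : Dˣ} (hb : b ∈ Subalgebra.centralizer Z X) (ht : (t : D) ∈ Subalgebra.centralizer Z X)
    (hbt : b * t = t * (b + 1)) (hbp : ∀ x, (b ^ p - b) * x = x * (b ^ p - b)) :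
    Module.finrank Z (Subalgebra.centralizer Z X) =
      p * Module.finrank Z (Subalgebra.centralizer Z (insert b X)) := by
  have hDp : CharP D p := charP_of_injective_algebraMap (algebraMap Z D).injective p
  have hEnd := Module.End.charP Z D p
  let T : Module.End Z D := LinearMap.mulLeft Z b - LinearMap.mulRight Z b
  have hpow : ∀ m : ℕ, b * (t : D) ^ m = (t : D) ^ m * (b + m) := by
    intro m
    induction m with
    | zero => simp
    | succ m ih =>
      rw [pow_succ, ← mul_assoc, ih, mul_assoc, add_mul, hbt, Nat.cast_comm, ← mul_add, mul_assoc]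
      push_cast
      congr 2
      abel
  have h := Subalgebra.finrank_centralizer_eq (ZMod.castHom (dvd_refl p) Z) X b T
    (fun x hx => Subalgebra.sub_mem _ (Subalgebra.mul_mem _ hb hx) (Subalgebra.mul_mem _ hx hb))
    (fun x hx => ?_) Finset.univ (fun c hc => absurd (Finset.mem_univ c) hc)
    (fun c => (t : D) ^ c.val) fun c _ => ⟨Subalgebra.pow_mem _ ht _, pow_ne_zero _ t.ne_zero,
      fun u hu => ?_⟩
  · rwa [Finset.card_univ, ZMod.card] at h
  · rw [← FiniteField.map_X_pow_card_sub_X, ZMod.card]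
    have h1 : T ^ p = LinearMap.mulLeft Z (b ^ p) - LinearMap.mulRight Z (b ^ p) := by
      rw [sub_pow_char_of_commute p (LinearMap.commute_mulLeft_right b b), LinearMap.pow_mulLeft,
        LinearMap.pow_mulRight]
    have h2 := hbp x
    rw [sub_mul, mul_sub] at h2
    simp only [map_sub, map_pow, Polynomial.aeval_X, h1]
    simp only [T, LinearMap.sub_apply, LinearMap.mulLeft_apply, LinearMap.mulRight_apply]
    rw [sub_sub_sub_comm, h2, sub_self]
  · have h1 : (ZMod.castHom (dvd_refl p) Z c) • (u * (t : D) ^ c.val) =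
        u * (t : D) ^ c.val * (c.val : D) := by
      rw [Algebra.smul_def, Algebra.commutes]
      congr 1
      rw [ZMod.castHom_eq_natCast, map_natCast]
    rw [h1]
    simp only [T, LinearMap.sub_apply, LinearMap.mulLeft_apply, LinearMap.mulRight_apply]
    have h2 : u * (t : D) ^ c.val * b =
        u * (b * (t : D) ^ c.val) - u * (t : D) ^ c.val * c.val := by
      rw [hpow, mul_add, mul_add, ← mul_assoc, ← mul_assoc, add_sub_cancel_right]
    rw [h2, sub_eq_iff_eq_add, add_sub_cancel, ← mul_assoc, ← mul_assoc,
      mul_left_inj' (pow_ne_zero _ t.ne_zero)]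

theorem Subalgebra.finrank_centralizer_of_shift (p : ℕ) [Fact p.Prime] [CharP Z p] {b : D}
    {u : Dˣ} (hb : b ∈ Subalgebra.centralizer Z X) (hbX : b ∈ X)
    (hu : ∀ x ∈ Subalgebra.centralizer Z X,
      (u : D) * x * ((u⁻¹ : Dˣ) : D) ∈ Subalgebra.centralizer Z X)
    (hub : (u : D) * b = (b + 1) * u) (hup : ∀ x, (u : D) ^ p * x = x * (u : D) ^ p) :
    Module.finrank Z (Subalgebra.centralizer Z X) =
      p * Module.finrank Z (Subalgebra.centralizer Z (insert (u : D) X)) := by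
  have hDp : CharP D p := charP_of_injective_algebraMap (algebraMap Z D).injective p
  have hEnd := Module.End.charP Z D p
  let σ := conjLinear Z u
  let P : ℕ → D := fun m => Polynomial.aeval b (ascPochhammer Z m)
  have hP0 : P 0 = 1 := by simp [P]
  have hP1 : ∀ m, P (m + 1) = P m * (b + m) := fun m => by
    simp [P, ascPochhammer_succ_right]
  have hcomm : ∀ m, b * P m = P m * b := fun m => by
    have := congrArg (Polynomial.aeval b) (mul_comm Polynomial.X (ascPochhammer Z m))
    simpa [P] using this
  have hσb : σ b = b + 1 := by
    simp only [σ]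
    rw [conjLinear_apply, hub, Units.mul_inv_cancel_right]
  have hP2 : ∀ m, b * σ (P m) = P (m + 1) := by
    intro m
    induction m with
    | zero =>
      simp only [σ, hP1, hP0]
      simp [conjLinear_apply]
    | succ m ih =>
      rw [hP1 m, conjLinear_mul, ← mul_assoc, ih, hP1 (m + 1)]
      congr 1
      rw [map_add, show conjLinear Z u b = b + 1 from hσb]
      have : conjLinear Z u (m : D) = m := by
        rw [conjLinear_eq_iff, Nat.cast_comm]
      rw [this]
      push_cast
      abel
  have hne : ∀ m, P m ≠ 0 := by
    intro m
    induction m with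
    | zero => rw [hP0]; exact one_ne_zero
    | succ m ih =>
      rw [hP1]
      refine mul_ne_zero ih fun h => ?_
      rw [eq_neg_of_add_eq_zero_left h, add_mul, one_mul, mul_neg, neg_mul, Nat.cast_comm,
        left_eq_add] at hub
      exact u.ne_zero hub
  let T : Module.End Z D := LinearMap.mulLeft Z b * (σ - 1)
  have hT : ∀ m a, T (P m * a) = P (m + 1) * (σ a - a) + m * (P m * a) := by
    intro m a
    simp only [T, Module.End.mul_apply, LinearMap.mulLeft_apply, LinearMap.sub_apply,
      Module.End.one_apply]
    rw [conjLinear_mul, mul_sub, ← mul_assoc, show b * conjLinear Z u (P m) = _ from hP2 m, mul_sub,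
      ← mul_assoc, hcomm, ← mul_assoc, Nat.cast_comm, hP1]
    simp only [mul_add, add_mul]
    abel
  have hprod : ∀ m x, Polynomial.aeval T
      (∏ i ∈ Finset.range m, (Polynomial.X - Polynomial.C (i : Z))) x =
      P m * ((σ - 1) ^ m) x := by
    intro m x
    induction m with
    | zero => simp [hP0]
    | succ m ih =>
      rw [Finset.prod_range_succ, mul_comm, map_mul, Module.End.mul_apply, ih, map_sub,
        Polynomial.aeval_X, Polynomial.aeval_C, LinearMap.sub_apply, hT,
        Module.algebraMap_end_apply, pow_succ', Module.End.mul_apply, Algebra.smul_def,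
        map_natCast, add_sub_cancel_right]
      rfl
  have h := Subalgebra.finrank_centralizer_eq (ZMod.castHom (dvd_refl p) Z) X (u : D) T
    (fun x hx => Subalgebra.mul_mem _ hb (Subalgebra.sub_mem _ (by
      simp only [σ]; rw [conjLinear_apply]; exact hu x hx) hx))
    (fun x hx => ?_) Finset.univ (fun c hc => absurd (Finset.mem_univ c) hc)
    (fun c => P c.val) fun c _ => ⟨?_, hne _, fun v hv => ?_⟩
  · rwa [Finset.card_univ, ZMod.card] at h
  · have h1 : ∏ c : ZMod p, (Polynomial.X - Polynomial.C (ZMod.castHom (dvd_refl p) Z c)) =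
        ∏ i ∈ Finset.range p, (Polynomial.X - Polynomial.C (i : Z)) := by
      refine Finset.prod_bij' (fun c _ => c.val) (fun i _ => (i : ZMod p)) (fun c _ => ?_)
        (fun i _ => Finset.mem_univ _) (fun c _ => ZMod.natCast_zmod_val c) (fun i hi => ?_)
        fun c _ => ?_
      · exact Finset.mem_range.mpr (ZMod.val_lt c)
      · exact ZMod.val_cast_of_lt (Finset.mem_range.mp hi)
      · rw [ZMod.castHom_eq_natCast]
    rw [h1, hprod, sub_pow_char_of_commute p (Commute.one_right _), one_pow, LinearMap.sub_apply,
      conjLinear_pow_eq_self (hup x), Module.End.one_apply, sub_self, mul_zero]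
  · have hP3 : ∀ m, P m ∈ Subalgebra.centralizer Z X := by
      intro m
      induction m with
      | zero => rw [hP0]; exact Subalgebra.one_mem _
      | succ m ih =>
        rw [hP1]
        exact Subalgebra.mul_mem _ ih (Subalgebra.add_mem _ hb (natCast_mem _ m))
    exact hP3 _
  · have hvb : b * v = v * b := (Subalgebra.mem_centralizer_iff Z).mp hv b hbX
    have hvP : ∀ m, v * P m = P m * v := by
      intro m
      induction m with
      | zero => rw [hP0, mul_one, one_mul]
      | succ m ih =>
        rw [hP1, ← mul_assoc, ih, mul_assoc, mul_assoc, mul_add, add_mul, hvb, Nat.cast_comm]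
    have h1 : (ZMod.castHom (dvd_refl p) Z c) • (P c.val * v) = c.val * (P c.val * v) := by
      rw [Algebra.smul_def]
      congr 1
      rw [ZMod.castHom_eq_natCast, map_natCast]
    rw [hvP, h1, hT, add_eq_right, mul_eq_zero_iff_left (hne _), sub_eq_zero]
    exact conjLinear_eq_iff u v

theorem Subalgebra.finrank_centralizer_of_conj {κ : Type*} [Field κ] [Finite κ] (ψ : κ →+* Z)
    {u : Dˣ}
    (hu : ∀ x ∈ Subalgebra.centralizer Z X,
      (u : D) * x * ((u⁻¹ : Dˣ) : D) ∈ Subalgebra.centralizer Z X)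
    (huq : ∀ x ∈ Subalgebra.centralizer Z X,
      (u : D) ^ (Nat.card κ - 1) * x = x * (u : D) ^ (Nat.card κ - 1)) :
    ∃ m, m ∣ Nat.card κ - 1 ∧ Module.finrank Z (Subalgebra.centralizer Z X) =
      m * Module.finrank Z (Subalgebra.centralizer Z (insert (u : D) X)) := by
  classical
  have := Fintype.ofFinite κ
  let H : Subgroup κˣ :=
    { carrier := {c | ∃ x ∈ Subalgebra.centralizer Z X, x ≠ 0 ∧ conjLinear Z u x = ψ c • x}
      one_mem' := ⟨1, Subalgebra.one_mem _, one_ne_zero, by simp [conjLinear_apply]⟩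
      mul_mem' := by
        rintro c d ⟨x, hx, hx0, hxc⟩ ⟨y, hy, hy0, hyd⟩
        refine ⟨x * y, Subalgebra.mul_mem _ hx hy, mul_ne_zero hx0 hy0, ?_⟩
        rw [conjLinear_mul, hxc, hyd, smul_mul_smul_comm, Units.val_mul, map_mul]
      inv_mem' := by
        rintro c ⟨x, hx, hx0, hxc⟩
        refine ⟨x⁻¹, ?_, inv_ne_zero hx0, ?_⟩
        · rw [Subalgebra.mem_centralizer_iff] at hx ⊢
          exact fun g hg => (show Commute g x from hx g hg).inv_right₀
        · have h1 : conjLinear Z u x⁻¹ * conjLinear Z u x = 1 := by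
            rw [← conjLinear_mul, inv_mul_cancel₀ hx0]
            simp [conjLinear_apply]
          rw [eq_inv_of_mul_eq_one_left h1, hxc, Algebra.smul_def, mul_inv_rev, Algebra.smul_def,
            Units.val_inv_eq_inv_val, map_inv₀, map_inv₀]
          rw [← map_inv₀ (algebraMap Z D), Algebra.commutes] }
  refine ⟨Nat.card H, ?_, ?_⟩
  · rw [← Nat.card_units]
    exact H.card_subgroup_dvd_card
  choose t ht using fun c : H => c.2
  have h := Subalgebra.finrank_centralizer_eq ψ X (u : D) (conjLinear Z u)
    (fun x hx => by rw [conjLinear_apply]; exact hu x hx) (fun x hx => ?_)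
    (Finset.image (fun c : H => ((c : κˣ) : κ)) Finset.univ) (fun c hc x hx hxc => ?_)
    (fun c => if h : c ≠ 0 then if h' : Units.mk0 c h ∈ H then t ⟨_, h'⟩ else 1 else 1)
    fun c hc => ?_
  · rw [h, Finset.card_image_of_injective, Finset.card_univ, Nat.card_eq_fintype_card]
    exact Units.val_injective.comp Subtype.val_injective
  · rw [← FiniteField.map_X_pow_card_sub_X, ← Nat.card_eq_fintype_card]
    have h1 : Nat.card κ = Nat.card κ - 1 + 1 := by
      have := Nat.card_pos (α := κ)
      omega
    rw [map_sub, map_pow, Polynomial.aeval_X, LinearMap.sub_apply, h1, pow_succ',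
      Module.End.mul_apply, conjLinear_pow_eq_self (huq x hx), sub_self]
  · by_contra h0
    have hc0 : c ≠ 0 := by
      rintro rfl
      rw [map_zero, zero_smul, conjLinear_apply] at hxc
      simp [h0] at hxc
    have hcH : Units.mk0 c hc0 ∈ H := ⟨x, hx, h0, hxc⟩
    exact hc (Finset.mem_image.mpr ⟨⟨Units.mk0 c hc0, hcH⟩, Finset.mem_univ _, rfl⟩)
  · obtain ⟨c, -, rfl⟩ := Finset.mem_image.mp hc
    have hc0 : ((c : κˣ) : κ) ≠ 0 := c.1.ne_zero
    have h' : Units.mk0 ((c : κˣ) : κ) hc0 = c := Units.mk0_val _ _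
    simp only [dif_pos hc0, h', SetLike.coe_mem, dif_pos]
    obtain ⟨h1, h2, h3⟩ := ht c
    refine ⟨h1, h2, fun v hv => ?_⟩
    rw [conjLinear_mul, h3, mul_smul_comm, (smul_right_injective D (by
      rwa [Ne, map_eq_zero] : ψ ((c : κˣ) : κ) ≠ 0)).eq_iff, mul_left_inj' h2, conjLinear_eq_iff]

end CentralizerDimension

theorem Subalgebra.conj_mem_centralizer {Z D : Type*} [Field Z] [DivisionRing D] [Algebra Z D]
    {X : Set D} {u : Dˣ}
    (h : ∀ g ∈ X, ∃ c, g * u = u * c ∧ ∀ x ∈ Subalgebra.centralizer Z X, c * x = x * c) :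
    ∀ x ∈ Subalgebra.centralizer Z X,
      (u : D) * x * ((u⁻¹ : Dˣ) : D) ∈ Subalgebra.centralizer Z X := by
  intro x hx
  rw [Subalgebra.mem_centralizer_iff]
  intro g hg
  obtain ⟨c, hc, hcx⟩ := h g hg
  have h1 : c * ((u⁻¹ : Dˣ) : D) = ((u⁻¹ : Dˣ) : D) * g := by
    rw [Units.mul_inv_eq_iff_eq_mul, mul_assoc, hc, Units.inv_mul_cancel_left]
  rw [← mul_assoc, ← mul_assoc, hc, mul_assoc (u : D), hcx x hx, mul_assoc, mul_assoc, h1]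
  simp only [mul_assoc]

namespace IsFiniteSystem

variable {κ K D : Type*} [Field κ] [Field K] [DivisionRing D] [Algebra K D]
  {n r : ℕ} {φ : κ →+* K} {ι : Fin r → Fin n} {lam : Fin n → Fin n → Kˣ} {y : Fin n → Dˣ}
  {w : Fin r → D} {p : ℕ} [CharP D p] [Fact p.Prime]
  {Z : Type*} [Field Z] [Algebra Z D]

theorem finrank_eq_centralizer_w [CharP Z p] [FiniteDimensional Z D]
    (R : IsFiniteSystem φ ι lam y w) (hι : Function.Injective ι) (s : Finset (Fin r)) :
    Module.finrank Z D = p ^ s.card * Module.finrank Z (Subalgebra.centralizer Z (w '' s)) := by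
  classical
  induction s using Finset.induction_on with
  | empty =>
    rw [Finset.coe_empty, Set.image_empty, Finset.card_empty, pow_zero, one_mul,
      show Subalgebra.centralizer Z (∅ : Set D) = ⊤ from Algebra.eq_top_iff.mpr fun x =>
        (Subalgebra.mem_centralizer_iff Z).mpr fun g hg => absurd hg (Set.notMem_empty g)]
    exact Subalgebra.topEquiv.toLinearEquiv.finrank_eq.symm
  | insert i s hi ih =>
    rw [ih, Finset.coe_insert, Set.image_insert_eq, Finset.card_insert_of_notMem hi,
      Subalgebra.finrank_centralizer_of_commutator p (b := w i) (t := y (ι i)), pow_succ, mul_assoc]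
    · rw [Subalgebra.mem_centralizer_iff]
      rintro _ ⟨j, -, rfl⟩
      exact R.ww j i
    · rw [Subalgebra.mem_centralizer_iff]
      rintro _ ⟨j, hj, rfl⟩
      have hij : ι j ≠ ι i := fun h => hi (hι h ▸ hj)
      rw [R.wy, if_neg hij, add_zero]
    · rw [R.wy, if_pos rfl]
    · exact R.central_sub i

variable [Finite κ]

theorem cast_card_eq_zero (_ : IsFiniteSystem φ ι lam y w) : (Nat.card κ : D) = 0 := by
  have := Fintype.ofFinite κ
  have h := congrArg (fun c => algebraMap K D (φ c)) (FiniteField.cast_card_eq_zero κ)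
  rwa [map_natCast, map_natCast, map_zero, map_zero, ← Nat.card_eq_fintype_card] at h

theorem finrank_centralizer_w [CharP Z p] [FiniteDimensional Z D]
    (R : IsFiniteSystem φ ι lam y w) (hι : Function.Injective ι) (t : Finset (Fin r)) :
    Module.finrank Z (Subalgebra.centralizer Z (Set.range w)) =
      p ^ t.card * Module.finrank Z (Subalgebra.centralizer Z
        ((fun i => (y (ι i) : D) ^ (Nat.card κ - 1)) '' t ∪ Set.range w)) := by
  classical
  induction t using Finset.induction_on with
  | empty =>
    rw [Finset.coe_empty, Set.image_empty, Set.empty_union, Finset.card_empty, pow_zero, one_mul]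
  | insert i t hi ih =>
    have hw : ∀ j, ι j ≠ ι i →
        w i * (y (ι j) : D) ^ (Nat.card κ - 1) = (y (ι j) : D) ^ (Nat.card κ - 1) * w i := by
      intro j hj
      rw [R.w_mul_pow, if_neg hj.symm, add_zero]
    have hu := R.w_mul_pow i (ι i) (Nat.card κ - 1)
    rw [if_pos rfl, Nat.cast_sub Nat.card_pos, R.cast_card_eq_zero, Nat.cast_one, zero_sub] at hu
    rw [ih, Finset.coe_insert, Set.image_insert_eq, Finset.card_insert_of_notMem hi,
      Set.insert_union, Subalgebra.finrank_centralizer_of_shift p (b := w i)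
        (u := y (ι i) ^ (Nat.card κ - 1)) (X := _ ∪ Set.range w), pow_succ, mul_assoc,
      Units.val_pow_eq_pow_val]
    · rw [Subalgebra.mem_centralizer_iff]
      rintro _ (⟨j, hj, rfl⟩ | ⟨j, rfl⟩)
      · exact (hw j fun h => hi (hι h ▸ hj)).symm
      · exact R.ww j i
    · exact .inr ⟨i, rfl⟩
    · refine Subalgebra.conj_mem_centralizer ?_
      rintro _ (⟨j, hj, rfl⟩ | ⟨j, rfl⟩)
      · refine ⟨_, ?_, fun x hx => (Subalgebra.mem_centralizer_iff Z).mp hx _ (.inl ⟨j, hj, rfl⟩)⟩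
        have := R.pow_mul_comm (ι i) 1 ((IsMonomial.gen (U := ⊤) (ι j)).pow (Nat.card κ - 1))
        rw [mul_one] at this
        simpa only [← Units.val_pow_eq_pow_val, ← Units.val_mul] using congrArg Units.val this.symm
      · refine ⟨_, by rw [Units.val_pow_eq_pow_val, R.w_mul_pow], fun x hx => ?_⟩
        rw [add_mul, mul_add, (Subalgebra.mem_centralizer_iff Z).mp hx _ (.inr ⟨j, rfl⟩)]
        split_ifs
        · rw [Nat.cast_comm]
        · rw [zero_mul, mul_zero]
    · rw [Units.val_pow_eq_pow_val, add_mul, hu, mul_add, one_mul, mul_neg, mul_one,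
        neg_add_cancel_right]
    · intro x
      have := R.central_pow (p := p) (ι i) x
      rwa [pow_mul] at this

variable [Algebra K Z]

theorem finrank_centralizer_pow (R : IsFiniteSystem φ ι lam y w) [FiniteDimensional Z D]
    (s : Finset (Fin n)) :
    ∃ m, ¬ p ∣ m ∧ Module.finrank Z (Subalgebra.centralizer Z
        (Set.range (fun i => (y (ι i) : D) ^ (Nat.card κ - 1)) ∪ Set.range w)) =
      m * Module.finrank Z (Subalgebra.centralizer Z ((fun i => (y i : D)) '' s ∪
        (Set.range (fun i => (y (ι i) : D) ^ (Nat.card κ - 1)) ∪ Set.range w))) := by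
  classical
  have hp := (Fact.out : p.Prime)
  induction s using Finset.induction_on with
  | empty => exact ⟨1, hp.not_dvd_one, by
    rw [Finset.coe_empty, Set.image_empty, Set.empty_union, one_mul]⟩
  | insert i s hi ih =>
    obtain ⟨m, hm, h⟩ := ih
    have key := Subalgebra.finrank_centralizer_of_conj ((algebraMap K Z).comp φ)
      (u := y i) (X := (fun i => (y i : D)) '' s ∪
        (Set.range (fun i => (y (ι i) : D) ^ (Nat.card κ - 1)) ∪ Set.range w)) ?_ ?_
    · obtain ⟨m', hm', h'⟩ := key
      refine ⟨m * m', fun hd => ?_, ?_⟩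
      · rcases hp.dvd_mul.mp hd with hd | hd
        · exact hm hd
        · have h1 : p ∣ Nat.card κ := (CharP.cast_eq_zero_iff D p _).mp R.cast_card_eq_zero
          have h2 := Nat.dvd_sub h1 (hd.trans hm')
          rw [Nat.sub_sub_self Nat.card_pos] at h2
          exact hp.not_dvd_one h2
      · rw [h, h', Finset.coe_insert, Set.image_insert_eq, Set.insert_union, mul_assoc]
    · refine Subalgebra.conj_mem_centralizer ?_
      rintro _ (⟨j, hj, rfl⟩ | ⟨j, rfl⟩ | ⟨j, rfl⟩)
      · refine ⟨(lam j i : K) • (y j : D), by rw [R.yy, mul_smul_comm], fun x hx => ?_⟩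
        rw [smul_mul_assoc, mul_smul_comm,
          (Subalgebra.mem_centralizer_iff Z).mp hx _ (.inl ⟨j, hj, rfl⟩)]
      · refine ⟨_, ?_, fun x hx =>
          (Subalgebra.mem_centralizer_iff Z).mp hx _ (.inr (.inl ⟨j, rfl⟩))⟩
        have := R.pow_mul_comm (ι j) 1 (IsMonomial.gen (U := ⊤) i)
        rw [mul_one] at this
        simpa only [← Units.val_pow_eq_pow_val, ← Units.val_mul] using congrArg Units.val this
      · refine ⟨_, R.wy j i, fun x hx => ?_⟩
        rw [add_mul, mul_add, (Subalgebra.mem_centralizer_iff Z).mp hx _ (.inr (.inr ⟨j, rfl⟩))]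
        split_ifs <;> simp
    · intro x hx
      by_cases hi : i ∈ Set.range ι
      · obtain ⟨j, rfl⟩ := hi
        exact (Subalgebra.mem_centralizer_iff Z).mp hx _ (.inr (.inl ⟨j, rfl⟩))
      · exact R.central_pow_of_notMem hi x

variable [IsScalarTower K Z D]

/-- The `p`-part of the dimension over the center. -/
theorem finrank_eq (R : IsFiniteSystem φ ι lam y w) (hι : Function.Injective ι) (p : ℕ) [CharP D p]
    [Fact p.Prime] (hZ : ∀ d : D, (∀ x, d * x = x * d) → ∃ z : Z, algebraMap Z D z = d) :
    ∃ m, ¬ p ∣ m ∧ Module.finrank Z D = p ^ (2 * r) * m := by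
  have : CharP Z p := ((algebraMap Z D).charP_iff (algebraMap Z D).injective p).mpr inferInstance
  have : FiniteDimensional Z D := R.finiteDimensional (fun i => hZ _ (R.central_pow (p := p) i))
    fun i => hZ _ (R.central_sub i)
  have h1 := R.finrank_eq_centralizer_w (p := p) (Z := Z) hι Finset.univ
  have h2 := R.finrank_centralizer_w (p := p) (Z := Z) hι Finset.univ
  obtain ⟨m, hm, h3⟩ := R.finrank_centralizer_pow (p := p) (Z := Z) Finset.univ
  rw [Finset.coe_univ, Set.image_univ, Finset.card_univ, Fintype.card_fin] at h1 h2
  have h4 : Subalgebra.centralizer Z ((fun i => (y i : D)) '' (Finset.univ : Finset (Fin n)) ∪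
      (Set.range (fun i => (y (ι i) : D) ^ (Nat.card κ - 1)) ∪ Set.range w)) = ⊥ := by
    rw [eq_bot_iff]
    intro x hx
    rw [Subalgebra.mem_centralizer_iff] at hx
    obtain ⟨z, rfl⟩ := hZ x (R.gen.commutes_qGenerators
      (fun i => (hx _ (.inl ⟨i, Finset.mem_coe.mpr (Finset.mem_univ i), rfl⟩)).symm)
      fun i => (hx _ (.inr (.inr ⟨i, rfl⟩))).symm)
    exact Subalgebra.algebraMap_mem _ z
  rw [h4, Subalgebra.finrank_bot, mul_one] at h3
  exact ⟨m, hm, by rw [h1, h2, h3, two_mul, pow_add, mul_assoc]⟩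

end IsFiniteSystem

theorem IsQFrame.rank_le {k D : Type u} [Field k] [DivisionRing D] [Algebra k D] {n r n' r' : ℕ}
    {ι : Fin r → Fin n} {lam : Fin n → Fin n → kˣ} {y : Fin n → Dˣ} {w : Fin r → D}
    {ι' : Fin r' → Fin n'} {lam' : Fin n' → Fin n' → kˣ} {y' : Fin n' → Dˣ} {w' : Fin r' → D}
    (S : IsQFrame ι lam y w) (S' : IsQFrame ι' lam' y' w') (hι : Function.Injective ι)
    (hι' : Function.Injective ι') : r = r' ∧ n + r ≤ n' + r' := by
  obtain ⟨κ, K, E, _, _, _, _, _, φ, μ, x, z, μ', x', z', R, R', X, hX, hli⟩ :=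
    S.exists_specialization S'
  obtain ⟨p, hp⟩ := CharP.exists κ
  have hprime : Fact p.Prime := ⟨(CharP.char_is_prime_or_zero κ p).resolve_right
    fun h => CharP.char_ne_zero_of_finite κ p h⟩
  have hE : CharP E p :=
    (((algebraMap K E).comp φ).charP_iff ((algebraMap K E).comp φ).injective p).mp hp
  let Z := Subring.center E
  let _ : Algebra K Z := ((algebraMap K E).codRestrict Z fun c =>
    Subring.mem_center_iff.mpr fun g => (Algebra.commutes c g).symm).toAlgebra
  have _ : IsScalarTower K Z E := IsScalarTower.of_algebraMap_eq fun _ => rfl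
  have hZ : ∀ d : E, (∀ x, d * x = x * d) → ∃ z : Z, algebraMap Z E z = d := fun d hd =>
    ⟨⟨d, Subring.mem_center_iff.mpr fun g => (hd g).symm⟩, rfl⟩
  refine ⟨?_, by exact_mod_cast (R.le_trdeg p hX hli hZ).trans (R'.trdeg_le p hZ)⟩
  obtain ⟨m, hm, h1⟩ := R.finrank_eq hι p hZ
  obtain ⟨m', hm', h2⟩ := R'.finrank_eq hι' p hZ
  have h3 : ∀ {a b : ℕ}, ¬ p ∣ b → padicValNat p (p ^ a * b) = a := by
    intro a b hb
    rw [padicValNat.mul (pow_ne_zero _ hprime.out.ne_zero) (by rintro rfl; exact hb (dvd_zero p)),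
      padicValNat.prime_pow, padicValNat.eq_zero_of_not_dvd hb, add_zero]
  have h4 : 2 * r = 2 * r' := by rw [← h3 (a := 2 * r) hm, ← h1, h2, h3 hm']
  omega

theorem IsQFrame.rank_eq {k D : Type u} [Field k] [DivisionRing D] [Algebra k D] {n r n' r' : ℕ}
    {ι : Fin r → Fin n} {lam : Fin n → Fin n → kˣ} {y : Fin n → Dˣ} {w : Fin r → D}
    {ι' : Fin r' → Fin n'} {lam' : Fin n' → Fin n' → kˣ} {y' : Fin n' → Dˣ} {w' : Fin r' → D}
    (S : IsQFrame ι lam y w) (S' : IsQFrame ι' lam' y' w') (hι : Function.Injective ι)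
    (hι' : Function.Injective ι') : n = n' ∧ r = r' := by
  obtain ⟨hr, h1⟩ := S.rank_le S' hι hι'
  obtain ⟨-, h2⟩ := S'.rank_le S hι' hι
  omega

section LeadingMonomial

variable {k D : Type*} [Field k] [DivisionRing D] [Algebra k D] {n r n' r' : ℕ}
  {ι : Fin r → Fin n} {lam : Fin n → Fin n → kˣ} {y : Fin n → Dˣ} {w : Fin r → D}
  {ι' : Fin r' → Fin n'} {lam' : Fin n' → Fin n' → kˣ} {y' : Fin n' → Dˣ} {w' : Fin r' → D}

theorem scalarUnit_injective {K B : Type*} [Field K] [Ring B] [Nontrivial B] [Algebra K B] :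
    Function.Injective (scalarUnit B : Kˣ →* Bˣ) :=
  Units.map_injective (algebraMap K B).injective

/-- A multiplicative retraction onto the monomials in the `y i`. -/
theorem IsQFrame.exists_retraction (S : IsQFrame ι lam y w) :
    ∃ ν : D →*₀ D, (∀ g a, IsMonomial (⊤ : Subgroup kˣ) y g a → ν g = g) ∧
      ∀ d, d ≠ 0 → ∃ g a, IsMonomial (⊤ : Subgroup kˣ) y g a ∧ ν d = g := by
  classical
  choose Y hY using IsMonomial.exists_of_exp (⊤ : Subgroup kˣ) y
  let v : Valuation k (WithZero (Multiplicative ℤ)) := 1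
  have hv : ∀ x, x ≠ 0 → v x = 1 := fun x hx => Valuation.one_apply_of_ne_zero hx
  obtain ⟨c, hc, T⟩ := S.isTriangular v (U := ⊤) (fun u _ => hv _ u.ne_zero)
    (fun _ _ => Subgroup.mem_top _) hY
  obtain ⟨A, hA, hspan⟩ := S.exists_subring hY
  obtain ⟨ν, hν⟩ := T.exists_leading_hom (G := D) IsQSystem.key_injective IsQSystem.key_add
    (S.li Y hY) hA (fun a => (hspan a).mp) (fun α x => x • (Y α.1 : D))
    (fun α x hx => smul_ne_zero hx (Y α.1).ne_zero) (by
      intro α β x z t hx hz h _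
      rw [hv _ (mul_ne_zero hx hz), Valuation.one_apply_lt_one_iff, sub_eq_zero] at h
      rw [h, smul_mul_smul_comm, hc, smul_smul]
      rfl)
  have hlead : ∀ f : ((Fin n → ℤ) × (Fin r →₀ ℕ)) →₀ k, f ≠ 0 → ∃ g a,
      IsMonomial (⊤ : Subgroup kˣ) y g a ∧
        ν (Finsupp.linearCombination k (S.basisFun Y) f) = g := by
    intro f hf
    obtain ⟨α, hα⟩ := IsLead.exists_isLead (v := v) (key := IsQSystem.key n r) hf
    refine ⟨_, _, (hY α.1).smul (Subgroup.mem_top (Units.mk0 _ hα.ne)), ?_⟩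
    rw [hν f α hα ((hspan _).mpr ⟨f, rfl⟩)]
    simp [Algebra.smul_def]
  refine ⟨ν, fun g a hg => ?_, fun d hd => ?_⟩
  · obtain ⟨u, -, rfl⟩ := hg.unique S.yy (fun _ _ => Subgroup.mem_top _) (hY a)
    have h1 : Finsupp.linearCombination k (S.basisFun Y) (Finsupp.single (a, 0) (u : k)) =
        ((scalarUnit D u * Y a : Dˣ) : D) := by
      simp [IsQSystem.basisFun, Algebra.smul_def]
    have h2 : IsLead v (IsQSystem.key n r) (Finsupp.single (a, 0) (u : k)) (a, 0) := by
      refine ⟨by simp, fun γ => ?_, fun γ hγ => ?_⟩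
      · rw [Finsupp.single_eq_same, hv _ u.ne_zero]
        by_cases h : Finsupp.single (a, 0) (u : k) γ = 0
        · simp [h]
        · rw [hv _ h]
      · rw [Finsupp.single_eq_of_ne (by rintro rfl; exact lt_irrefl _ hγ), map_zero,
          Finsupp.single_eq_same, hv _ u.ne_zero]
        exact zero_lt_one
    rw [← h1, hν _ _ h2 ((hspan _).mpr ⟨_, rfl⟩), h1]
    simp [Algebra.smul_def]
  · obtain ⟨a, ha, b, hb, h0, rfl⟩ := hA d
    obtain ⟨f, rfl⟩ := (hspan a).mp ha
    obtain ⟨f', rfl⟩ := (hspan b).mp hb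
    obtain ⟨g, a, hg, hga⟩ := hlead f (by rintro rfl; simp at hd)
    obtain ⟨g', a', hg', hga'⟩ := hlead f' (by rintro rfl; simp at h0)
    exact ⟨_, _, hg.mul hg'.inv, by simp [map_inv₀, hga', map_mul, hga]⟩

/-- Leading exponents of the `y'`-variables of another frame realise its commutation parameters. -/
theorem IsQFrame.exists_exponents (S : IsQFrame ι lam y w) (S' : IsQFrame ι' lam' y' w') :
    ∃ α : Fin n' → Fin n → ℤ, ∀ i j, bichar lam (α i) (α j) = lam' i j := by
  obtain ⟨ν, hν, hν'⟩ := S.exists_retraction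
  choose g α hg hgν using fun i => hν' (y' i) (y' i).ne_zero
  refine ⟨α, fun i j => ?_⟩
  have h1 := congrArg ν (S'.yy i j)
  rw [Algebra.smul_def, map_mul, map_mul, map_mul, hgν, hgν,
    show ν (algebraMap k D (lam' i j)) = _ from
      hν (scalarUnit D (lam' i j)) 0 (.scalar _ (Subgroup.mem_top _))] at h1
  have h2 := (hg i).mul_comm' S.yy (hg j)
  have h3 : g i * g j = scalarUnit D (lam' i j) * (g j * g i) := Units.ext h1
  rw [h2, mul_left_inj] at h3
  exact scalarUnit_injective h3

end LeadingMonomial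

/-- The bicharacter as a bilinear map. -/
noncomputable def bicharBilin {G : Type*} [CommGroup G] {n : ℕ} (lam : Fin n → Fin n → G) :
    (Fin n → ℤ) →ₗ[ℤ] (Fin n → ℤ) →ₗ[ℤ] Additive G :=
  LinearMap.mk₂ ℤ (fun a b => Additive.ofMul (bichar lam a b))
    (fun a a' b => by rw [bichar.add_left]; rfl)
    (fun c a b => by
      rw [← ofMul_zpow]
      simp [bichar, ← Finset.prod_zpow, ← zpow_mul, mul_left_comm, mul_comm])
    (fun a b b' => by rw [bichar.add_right]; rfl)
    (fun c a b => by
      rw [← ofMul_zpow]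
      simp [bichar, ← Finset.prod_zpow, ← zpow_mul, mul_left_comm, mul_comm])

theorem bichar.exists_linearMap {G : Type*} [CommGroup G] {n n' : ℕ} {lam : Fin n → Fin n → G}
    {lam' : Fin n' → Fin n' → G} {α : Fin n' → Fin n → ℤ}
    (h : ∀ i j, bichar lam (α i) (α j) = lam' i j) :
    ∃ A : (Fin n' → ℤ) →ₗ[ℤ] (Fin n → ℤ), (∀ i, A (Pi.single i 1) = α i) ∧
      ∀ a b, bicharBilin lam (A a) (A b) = bicharBilin lam' a b := by
  let A := Fintype.linearCombination ℤ α
  have hA : ∀ i, A (Pi.single i 1) = α i := fun i => by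
    simp [A]
  refine ⟨A, hA, ?_⟩
  have h1 : (bicharBilin lam).compl₁₂ A A = bicharBilin lam' := by
    refine LinearMap.pi_ext' fun i => LinearMap.ext_ring (LinearMap.pi_ext' fun j =>
      LinearMap.ext_ring ?_)
    have h2 : bichar lam (A (Pi.single i 1)) (A (Pi.single j 1)) =
        bichar lam' (Pi.single i 1) (Pi.single j 1) := by
      rw [hA, hA, h, bichar.single_single]
    exact congrArg Additive.ofMul h2
  exact fun a b => LinearMap.congr_fun (LinearMap.congr_fun h1 a) b

/-- An endomorphism of a lattice preserving a nondegenerate bilinear map is surjective. -/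
theorem LinearMap.surjective_of_preserves_bilin {L C : Type*} [AddCommGroup L] [Module.Free ℤ L]
    [Module.Finite ℤ L] [AddCommGroup C] (B : L →ₗ[ℤ] L →ₗ[ℤ] C)
    (hB : ∀ a, (∀ b, B a b = 0) → a = 0) (M : L →ₗ[ℤ] L) (hM : ∀ a b, B (M a) (M b) = B a b) :
    Function.Surjective M := by
  have hpow : ∀ (m : ℕ) a b, B ((M ^ m) a) ((M ^ m) b) = B a b := by
    intro m
    induction m with
    | zero => intro a b; rfl
    | succ m ih => intro a b; rw [pow_succ', Module.End.mul_apply, Module.End.mul_apply, hM, ih]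
  have hinj : ∀ m : ℕ, Function.Injective (M ^ m : L →ₗ[ℤ] L) := by
    intro m
    rw [injective_iff_map_eq_zero]
    intro a ha
    exact hB a fun b => by rw [← hpow m, ha, map_zero, LinearMap.zero_apply]
  have hnd : ∀ (m : ℕ) a, (∀ b, B a ((M ^ m) b) = 0) → a = 0 := by
    intro m a ha
    have hfin := Submodule.finiteQuotientOfFreeOfRankEq (LinearMap.range (M ^ m))
      (LinearMap.finrank_range_of_inj (hinj m))
    have hN : 0 < Nat.card (L ⧸ LinearMap.range (M ^ m)) := Nat.card_pos
    set N := Nat.card (L ⧸ LinearMap.range (M ^ m))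
    have hmem : ∀ b, N • b ∈ LinearMap.range (M ^ m) := by
      intro b
      rw [← Submodule.Quotient.mk_eq_zero, Submodule.Quotient.mk_smul]
      exact card_nsmul_eq_zero'
    have h0 : N • a = 0 := by
      refine hB _ fun b => ?_
      obtain ⟨b', hb'⟩ := hmem b
      rw [map_nsmul, LinearMap.smul_apply, ← map_nsmul, ← hb', ha]
    rw [← natCast_zsmul] at h0
    exact (smul_eq_zero.mp h0).resolve_left (by exact_mod_cast hN.ne')
  obtain ⟨f, hf, hfM⟩ := LinearMap.exists_monic_and_aeval_eq_zero ℤ M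
  intro a
  set d := f.natDegree
  let a' : L := -∑ i ∈ Finset.range d, f.coeff i • (M ^ (d - 1 - i)) a
  refine ⟨a', ?_⟩
  rw [← sub_eq_zero]
  refine hnd d _ fun b => ?_
  have h1 : ∑ i ∈ Finset.range d, f.coeff i • (M ^ i) b + (M ^ d) b = 0 := by
    have := LinearMap.congr_fun hfM b
    rw [Polynomial.aeval_eq_sum_range, Finset.sum_range_succ] at this
    simpa [LinearMap.sum_apply, d, hf.coeff_natDegree] using this
  have h2 : ∀ i ∈ Finset.range d, B (M ((M ^ (d - 1 - i)) a)) ((M ^ d) b) = B a ((M ^ i) b) := by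
    intro i hi
    have hi' := Finset.mem_range.mp hi
    have e1 : M ((M ^ (d - 1 - i)) a) = (M ^ (d - i)) a := by
      rw [← Module.End.mul_apply, ← pow_succ']
      congr 2
      omega
    have e2 : (M ^ d) b = (M ^ (d - i)) ((M ^ i) b) := by
      rw [← Module.End.mul_apply, ← pow_add, Nat.sub_add_cancel hi'.le]
    rw [e1, e2, hpow]
  have h3 : B (M a') ((M ^ d) b) = -∑ i ∈ Finset.range d, f.coeff i • B a ((M ^ i) b) := by
    simp only [a', map_neg, map_sum, LinearMap.neg_apply, LinearMap.sum_apply, map_zsmul,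
      LinearMap.smul_apply]
    rw [Finset.sum_congr rfl fun i hi => by rw [h2 i hi]]
  have h4 := congrArg (B a) h1
  rw [map_add, map_sum, map_zero] at h4
  simp only [map_zsmul] at h4
  rw [map_sub, LinearMap.sub_apply, h3, ← neg_add', h4, neg_zero]

theorem IsMonomial.map {K B C : Type*} [Field K] [Ring B] [Algebra K B] [Ring C] [Algebra K C]
    {n n' : ℕ} {y : Fin n → Bˣ} {y' : Fin n' → Cˣ} (f : B →ₐ[K] C)
    (A : (Fin n → ℤ) →+ (Fin n' → ℤ))
    (hA : ∀ i, IsMonomial (⊤ : Subgroup Kˣ) y' (Units.map (f : B →* C) (y i)) (A (Pi.single i 1)))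
    {g : Bˣ} {a : Fin n → ℤ} (hg : IsMonomial (⊤ : Subgroup Kˣ) y g a) :
    IsMonomial (⊤ : Subgroup Kˣ) y' (Units.map (f : B →* C) g) (A a) := by
  induction hg with
  | gen i => exact hA i
  | scalar u hu =>
    rw [map_zero]
    convert IsMonomial.scalar (y := y') u hu using 1
    ext
    exact f.commutes _
  | mul _ _ h1 h2 => rw [map_mul, map_add]; exact h1.mul h2
  | inv _ h => rw [map_inv, map_neg]; exact h.inv

namespace QuantumTorus

variable {k : Type u} [Field k] {n : ℕ} {Λ : Matrix (Fin n) (Fin n) k}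

/-- The action of the quantum torus on functions on `ℤ^n`. -/
theorem exists_hom_op (hΛ : Λ.MulAntisymmetric) : ∃ f : QuantumTorus k Λ →ₐ[k] Op k n,
    ∀ i, Units.map (f : QuantumTorus k Λ →* Op k n) (unit Λ i) = ShiftRep.unit hΛ.units i := by
  obtain ⟨f, hf⟩ := exists_hom (Λ := Λ) (ShiftRep.unit (k := k) hΛ.units) fun i j =>
    ShiftRep.unit_mul hΛ.units_self hΛ.units_mul i j
  exact ⟨f, fun i => Units.ext (hf i)⟩

theorem nontrivial (hΛ : Λ.MulAntisymmetric) : Nontrivial (QuantumTorus k Λ) := by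
  obtain ⟨f, -⟩ := exists_hom_op hΛ
  exact RingHom.domain_nontrivial (f : QuantumTorus k Λ →+* Op k n)

theorem subalgebra_eq_top (S : Subalgebra k (QuantumTorus k Λ))
    (h : ∀ i, (unit Λ i : QuantumTorus k Λ) ∈ S)
    (h' : ∀ i, (((unit Λ i)⁻¹ : (QuantumTorus k Λ)ˣ) : QuantumTorus k Λ) ∈ S) : S = ⊤ := by
  rw [eq_top_iff, ← adjoin_eq_top, Algebra.adjoin_le_iff]
  rintro _ (⟨i, rfl⟩ | ⟨i, rfl⟩)
  · exact h i
  · exact h' i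

theorem unit_mul_unit (hΛ : Λ.MulAntisymmetric) (i j : Fin n) :
    (unit Λ i : QuantumTorus k Λ) * unit Λ j =
      (hΛ.units i j : k) • ((unit Λ j : QuantumTorus k Λ) * unit Λ i) := y_mul_y i j

/-- The bicharacter of a simple quantum torus is nondegenerate. -/
theorem eq_zero_of_bichar_eq_one (hΛ : Λ.MulAntisymmetric) [IsSimpleRing (QuantumTorus k Λ)]
    {a : Fin n → ℤ} (ha : ∀ b, bichar hΛ.units a b = 1) : a = 0 := by
  classical
  by_contra ha0
  obtain ⟨g, hg⟩ := IsMonomial.exists_of_exp (⊤ : Subgroup kˣ) (unit Λ) a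
  obtain ⟨f, hf⟩ := exists_hom_op hΛ
  have hcomm : ∀ h b, IsMonomial (⊤ : Subgroup kˣ) (unit Λ) h b → h * g = g * h := by
    intro h b hh
    rw [hg.mul_comm' (unit_mul_unit hΛ) hh, ha, map_one, one_mul]
  have hcent : (g : QuantumTorus k Λ) ∈ Subring.center (QuantumTorus k Λ) := by
    have hS := subalgebra_eq_top (Subalgebra.centralizer k {(g : QuantumTorus k Λ)})
      (fun i => by
        rw [Subalgebra.mem_centralizer_iff]
        rintro _ rfl
        exact congrArg Units.val (hcomm _ _ (.gen i)).symm)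
      (fun i => by
        rw [Subalgebra.mem_centralizer_iff]
        rintro _ rfl
        exact congrArg Units.val (hcomm _ _ (IsMonomial.gen i).inv).symm)
    rw [Subring.mem_center_iff]
    intro x
    have hx : x ∈ Subalgebra.centralizer k {(g : QuantumTorus k Λ)} := hS ▸ Algebra.mem_top
    exact ((Subalgebra.mem_centralizer_iff k).mp hx _ rfl).symm
  set T : (Op k n)ˣ := Units.map (f : QuantumTorus k Λ →* Op k n) g with hT
  have hTm : IsMonomial (⊤ : Subgroup kˣ) (ShiftRep.unit hΛ.units) T a :=
    hg.map f (AddMonoidHom.id _) fun i => by rw [hf]; exact .gen i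
  let δ : (Fin n → ℤ) → k := Pi.single 0 1
  have hTz : ∀ j : ℤ, ∃ u : (Fin n → ℤ) → kˣ, ∀ ψ m,
      ((T ^ j : (Op k n)ˣ) : Op k n) ψ m = u m * ψ (m + j • a) :=
    fun j => ShiftRep.apply_of_isMonomial (hTm.zpow j)
  have hinj : ∀ i j : ℤ, i • a = j • a → i = j := fun i j h => smul_left_injective ℤ ha0 h
  let ψ : (Fin n → ℤ) → k := fun m =>
    if h : ∃ j : ℤ, m = -j • a then ((T ^ h.choose : (Op k n)ˣ) : Op k n) δ m else 0
  have hψ : ∀ j : ℤ, ψ (-j • a) = ((T ^ j : (Op k n)ˣ) : Op k n) δ (-j • a) := by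
    intro j
    have h : ∃ i : ℤ, -j • a = -i • a := ⟨j, rfl⟩
    have e : h.choose = j := neg_injective (hinj _ _ h.choose_spec).symm
    simp only [ψ]
    rw [dif_pos h, e]
  have hψ0 : ψ 0 = 1 := by
    have := hψ 0
    simpa [δ] using this
  obtain ⟨u, hu⟩ := ShiftRep.apply_of_isMonomial hTm
  have hTψ : (T : Op k n) ψ = ψ := by
    ext m
    rw [hu]
    by_cases h : ∃ j : ℤ, m = -j • a
    · obtain ⟨j, rfl⟩ := h
      have e : -j • a + a = -(j - 1) • a := by
        rw [neg_sub, sub_smul, one_smul, neg_smul]; abel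
      have hj : T ^ j = T * T ^ (j - 1) := by
        rw [← zpow_one_add, add_sub_cancel]
      rw [hψ, hj, Units.val_mul, Module.End.mul_apply, hu, e, hψ]
    · have h' : ¬ ∃ j : ℤ, m + a = -j • a := by
        rintro ⟨j, hj⟩
        refine h ⟨j + 1, ?_⟩
        rw [eq_sub_of_add_eq hj, neg_add, add_smul]
        simp [sub_eq_add_neg]
      simp only [ψ]
      rw [dif_neg h, dif_neg h', mul_zero]
  have hg1 : (g : QuantumTorus k Λ) - 1 ≠ 0 := by
    intro h
    have hT1 : (T : Op k n) = 1 := by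
      rw [sub_eq_zero] at h
      simp [hT, h]
    have h2 := hu δ (-a)
    rw [hT1, neg_add_cancel] at h2
    simp [δ, ha0] at h2
    exact (u (-a)).ne_zero h2.symm
  obtain ⟨c, hc⟩ := (IsSimpleRing.isField_center (QuantumTorus k Λ)).mul_inv_cancel
    (a := ⟨(g : QuantumTorus k Λ) - 1, Subring.sub_mem _ hcent (Subring.one_mem _)⟩)
    (fun h => hg1 (congrArg Subtype.val h))
  have hc' : (c : QuantumTorus k Λ) * ((g : QuantumTorus k Λ) - 1) = 1 := by
    rw [mul_comm] at hc
    exact congrArg Subtype.val hc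
  have h3 := congrArg f hc'
  rw [map_mul, map_sub, map_one] at h3
  have h4 := congrFun (LinearMap.congr_fun h3 ψ) 0
  have h5 : (f g - 1) ψ = 0 := by
    rw [LinearMap.sub_apply, Module.End.one_apply, sub_eq_zero]
    exact hTψ
  rw [Module.End.mul_apply, h5, map_zero, Module.End.one_apply, hψ0] at h4
  exact zero_ne_one h4

/-- A simple quantum torus is isomorphic to every quantum torus obtained from it by an invertible
change of exponents. -/
theorem nonempty_algEquiv {n' : ℕ} {Λ' : Matrix (Fin n') (Fin n') k} (hΛ : Λ.MulAntisymmetric)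
    (hΛ' : Λ'.MulAntisymmetric) [IsSimpleRing (QuantumTorus k Λ)]
    (A : (Fin n → ℤ) →+ (Fin n' → ℤ)) (hA : Function.Surjective A)
    (h : ∀ i j, bichar hΛ'.units (A (Pi.single i 1)) (A (Pi.single j 1)) = hΛ.units i j) :
    Nonempty (QuantumTorus k Λ ≃ₐ[k] QuantumTorus k Λ') := by
  choose Y hY using IsMonomial.exists_of_exp (⊤ : Subgroup kˣ) (unit Λ')
  obtain ⟨f, hf⟩ := exists_hom (Λ := Λ) (fun i => Y (A (Pi.single i 1))) fun i j => by
    have := congrArg Units.val ((hY (A (Pi.single i 1))).mul_comm' (unit_mul_unit hΛ')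
      (hY (A (Pi.single j 1))))
    rw [h] at this
    rw [← hΛ.val_units, Algebra.smul_def]
    exact this
  have hf' : ∀ i, IsMonomial (⊤ : Subgroup kˣ) (unit Λ')
      (Units.map (f : QuantumTorus k Λ →* QuantumTorus k Λ') (unit Λ i)) (A (Pi.single i 1)) := by
    intro i
    have e : Units.map (f : QuantumTorus k Λ →* QuantumTorus k Λ') (unit Λ i) =
        Y (A (Pi.single i 1)) := Units.ext (hf i)
    rw [e]
    exact hY _
  have := nontrivial hΛ'
  have hmem : ∀ i, ∃ x, unit Λ' i = Units.map (f : QuantumTorus k Λ →* QuantumTorus k Λ') x := by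
    intro i
    obtain ⟨c, hc⟩ := hA (Pi.single i 1)
    obtain ⟨g, hg⟩ := IsMonomial.exists_of_exp (⊤ : Subgroup kˣ) (unit Λ) c
    obtain ⟨u, -, hu⟩ := (IsMonomial.gen (U := (⊤ : Subgroup kˣ)) (y := unit Λ') i).unique
      (unit_mul_unit hΛ') (fun _ _ => Subgroup.mem_top _) ((hg.map f A hf').congr_exp hc)
    refine ⟨scalarUnit _ u * g, ?_⟩
    rw [hu, map_mul]
    congr 1
    ext
    exact (f.commutes _).symm
  refine ⟨AlgEquiv.ofBijective f ⟨RingHom.injective (f : QuantumTorus k Λ →+* QuantumTorus k Λ'),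
    ?_⟩⟩
  rw [← AlgHom.range_eq_top]
  refine subalgebra_eq_top _ (fun i => ?_) fun i => ?_
  · obtain ⟨x, hx⟩ := hmem i
    exact ⟨x, by rw [hx]; rfl⟩
  · obtain ⟨x, hx⟩ := hmem i
    exact ⟨(x⁻¹ : (QuantumTorus k Λ)ˣ), by rw [hx, ← map_inv]; rfl⟩

/-- Simple quantum tori with the same rank whose bicharacters are pulled back from each other are
isomorphic. -/
theorem nonempty_algEquiv_of_exponents {n' : ℕ} (hn : n = n') {Λ' : Matrix (Fin n') (Fin n') k}
    (hΛ : Λ.MulAntisymmetric) (hΛ' : Λ'.MulAntisymmetric) [IsSimpleRing (QuantumTorus k Λ)]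
    {α : Fin n' → Fin n → ℤ} (hα : ∀ i j, bichar hΛ.units (α i) (α j) = hΛ'.units i j)
    {β : Fin n → Fin n' → ℤ} (hβ : ∀ i j, bichar hΛ'.units (β i) (β j) = hΛ.units i j) :
    Nonempty (QuantumTorus k Λ ≃ₐ[k] QuantumTorus k Λ') := by
  subst hn
  obtain ⟨A, -, hA⟩ := bichar.exists_linearMap hα
  obtain ⟨B, hB1, hB⟩ := bichar.exists_linearMap hβ
  have hAB : Function.Surjective (A ∘ₗ B) :=
    LinearMap.surjective_of_preserves_bilin (bicharBilin hΛ.units)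
      (fun a ha => eq_zero_of_bichar_eq_one hΛ fun b => ha b) _
      fun a b => by rw [LinearMap.comp_apply, LinearMap.comp_apply, hA, hB]
  have hAs : Function.Surjective A := Function.Surjective.of_comp (g := B) hAB
  have hAi : Function.Injective A := IsNoetherian.injective_of_surjective_endomorphism A hAs
  have hBs : Function.Surjective B := by
    intro c
    obtain ⟨b, hb⟩ := hAB (A c)
    exact ⟨b, hAi hb⟩
  refine nonempty_algEquiv hΛ hΛ' B.toAddMonoidHom hBs fun i j => ?_
  simp only [LinearMap.toAddMonoidHom_coe, hB1]
  exact hβ i j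

end QuantumTorus

/-- If division rings of fractions of `S_{n,r}^Λ(k)` and
`S_{n',r'}^{Λ'}(k)` are `k`-isomorphic, then `n = n'` and `r = r'`; if moreover
`O_Λ((k*)^n)` is simple, the quantum tori `O_Λ((k*)^n)` and `O_{Λ'}((k*)^{n'})` are
`k`-isomorphic. -/
theorem stmt17 {k : Type u} [Field k] [CharZero k] {n n' : ℕ} (hn : 1 ≤ n) (hn' : 1 ≤ n')
    {r r' : ℕ} (hr : r ≤ n) (hr' : r' ≤ n')
    (Λ : Matrix (Fin n) (Fin n) k) (hΛ : Λ.MulAntisymmetric)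
    (Λ' : Matrix (Fin n') (Fin n') k) (hΛ' : Λ'.MulAntisymmetric)
    (F : FractionDivisionRing k (MixedCrossedAlgebra k Λ r hr))
    (F' : FractionDivisionRing k (MixedCrossedAlgebra k Λ' r' hr'))
    (hiso : Nonempty (F.carrier ≃ₐ[k] F'.carrier)) :
    (n = n' ∧ r = r') ∧
    (IsSimpleRing (QuantumTorus k Λ) →
      Nonempty (QuantumTorus k Λ ≃ₐ[k] QuantumTorus k Λ')) := by
  obtain ⟨e⟩ := hiso
  obtain ⟨y, w, S⟩ := MixedCrossedAlgebra.exists_isQFrame hΛ F.emb F.emb_injective F.frac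
  obtain ⟨y', w', S'⟩ := MixedCrossedAlgebra.exists_isQFrame hΛ'
    ((e.symm : F'.carrier →ₐ[k] F.carrier).comp F'.emb)
    (e.symm.injective.comp F'.emb_injective) fun d => by
      obtain ⟨a, b, hb, hd⟩ := F'.frac (e d)
      refine ⟨a, b, hb, ?_⟩
      rw [← e.symm_apply_apply d, hd, map_mul, map_inv₀]
      rfl
  have hrank := S.rank_eq S' (Fin.castLE_injective hr) (Fin.castLE_injective hr')
  refine ⟨hrank, fun _ => ?_⟩
  obtain ⟨α, hα⟩ := S.exists_exponents S'
  obtain ⟨β, hβ⟩ := S'.exists_exponents S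
  exact QuantumTorus.nonempty_algEquiv_of_exponents hrank.1 hΛ hΛ' hα hβ
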